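/- Let δ ≤ Δ be dyadic in 2^{−ℕ}, ε > 0, and let (𝒫, 𝒯) be a (δ, s, δ^{−ε²}, M)-nice configuration with s ∈ (0,1]. Suppose 𝒫 ⊂ 𝒟_δ satisfies the spacing conditions |𝒫 ∩ B(x,ρ)|_δ ≤ δ^{−ε²} · ρ^{2−s} · |𝒫|_δ for all Δ < ρ < 1, and |𝒫 ∩ B(x,ρ)|_δ ≤ δ^{−ε²} · (ρ/δ)^s for all δ < ρ < Δ (for all x ∈ ℝ²). Then |𝒯|_δ ≳_ε δ^{35ε} · min( M |𝒫|_δ, M^{3/2} |𝒫|_δ^{1/2}, δ^{−1} M ). -/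

import Mathlib

open Set Metric
open scoped Classical

noncomputable section

/-- The half-open dyadic square of side-length `δ` with index `q`. -/
def dSq (δ : ℝ) (q : ℤ × ℤ) : Set (ℝ × ℝ) :=
  Set.Ico ((q.1 : ℝ) * δ) (((q.1 : ℝ) + 1) * δ) ×ˢ Set.Ico ((q.2 : ℝ) * δ) (((q.2 : ℝ) + 1) * δ)

/-- The dyadic `δ`-covering number of a planar set. -/
def covNum (δ : ℝ) (P : Set (ℝ × ℝ)) : ℕ :=
  Nat.card {q : ℤ × ℤ | (dSq δ q ∩ P).Nonempty}

/-- The dyadic `δ`-covering number of a set of reals. -/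
def covNum1 (δ : ℝ) (A : Set ℝ) : ℕ :=
  Nat.card {k : ℤ | (Set.Ico ((k : ℝ) * δ) (((k : ℝ) + 1) * δ) ∩ A).Nonempty}

/-- `A` is a `(δ, s, C)`-set in the plane. -/
def IsDSSet (δ s C : ℝ) (A : Set (ℝ × ℝ)) : Prop :=
  ∀ (x : ℝ × ℝ) (r : ℝ), δ ≤ r → r ≤ 1 →
    (covNum δ (A ∩ Metric.ball x r) : ℝ) ≤ C * r ^ s * (covNum δ A : ℝ)

/-- The line `y = a x + b`, dual to the point `(a, b)`. -/
def dualLine (a b : ℝ) : Set (ℝ × ℝ) := {z : ℝ × ℝ | z.2 = a * z.1 + b}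

/-- The dyadic `δ`-tube `D(p)`, the union of the lines dual to points of the
dyadic `δ`-square with index `q`. -/
def dTube (δ : ℝ) (q : ℤ × ℤ) : Set (ℝ × ℝ) :=
  {z : ℝ × ℝ | ∃ ab ∈ dSq δ q, z.2 = ab.1 * z.1 + ab.2}

/-- The dyadic square with index `q` is contained in `[0,1)²`. -/
def sqInUnit (δ : ℝ) (q : ℤ × ℤ) : Prop :=
  dSq δ q ⊆ Set.Ico (0 : ℝ) 1 ×ˢ Set.Ico (0 : ℝ) 1

/-- The dyadic `δ`-square with index `q` is contained in `[−1,1] × ℝ`, so that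
`dTube δ q` is a legitimate dyadic `δ`-tube. -/
def tubeIdx (δ : ℝ) (q : ℤ × ℤ) : Prop :=
  (-1 : ℝ) ≤ (q.1 : ℝ) * δ ∧ ((q.1 : ℝ) + 1) * δ ≤ 1

/-- Index of the dyadic parent square/tube, when the scale is multiplied by `S`. -/
def parQ (S : ℤ) (q : ℤ × ℤ) : ℤ × ℤ := (Int.fdiv q.1 S, Int.fdiv q.2 S)

/-- The `c·ρ`-neighbourhood of the dyadic `ρ`-tube with index `q`; `c = 6` gives `6T`
and `c = 4` gives `4T`. -/
def nbTube (c ρ : ℝ) (q : ℤ × ℤ) : Set (ℝ × ℝ) :=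
  Metric.cthickening (c * ρ) (dTube ρ q)

/-- The union of the dyadic `δ`-squares indexed by a finite set. -/
def sqUnion (δ : ℝ) (P : Finset (ℤ × ℤ)) : Set (ℝ × ℝ) := ⋃ p ∈ P, dSq δ p

/-- `(𝒫, 𝒯)` is a `(δ, s, C, M)`-nice configuration: every `p ∈ 𝒫` carries a
`(δ, s, C)`-set `𝒯(p) ⊆ 𝒯` of tubes meeting `p`, with `|𝒯(p)| ∼ M`. -/
def NiceConfig (δ s C : ℝ) (M : ℕ) (P T : Finset (ℤ × ℤ))
    (Tp : ℤ × ℤ → Finset (ℤ × ℤ)) : Prop :=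
  (∀ p ∈ P, sqInUnit δ p) ∧ (∀ t ∈ T, tubeIdx δ t) ∧
  ∀ p ∈ P, Tp p ⊆ T ∧ IsDSSet δ s C (sqUnion δ (Tp p)) ∧
    (M : ℝ) ≤ 2 * ((Tp p).card : ℝ) ∧ ((Tp p).card : ℝ) ≤ 2 * (M : ℝ) ∧
    ∀ t ∈ Tp p, (dTube δ t ∩ dSq δ p).Nonempty




def PK (v u : ℝ) : ℝ := v / (v ^ 2 + u ^ 2)

lemma PK_den_pos {v : ℝ} (hv : 0 < v) (u : ℝ) : 0 < v ^ 2 + u ^ 2 := by positivity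

lemma PK_pos {v : ℝ} (hv : 0 < v) (u : ℝ) : 0 < PK v u := by unfold PK; positivity

lemma PK_neg (v u : ℝ) : PK v (-u) = PK v u := by unfold PK; simp

lemma PK_cont {v : ℝ} (hv : 0 < v) : Continuous (PK v) := by
  unfold PK
  exact Continuous.div (by fun_prop) (by fun_prop) (fun u => (PK_den_pos hv u).ne')

lemma PK_le {v : ℝ} (hv : 0 < v) (u : ℝ) : PK v u ≤ 1 / v := by
  unfold PK
  rw [div_le_div_iff₀ (PK_den_pos hv u) hv]; nlinarith [sq_nonneg u]

lemma PK_eq {v : ℝ} (hv : 0 < v) (u : ℝ) : PK v u = v⁻¹ * (1 + (u / v) ^ 2)⁻¹ := by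
  unfold PK; field_simp

lemma PK_integrable {v : ℝ} (hv : 0 < v) : MeasureTheory.Integrable (PK v) := by
  have : PK v = fun u => v⁻¹ * (1 + (u / v) ^ 2)⁻¹ := funext (PK_eq hv)
  rw [this]
  exact (integrable_inv_one_add_sq.comp_div hv.ne').const_mul _

lemma PK_integral {v : ℝ} (hv : 0 < v) : ∫ u, PK v u = Real.pi := by
  have : PK v = fun u => v⁻¹ * (1 + (u / v) ^ 2)⁻¹ := funext (PK_eq hv)
  rw [this, MeasureTheory.integral_const_mul,
    MeasureTheory.Measure.integral_comp_div (fun x : ℝ => (1 + x ^ 2)⁻¹), integral_univ_inv_one_add_sq]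
  rw [abs_of_pos hv, smul_eq_mul]; field_simp

lemma PK_mul_integrable {w v : ℝ} (hw : 0 < w) (hv : 0 < v) (g : ℝ → ℝ) (hg : Continuous g) :
    MeasureTheory.Integrable (fun u => PK w u * PK v (g u)) := by
  refine (PK_integrable hw).mul_bdd (c := 1 / v) ?_ ?_
  · exact ((PK_cont hv).comp hg).aestronglyMeasurable
  · refine Filter.Eventually.of_forall fun u => ?_
    rw [Real.norm_eq_abs, abs_of_pos (PK_pos hv _)]; exact PK_le hv _

lemma tendsto_arctan_top {w : ℝ} (hw : 0 < w) (c : ℝ) :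
    Filter.Tendsto (fun u => Real.arctan ((u - c) / w)) Filter.atTop (nhds (Real.pi / 2)) := by
  refine (Real.tendsto_arctan_atTop.mono_right nhdsWithin_le_nhds).comp ?_
  exact (Filter.tendsto_atTop_add_const_right _ (-c) Filter.tendsto_id).atTop_div_const hw

lemma tendsto_arctan_bot {w : ℝ} (hw : 0 < w) (c : ℝ) :
    Filter.Tendsto (fun u => Real.arctan ((u - c) / w)) Filter.atBot (nhds (-(Real.pi / 2))) := by
  refine (Real.tendsto_arctan_atBot.mono_right nhdsWithin_le_nhds).comp ?_
  exact (Filter.tendsto_atBot_add_const_right _ (-c) Filter.tendsto_id).atBot_div_const hw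

lemma hasDeriv_arctan {w : ℝ} (hw : 0 < w) (c u : ℝ) :
    HasDerivAt (fun u => Real.arctan ((u - c) / w)) (PK w (u - c)) u := by
  have := (((hasDerivAt_id u).sub_const c).div_const w).arctan
  refine HasDerivAt.congr_deriv this ?_
  unfold PK; simp; field_simp

lemma tendsto_logs (F : Filter ℝ) (hF : Filter.Tendsto (fun u : ℝ => u⁻¹) F (nhds 0))
    (hF0 : ∀ᶠ u in F, u ≠ 0) {w v : ℝ} (hw : 0 < w) (hv : 0 < v) (c : ℝ) :
    Filter.Tendsto (fun u => Real.log (w ^ 2 + u ^ 2) - Real.log (v ^ 2 + (u - c) ^ 2)) F (nhds 0) := by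
  have h1 : Filter.Tendsto (fun u : ℝ => ((w * u⁻¹) ^ 2 + 1) / ((v * u⁻¹) ^ 2 + (1 - c * u⁻¹) ^ 2)) F
      (nhds (((w * 0) ^ 2 + 1) / ((v * 0) ^ 2 + (1 - c * 0) ^ 2))) := by
    refine Filter.Tendsto.div ?_ ?_ (by norm_num)
    · exact ((hF.const_mul w).pow 2).add_const 1
    · exact ((hF.const_mul v).pow 2).add (((hF.const_mul c).const_sub 1).pow 2)
  have h2 := h1.log (by norm_num)
  norm_num at h2
  refine h2.congr' ?_
  filter_upwards [hF0] with u hu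
  have p1 := PK_den_pos hw u
  have p2 := PK_den_pos hv (u - c)
  rw [← Real.log_div p1.ne' p2.ne']
  congr 1
  have e1 : (w * u⁻¹) ^ 2 + 1 = (w ^ 2 + u ^ 2) / u ^ 2 := by field_simp
  have e2 : (v * u⁻¹) ^ 2 + (1 - c * u⁻¹) ^ 2 = (v ^ 2 + (u - c) ^ 2) / u ^ 2 := by field_simp
  rw [e1, e2]
  field_simp

lemma PK_conv_gen {w v : ℝ} (hw : 0 < w) (hv : 0 < v) (c : ℝ) (hne : c ^ 2 + (w - v) ^ 2 ≠ 0) :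
    ∫ u, PK w u * PK v (c - u) = Real.pi * PK (w + v) c := by
  have hq2 : 0 < (w + v) ^ 2 + c ^ 2 := by positivity
  set Q := (c ^ 2 + (w - v) ^ 2) * ((w + v) ^ 2 + c ^ 2) with hQ
  have hQ0 : Q ≠ 0 := mul_ne_zero hne hq2.ne'
  set al := w * v * (2 * c) / Q with hal
  set be := v * (c ^ 2 - w ^ 2 + v ^ 2) / Q with hbe
  set ka := w * (c ^ 2 - v ^ 2 + w ^ 2) / Q with hka
  set F : ℝ → ℝ := fun u => al / 2 * (Real.log (w ^ 2 + u ^ 2) - Real.log (v ^ 2 + (u - c) ^ 2)) +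
    be * Real.arctan ((u - 0) / w) + ka * Real.arctan ((u - c) / v) with hFdef
  have hder : ∀ u, HasDerivAt F (PK w u * PK v (c - u)) u := by
    intro u
    have p1 := PK_den_pos hw u
    have p2 := PK_den_pos hv (u - c)
    have d1 : HasDerivAt (fun u => Real.log (w ^ 2 + u ^ 2)) (2 * u / (w ^ 2 + u ^ 2)) u := by
      have := (((hasDerivAt_id u).pow 2).const_add (w ^ 2)).log p1.ne'
      simpa using this
    have d2 : HasDerivAt (fun u => Real.log (v ^ 2 + (u - c) ^ 2)) (2 * (u - c) / (v ^ 2 + (u - c) ^ 2)) u := by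
      have := ((((hasDerivAt_id u).sub_const c).pow 2).const_add (v ^ 2)).log p2.ne'
      simpa using this
    have := ((((d1.sub d2).const_mul (al / 2)).add ((hasDeriv_arctan hw 0 u).const_mul be)).add
      ((hasDeriv_arctan hv c u).const_mul ka))
    refine HasDerivAt.congr_deriv this ?_
    symm
    rw [show c - u = -(u - c) by ring, PK_neg]
    unfold PK
    rw [hal, hbe, hka]
    simp only [sub_zero]
    generalize hA : w ^ 2 + u ^ 2 = A at *
    generalize hB : v ^ 2 + (u - c) ^ 2 = B at *
    have hA0 := p1.ne'
    have hB0 := p2.ne'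
    field_simp
    rw [hQ, ← hA, ← hB]
    ring
  have hintg := PK_mul_integrable hw hv (fun u => c - u) (by fun_prop)
  have lim0 : Filter.Tendsto F Filter.atTop (nhds (al / 2 * 0 + be * (Real.pi / 2) + ka * (Real.pi / 2))) := by
    refine ((tendsto_logs _ tendsto_inv_atTop_zero (Filter.eventually_ne_atTop 0) hw hv c).const_mul _).add
      ((tendsto_arctan_top hw 0).const_mul _) |>.add ((tendsto_arctan_top hv c).const_mul _)
  have lim1 : Filter.Tendsto F Filter.atBot (nhds (al / 2 * 0 + be * (-(Real.pi / 2)) + ka * (-(Real.pi / 2)))) := by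
    refine ((tendsto_logs _ tendsto_inv_atBot_zero (Filter.eventually_ne_atBot 0) hw hv c).const_mul _).add
      ((tendsto_arctan_bot hw 0).const_mul _) |>.add ((tendsto_arctan_bot hv c).const_mul _)
  rw [MeasureTheory.integral_of_hasDerivAt_of_tendsto hder hintg lim1 lim0]
  have : be + ka = PK (w + v) c := by
    rw [hbe, hka, hQ]; unfold PK
    field_simp
    ring
  rw [← this]; ring

lemma PK_conv_deg {w : ℝ} (hw : 0 < w) :
    ∫ u, PK w u * PK w (0 - u) = Real.pi * PK (w + w) 0 := by
  set F : ℝ → ℝ := fun u => 1 / 2 * (u / (w ^ 2 + u ^ 2)) * w ^ 2 / w ^ 2 + 1 / (2 * w) * Real.arctan ((u - 0) / w) with hF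
  have hder : ∀ u, HasDerivAt F (PK w u * PK w (0 - u)) u := by
    intro u
    have p1 := PK_den_pos hw u
    have d1 := (hasDerivAt_id u).div (((hasDerivAt_id u).pow 2).const_add (w ^ 2)) p1.ne'
    have := (((d1.const_mul (1 / 2 : ℝ)).mul_const (w ^ 2)).div_const (w ^ 2)).add
      ((hasDeriv_arctan hw 0 u).const_mul (1 / (2 * w)))
    refine HasDerivAt.congr_deriv this ?_
    symm
    rw [zero_sub, PK_neg]
    unfold PK
    simp only [id, sub_zero, Pi.pow_apply]
    field_simp
    norm_num
    ring
  have hintg := PK_mul_integrable hw hw (fun u => 0 - u) (by fun_prop)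
  have key : ∀ G : Filter ℝ, Filter.Tendsto (fun u : ℝ => u⁻¹) G (nhds 0) → (∀ᶠ u in G, u ≠ 0) →
      Filter.Tendsto (fun u : ℝ => 1 / 2 * (u / (w ^ 2 + u ^ 2)) * w ^ 2 / w ^ 2) G (nhds 0) := by
    intro G h0 hne
    have h1 : Filter.Tendsto (fun u : ℝ => 1 / 2 * (u⁻¹ / ((w * u⁻¹) ^ 2 + 1)) * w ^ 2 / w ^ 2) G
        (nhds (1 / 2 * (0 / ((w * 0) ^ 2 + 1)) * w ^ 2 / w ^ 2)) := by
      refine (((h0.div (((h0.const_mul w).pow 2).add_const 1) (by norm_num)).const_mul _).mul_const _).div_const _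
    norm_num at h1
    refine h1.congr' ?_
    filter_upwards [hne] with u hu
    field_simp
  have lim0 := (key _ tendsto_inv_atTop_zero (Filter.eventually_ne_atTop 0)).add ((tendsto_arctan_top hw 0).const_mul (1 / (2 * w)))
  have lim1 := (key _ tendsto_inv_atBot_zero (Filter.eventually_ne_atBot 0)).add ((tendsto_arctan_bot hw 0).const_mul (1 / (2 * w)))
  rw [MeasureTheory.integral_of_hasDerivAt_of_tendsto hder hintg lim1 lim0]
  unfold PK
  field_simp
  ring

lemma PK_conv {w v : ℝ} (hw : 0 < w) (hv : 0 < v) (c : ℝ) :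
    ∫ u, PK w u * PK v (c - u) = Real.pi * PK (w + v) c := by
  by_cases hne : c ^ 2 + (w - v) ^ 2 = 0
  · have h1 : c = 0 := by nlinarith [sq_nonneg c, sq_nonneg (w - v)]
    have h2 : w = v := by
      have : (w - v) ^ 2 = 0 := by nlinarith [sq_nonneg c, sq_nonneg (w - v)]
      have := pow_eq_zero_iff (two_ne_zero) |>.1 this
      linarith
    subst h1 h2
    exact PK_conv_deg hw
  · exact PK_conv_gen hw hv c hne

/-- integral in the intercept -/
lemma PK_conv_beta {w v : ℝ} (hw : 0 < w) (hv : 0 < v) (s t : ℝ) :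
    ∫ b, PK w (s - b) * PK v (t - b) = Real.pi * PK (w + v) (t - s) := by
  rw [← PK_conv hw hv (t - s), ← MeasureTheory.integral_sub_right_eq_self (fun u => PK w u * PK v (t - s - u)) s]
  congr 1; ext b
  rw [← PK_neg w (s - b)]
  congr 2 <;> ring

lemma PK_beta_integrable {w v : ℝ} (hw : 0 < w) (hv : 0 < v) (s t : ℝ) :
    MeasureTheory.Integrable (fun b => PK w (s - b) * PK v (t - b)) := by
  have := (PK_mul_integrable hw hv (fun u => t - s + u) (by fun_prop)).comp_sub_left s
  refine this.congr (Filter.Eventually.of_forall fun b => ?_)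
  simp only
  congr 2; ring

/-- integral in the slope -/
lemma PK_conv_slope {v : ℝ} (hv : 0 < v) (x y : ℝ) :
    ∫ a, PK 1 a * PK v (y - a * x) = Real.pi * PK (v + |x|) y := by
  by_cases hx : x = 0
  · subst hx
    simp only [mul_zero, sub_zero, abs_zero, add_zero]
    rw [MeasureTheory.integral_mul_const, PK_integral one_pos]
  · have hax : 0 < |x| := abs_pos.2 hx
    have e : ∀ a, PK 1 a * PK v (y - a * x) = |x|⁻¹ * (PK 1 a * PK (v / |x|) (y / x - a)) := by
      intro a
      have : PK v (y - a * x) = |x|⁻¹ * PK (v / |x|) (y / x - a) := by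
        unfold PK
        rw [div_pow, sq_abs]
        have h1 : y - a * x = x * (y / x - a) := by field_simp
        rw [h1]
        generalize y / x - a = z
        have h2 : (v ^ 2 / x ^ 2 + z ^ 2) = (v ^ 2 + (x * z) ^ 2) / x ^ 2 := by field_simp
        rw [h2, ← sq_abs x]
        have : 0 < v ^ 2 + (x * z) ^ 2 := by positivity
        field_simp
      rw [this]; ring
    simp_rw [e]
    rw [MeasureTheory.integral_const_mul, PK_conv one_pos (div_pos hv hax)]
    unfold PK
    rw [div_pow]
    have h2 : (1 + v / |x|) ^ 2 + y ^ 2 / x ^ 2 = ((v + |x|) ^ 2 + y ^ 2) / |x| ^ 2 := by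
      rw [← sq_abs x]; field_simp; ring
    rw [h2]
    have : 0 < (v + |x|) ^ 2 + y ^ 2 := by positivity
    field_simp
    ring


lemma sum_le_integral_cells (g : ℝ → ℝ) (hg : MeasureTheory.Integrable g) (hg0 : ∀ x, 0 ≤ g x)
    (I : Finset ℤ) (c : ℤ → ℝ) (α : ℝ) (hα : 0 < α)
    (h : ∀ i ∈ I, ∀ x, (i : ℝ) * α ≤ x → x < ((i : ℝ) + 1) * α → c i ≤ g x) :
    ∑ i ∈ I, α * c i ≤ ∫ x, g x := by
  have hdisj : (↑I : Set ℤ).Pairwise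
      (Function.onFun Disjoint fun i : ℤ => Set.Ico ((i : ℝ) * α) (((i : ℝ) + 1) * α)) := by
    intro i _ j _ hij
    refine Set.disjoint_left.2 ?_
    rintro x ⟨h1, h2⟩ ⟨h3, h4⟩
    apply hij
    have a1 : (i : ℝ) < j + 1 := by
      by_contra hh; push Not at hh; nlinarith
    have a2 : (j : ℝ) < i + 1 := by
      by_contra hh; push Not at hh; nlinarith
    have b1 : i < j + 1 := by exact_mod_cast a1
    have b2 : j < i + 1 := by exact_mod_cast a2
    omega
  have h1 := MeasureTheory.integral_biUnion_finset (μ := MeasureTheory.volume) (f := g) I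
    (s := fun i : ℤ => Set.Ico ((i : ℝ) * α) (((i : ℝ) + 1) * α))
    (fun i _ => measurableSet_Ico) hdisj (fun i _ => hg.integrableOn)
  calc ∑ i ∈ I, α * c i ≤ ∑ i ∈ I, ∫ x in Set.Ico ((i : ℝ) * α) (((i : ℝ) + 1) * α), g x := by
        refine Finset.sum_le_sum fun i hi => ?_
        have := MeasureTheory.setIntegral_ge_of_const_le_real (μ := MeasureTheory.volume) (f := g) (c := c i)
          (s := Set.Ico ((i : ℝ) * α) (((i : ℝ) + 1) * α)) measurableSet_Ico
          (by simp) (fun x hx => h i hi x hx.1 hx.2) hg.integrableOn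
        refine le_trans (le_of_eq ?_) this
        rw [Real.volume_real_Ico_of_le (by nlinarith)]; ring
    _ = ∫ x in (⋃ i ∈ I, Set.Ico ((i : ℝ) * α) (((i : ℝ) + 1) * α)), g x := h1.symm
    _ ≤ ∫ x, g x := MeasureTheory.setIntegral_le_integral hg (Filter.Eventually.of_forall hg0)

/-- The kernel obtained after averaging over slopes. -/
def KK (w x y : ℝ) : ℝ :=
  PK (2 * w + |x|) y - 2 * PK (3 * w + |x|) y + PK (4 * w + |x|) y

def hh {ι : Type*} (S : Finset ι) (x y : ι → ℝ) (w a b : ℝ) : ℝ :=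
  ∑ p ∈ S, (PK w (y p - a * x p - b) - PK (2 * w) (y p - a * x p - b))

lemma PP_integrable {w : ℝ} (hw : 0 < w) (s t : ℝ) :
    MeasureTheory.Integrable (fun b => (PK w (s - b) - PK (2 * w) (s - b)) * (PK w (t - b) - PK (2 * w) (t - b))) := by
  have h2 : 0 < 2 * w := by positivity
  have := (((PK_beta_integrable hw hw s t).sub (PK_beta_integrable hw h2 s t)).sub
    (PK_beta_integrable h2 hw s t)).add (PK_beta_integrable h2 h2 s t)
  refine this.congr (Filter.Eventually.of_forall fun b => ?_)
  simp only [Pi.add_apply, Pi.sub_apply]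
  ring

lemma PP_integral {w : ℝ} (hw : 0 < w) (s t : ℝ) :
    ∫ b, (PK w (s - b) - PK (2 * w) (s - b)) * (PK w (t - b) - PK (2 * w) (t - b)) =
      Real.pi * (PK (2 * w) (t - s) - 2 * PK (3 * w) (t - s) + PK (4 * w) (t - s)) := by
  have h2 : 0 < 2 * w := by positivity
  have e : ∀ b, (PK w (s - b) - PK (2 * w) (s - b)) * (PK w (t - b) - PK (2 * w) (t - b)) =
    PK w (s - b) * PK w (t - b) - PK w (s - b) * PK (2 * w) (t - b) -
      PK (2 * w) (s - b) * PK w (t - b) + PK (2 * w) (s - b) * PK (2 * w) (t - b) := fun b => by ring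
  simp_rw [e]
  rw [MeasureTheory.integral_add, MeasureTheory.integral_sub, MeasureTheory.integral_sub,
    PK_conv_beta hw hw, PK_conv_beta hw h2, PK_conv_beta h2 hw, PK_conv_beta h2 h2]
  · rw [show w + w = 2 * w by ring, show w + 2 * w = 3 * w by ring, show 2 * w + w = 3 * w by ring,
      show 2 * w + 2 * w = 4 * w by ring]; ring
  · exact PK_beta_integrable hw hw s t
  · exact PK_beta_integrable hw h2 s t
  · exact (PK_beta_integrable hw hw s t).sub (PK_beta_integrable hw h2 s t)
  · exact PK_beta_integrable h2 hw s t
  · exact ((PK_beta_integrable hw hw s t).sub (PK_beta_integrable hw h2 s t)).sub (PK_beta_integrable h2 hw s t)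
  · exact PK_beta_integrable h2 h2 s t

lemma hh_sq_integrable {ι : Type*} (S : Finset ι) (x y : ι → ℝ) {w : ℝ} (hw : 0 < w) (a : ℝ) :
    MeasureTheory.Integrable (fun b => hh S x y w a b ^ 2) := by
  have e : (fun b => hh S x y w a b ^ 2) = fun b => ∑ p ∈ S, ∑ q ∈ S,
      (PK w (y p - a * x p - b) - PK (2 * w) (y p - a * x p - b)) *
      (PK w (y q - a * x q - b) - PK (2 * w) (y q - a * x q - b)) := by
    ext b; unfold hh; rw [sq, Finset.sum_mul_sum]
  rw [e]
  exact MeasureTheory.integrable_finsetSum _ fun p _ => MeasureTheory.integrable_finsetSum _ fun q _ => PP_integrable hw _ _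

lemma hh_sq_integral {ι : Type*} (S : Finset ι) (x y : ι → ℝ) {w : ℝ} (hw : 0 < w) (a : ℝ) :
    ∫ b, hh S x y w a b ^ 2 = ∑ p ∈ S, ∑ q ∈ S, Real.pi *
      (PK (2 * w) ((y q - y p) - a * (x q - x p)) - 2 * PK (3 * w) ((y q - y p) - a * (x q - x p))
        + PK (4 * w) ((y q - y p) - a * (x q - x p))) := by
  have e : (fun b => hh S x y w a b ^ 2) = fun b => ∑ p ∈ S, ∑ q ∈ S,
      (PK w (y p - a * x p - b) - PK (2 * w) (y p - a * x p - b)) *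
      (PK w (y q - a * x q - b) - PK (2 * w) (y q - a * x q - b)) := by
    ext b; unfold hh; rw [sq, Finset.sum_mul_sum]
  rw [e, MeasureTheory.integral_finsetSum _ fun p _ => MeasureTheory.integrable_finsetSum _ fun q _ => PP_integrable hw _ _]
  refine Finset.sum_congr rfl fun p _ => ?_
  rw [MeasureTheory.integral_finsetSum _ fun q _ => PP_integrable hw _ _]
  refine Finset.sum_congr rfl fun q _ => ?_
  rw [PP_integral hw]
  rw [show y q - a * x q - (y p - a * x p) = (y q - y p) - a * (x q - x p) by ring]

lemma slope_integrable {w : ℝ} (hw : 0 < w) (x y : ℝ) :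
    MeasureTheory.Integrable (fun a => PK 1 a * (PK (2 * w) (y - a * x) - 2 * PK (3 * w) (y - a * x)
        + PK (4 * w) (y - a * x))) := by
  have hc : Continuous (fun a : ℝ => y - a * x) := by fun_prop
  have := ((PK_mul_integrable one_pos (by positivity : 0 < 2 * w) _ hc).sub
    ((PK_mul_integrable one_pos (by positivity : 0 < 3 * w) _ hc).const_mul 2)).add
    (PK_mul_integrable one_pos (by positivity : 0 < 4 * w) _ hc)
  refine this.congr (Filter.Eventually.of_forall fun b => ?_)
  simp only [Pi.add_apply, Pi.sub_apply]
  ring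

lemma slope_integral {w : ℝ} (hw : 0 < w) (x y : ℝ) :
    ∫ a, PK 1 a * (PK (2 * w) (y - a * x) - 2 * PK (3 * w) (y - a * x)
        + PK (4 * w) (y - a * x)) = Real.pi * KK w x y := by
  have hc : Continuous (fun a : ℝ => y - a * x) := by fun_prop
  have i1 := (PK_mul_integrable one_pos (by positivity : 0 < 2 * w) _ hc)
  have i2 := (PK_mul_integrable one_pos (by positivity : 0 < 3 * w) _ hc).const_mul 2
  have i3 := (PK_mul_integrable one_pos (by positivity : 0 < 4 * w) _ hc)
  have e : ∀ a, PK 1 a * (PK (2 * w) (y - a * x) - 2 * PK (3 * w) (y - a * x)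
        + PK (4 * w) (y - a * x)) = PK 1 a * PK (2 * w) (y - a * x) - 2 * (PK 1 a * PK (3 * w) (y - a * x))
        + PK 1 a * PK (4 * w) (y - a * x) := fun a => by ring
  simp_rw [e]
  have t1 := MeasureTheory.integral_add (i1.sub i2) i3
  have t2 := MeasureTheory.integral_sub i1 i2
  simp only [Pi.sub_apply] at t1
  rw [t1, t2,
    MeasureTheory.integral_const_mul, PK_conv_slope (by positivity), PK_conv_slope (by positivity),
    PK_conv_slope (by positivity)]
  unfold KK; ring

lemma total_eq {ι : Type*} (S : Finset ι) (x y : ι → ℝ) {w : ℝ} (hw : 0 < w) :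
    MeasureTheory.Integrable (fun a => PK 1 a * ∫ b, hh S x y w a b ^ 2) ∧
    ∫ a, PK 1 a * ∫ b, hh S x y w a b ^ 2 =
      Real.pi ^ 2 * ∑ p ∈ S, ∑ q ∈ S, KK w (x q - x p) (y q - y p) := by
  have e : (fun a => PK 1 a * ∫ b, hh S x y w a b ^ 2) = fun a => ∑ p ∈ S, ∑ q ∈ S, Real.pi *
      (PK 1 a * (PK (2 * w) ((y q - y p) - a * (x q - x p)) - 2 * PK (3 * w) ((y q - y p) - a * (x q - x p))
        + PK (4 * w) ((y q - y p) - a * (x q - x p)))) := by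
    ext a
    rw [hh_sq_integral S x y hw, Finset.mul_sum]
    refine Finset.sum_congr rfl fun p _ => ?_
    rw [Finset.mul_sum]
    refine Finset.sum_congr rfl fun q _ => by ring
  rw [e]
  constructor
  · exact MeasureTheory.integrable_finsetSum _ fun p _ => MeasureTheory.integrable_finsetSum _ fun q _ =>
      (slope_integrable hw _ _).const_mul _
  · rw [MeasureTheory.integral_finsetSum _ fun p _ => MeasureTheory.integrable_finsetSum _ fun q _ =>
      (slope_integrable hw _ _).const_mul _, Finset.mul_sum]
    refine Finset.sum_congr rfl fun p _ => ?_
    rw [MeasureTheory.integral_finsetSum _ fun q _ => (slope_integrable hw _ _).const_mul _, Finset.mul_sum]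
    refine Finset.sum_congr rfl fun q _ => ?_
    rw [MeasureTheory.integral_const_mul, slope_integral hw]; ring

lemma PK_re (v u : ℝ) : PK v u = ((1 : ℂ) / (v + u * Complex.I)).re := by
  unfold PK
  simp [Complex.normSq_apply, sq]

lemma KK_le {w : ℝ} (hw : 0 < w) (x y R : ℝ) (hR : 0 < R) (h : R ≤ 2 * w + |x| ∨ R ≤ |y|) :
    KK w x y ≤ 2 * w ^ 2 / R ^ 3 := by
  have hx := abs_nonneg x
  set m := 3 * w + |x| with hm
  set z : ℂ := (m : ℂ) + y * Complex.I with hz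
  have nz : ∀ t : ℝ, -w ≤ t → R ≤ ‖z + t‖ := by
    intro t ht
    have hre : (z + t).re = m + t := by simp [hz]
    have him : (z + t).im = y := by simp [hz]
    rcases h with h | h
    · calc R ≤ m + t := by rw [hm]; linarith
        _ = (z + t).re := hre.symm
        _ ≤ ‖z + t‖ := Complex.re_le_norm _
    · calc R ≤ |y| := h
        _ = |(z + t).im| := by rw [him]
        _ ≤ ‖z + t‖ := Complex.abs_im_le_norm _
  have n0 := nz 0 (by linarith)
  have n1 := nz w (by linarith)
  have n2 := nz (-w) (by linarith)
  have p0 : z + (0 : ℝ) ≠ 0 := norm_pos_iff.1 (lt_of_lt_of_le hR n0)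
  have p1 : z + (w : ℝ) ≠ 0 := norm_pos_iff.1 (lt_of_lt_of_le hR n1)
  have p2 : z + ((-w : ℝ) : ℂ) ≠ 0 := norm_pos_iff.1 (lt_of_lt_of_le hR n2)
  have key : KK w x y = ((2 * w ^ 2 : ℂ) / ((z + (0 : ℝ)) * (z + (w : ℝ)) * (z + ((-w : ℝ) : ℂ)))).re := by
    have e : (2 * w ^ 2 : ℂ) / ((z + (0 : ℝ)) * (z + (w : ℝ)) * (z + ((-w : ℝ) : ℂ))) =
        1 / (z + ((-w : ℝ) : ℂ)) - ((2 : ℝ) : ℂ) * (1 / (z + (0 : ℝ))) + 1 / (z + (w : ℝ)) := by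
      field_simp
      push_cast
      ring
    rw [e]
    unfold KK
    rw [PK_re, PK_re, PK_re]
    rw [Complex.add_re, Complex.sub_re, Complex.re_ofReal_mul]
    have q1 : ((2 * w + |x| : ℝ) : ℂ) + y * Complex.I = z + ((-w : ℝ) : ℂ) := by
      rw [hz, hm]; push_cast; ring
    have q2 : ((3 * w + |x| : ℝ) : ℂ) + y * Complex.I = z + (0 : ℝ) := by
      rw [hz, hm]; push_cast; ring
    have q3 : ((4 * w + |x| : ℝ) : ℂ) + y * Complex.I = z + (w : ℝ) := by
      rw [hz, hm]; push_cast; ring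
    rw [q1, q2, q3]
  rw [key]
  refine (Complex.re_le_norm _).trans ?_
  rw [norm_div]
  have : ‖(2 * w ^ 2 : ℂ)‖ = 2 * w ^ 2 := by
    rw [show (2 * w ^ 2 : ℂ) = ((2 * w ^ 2 : ℝ) : ℂ) by push_cast; ring, Complex.norm_real,
      Real.norm_of_nonneg (by positivity)]
  rw [this, norm_mul, norm_mul]
  refine div_le_div_of_nonneg_left (by positivity) (by positivity) ?_
  calc R ^ 3 = R * R * R := by ring
    _ ≤ _ := by gcongr

lemma PK_one_ge {a : ℝ} (ha : |a| ≤ 2) : 1 / 5 ≤ PK 1 a := by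
  unfold PK
  have : a ^ 2 ≤ 4 := by nlinarith [sq_abs a, abs_nonneg a]
  rw [div_le_div_iff₀ (by norm_num) (by positivity)]; nlinarith

/-- **High-frequency (energy) estimate**. -/
lemma energy {ι : Type*} (S : Finset ι) (x y : ι → ℝ) {w : ℝ} (hw : 0 < w)
    (C : Finset (ℤ × ℤ)) (α β H : ℝ) (hα : 0 < α) (hβ : 0 < β) (hH : 0 ≤ H)
    (h : ∀ c ∈ C, ∀ a b, (c.1 : ℝ) * α ≤ a → a < ((c.1 : ℝ) + 1) * α →
      (c.2 : ℝ) * β ≤ b → b < ((c.2 : ℝ) + 1) * β → |a| ≤ 2 ∧ H ≤ hh S x y w a b) :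
    (C.card : ℝ) * (α * β * H ^ 2 / 5) ≤
      Real.pi ^ 2 * ∑ p ∈ S, ∑ q ∈ S, KK w (x q - x p) (y q - y p) := by
  obtain ⟨ti, te⟩ := total_eq S x y hw
  rw [← te]
  have hb0 : ∀ a, 0 ≤ ∫ b, hh S x y w a b ^ 2 := fun a =>
    MeasureTheory.integral_nonneg fun b => sq_nonneg _
  have main := sum_le_integral_cells _ ti (fun a => mul_nonneg (PK_pos one_pos a).le (hb0 a))
    (C.image Prod.fst) (fun i => 1 / 5 * ((C.filter (fun c => c.1 = i)).card * (β * H ^ 2))) α hα ?_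
  · refine le_trans (le_of_eq ?_) main
    have hc : (C.card : ℝ) = ∑ i ∈ C.image Prod.fst, ((C.filter (fun c => c.1 = i)).card : ℝ) := by
      exact_mod_cast Finset.card_eq_sum_card_image Prod.fst C
    rw [hc, Finset.sum_mul]
    refine Finset.sum_congr rfl fun i _ => by ring
  · intro i hi a ha1 ha2
    obtain ⟨c0, hc0, hc0i⟩ := Finset.mem_image.1 hi
    subst hc0i
    refine mul_le_mul ?_ ?_ (by positivity) (PK_pos one_pos a).le
    · refine PK_one_ge (h c0 hc0 a (c0.2 * β) ha1 ha2 le_rfl (by nlinarith)).1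
    · have := sum_le_integral_cells _ (hh_sq_integrable S x y hw a) (fun b => sq_nonneg _)
        ((C.filter (fun c => c.1 = c0.1)).image Prod.snd) (fun _ => H ^ 2) β hβ ?_
      · refine le_trans (le_of_eq ?_) this
        rw [Finset.sum_const, Finset.card_image_of_injOn, nsmul_eq_mul]
        intro c hc c' hc' hcc
        simp only [Finset.coe_filter, Set.mem_ofPred_eq] at hc hc'
        exact Prod.ext (hc.2.trans hc'.2.symm) hcc
      · intro j hj b hb1 hb2
        obtain ⟨c, hc, rfl⟩ := Finset.mem_image.1 hj
        obtain ⟨hcC, hce⟩ := Finset.mem_filter.1 hc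
        have := (h c hcC a b (by rw [hce]; exact ha1) (by rw [hce]; exact ha2) hb1 hb2).2
        gcongr


/-- index of the dyadic square of side `2^j` containing the integer point -/
def sqi (j : ℕ) (p : ℤ × ℤ) : ℤ × ℤ := (p.1 / 2 ^ j, p.2 / 2 ^ j)

/-- sup distance -/
def ddn (p q : ℤ × ℤ) : ℕ := max (p.1 - q.1).natAbs (p.2 - q.2).natAbs

/-- vertical displacement of the point from the line -/
def uu (D : ℝ) (t p : ℤ × ℤ) : ℝ := (p.2 : ℝ) - (t.1 : ℝ) / D * p.1 - t.2

lemma layer_sum {α : Type*} (S : Finset α) (φ : α → ℝ) (lev : α → ℕ) (A G θ γ : ℝ)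
    (hA : 0 ≤ A) (hG : 0 ≤ G) (hθ : 0 ≤ θ) (hθγ : θ * γ = 1 / 2)
    (h1 : ∀ p ∈ S, φ p ≤ A * θ ^ lev p)
    (h2 : ∀ k, ((S.filter (fun p => lev p = k)).card : ℝ) ≤ G * γ ^ k) :
    ∑ p ∈ S, φ p ≤ 2 * A * G := by
  set m := S.sup lev + 1 with hm
  have hmap : ∀ p ∈ S, lev p ∈ Finset.range m := fun p hp =>
    Finset.mem_range.2 (Nat.lt_succ_of_le (Finset.le_sup hp))
  calc ∑ p ∈ S, φ p ≤ ∑ p ∈ S, A * θ ^ lev p := Finset.sum_le_sum h1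
    _ = ∑ k ∈ Finset.range m, ∑ p ∈ S.filter (fun p => lev p = k), A * θ ^ lev p :=
        (Finset.sum_fiberwise_of_maps_to hmap _).symm
    _ = ∑ k ∈ Finset.range m, ((S.filter (fun p => lev p = k)).card : ℝ) * (A * θ ^ k) := by
        refine Finset.sum_congr rfl fun k _ => ?_
        rw [← nsmul_eq_mul, ← Finset.sum_const]
        refine Finset.sum_congr rfl fun p hp => ?_
        rw [(Finset.mem_filter.1 hp).2]
    _ ≤ ∑ k ∈ Finset.range m, A * G * (1 / 2) ^ k := by
        refine Finset.sum_le_sum fun k _ => ?_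
        calc ((S.filter (fun p => lev p = k)).card : ℝ) * (A * θ ^ k) ≤ G * γ ^ k * (A * θ ^ k) := by
              have := h2 k
              gcongr
          _ = A * G * (1 / 2) ^ k := by rw [← hθγ, mul_pow]; ring
    _ = A * G * ∑ k ∈ Finset.range m, (1 / 2 : ℝ) ^ k := by rw [Finset.mul_sum]
    _ ≤ A * G * 2 := by
        have := sum_geometric_two_le m
        gcongr
    _ = 2 * A * G := by ring

lemma rect_count (S : Finset (ℤ × ℤ)) (j V : ℕ)
    (hV : ∀ Q, (S.filter (fun p => sqi j p = Q)).card ≤ V) (a b c d : ℤ)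
    (h : ∀ p ∈ S, a ≤ p.1 / 2 ^ j ∧ p.1 / 2 ^ j ≤ b ∧ c ≤ p.2 / 2 ^ j ∧ p.2 / 2 ^ j ≤ d) :
    S.card ≤ V * ((b + 1 - a).toNat * (d + 1 - c).toNat) := by
  have := Finset.card_le_mul_card_image_of_maps_to (s := S) (t := Finset.Icc a b ×ˢ Finset.Icc c d) (f := sqi j)
    (fun p hp => by
      have := h p hp
      simp only [sqi, Finset.mem_product, Finset.mem_Icc]
      tauto) V (fun Q _ => hV Q)
  simpa using this

lemma div_range {a b : ℤ} {j : ℕ} {m : ℤ} (h1 : |a - b| < m * 2 ^ j) :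
    |a / 2 ^ j - b / 2 ^ j| ≤ m := by
  have hp : (0 : ℤ) < 2 ^ j := by positivity
  rw [abs_lt] at h1
  have a1 := Int.ediv_mul_le a hp.ne'
  have a2 := Int.lt_ediv_add_one_mul_self a hp
  have b1 := Int.ediv_mul_le b hp.ne'
  have b2 := Int.lt_ediv_add_one_mul_self b hp
  rw [abs_le]
  constructor
  · by_contra hh; push Not at hh
    nlinarith
  · by_contra hh; push Not at hh
    nlinarith

lemma box_count (S : Finset (ℤ × ℤ)) (j V : ℕ)
    (hV : ∀ Q, (S.filter (fun p => sqi j p = Q)).card ≤ V) (p : ℤ × ℤ) (k : ℕ) :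
    (S.filter (fun q => ddn p q < 2 ^ k * 2 ^ j)).card ≤ 9 * 4 ^ k * V := by
  have := rect_count (S.filter (fun q => ddn p q < 2 ^ k * 2 ^ j)) j V
    (fun Q => (Finset.card_le_card (Finset.filter_subset_filter _ (Finset.filter_subset _ _))).trans (hV Q))
    (p.1 / 2 ^ j - 2 ^ k) (p.1 / 2 ^ j + 2 ^ k) (p.2 / 2 ^ j - 2 ^ k) (p.2 / 2 ^ j + 2 ^ k) ?_
  · refine this.trans ?_
    have e : ∀ z : ℤ, (z + 2 ^ k + 1 - (z - 2 ^ k)).toNat = 2 * 2 ^ k + 1 := by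
      intro z
      have : z + 2 ^ k + 1 - (z - 2 ^ k) = ((2 * 2 ^ k + 1 : ℕ) : ℤ) := by push_cast; ring
      rw [this, Int.toNat_natCast]
    rw [e, e]
    have h1 : 1 ≤ 2 ^ k := Nat.one_le_two_pow
    have h4 : (4 : ℕ) ^ k = 2 ^ k * 2 ^ k := by rw [← mul_pow]; norm_num
    rw [h4]
    calc V * ((2 * 2 ^ k + 1) * (2 * 2 ^ k + 1)) ≤ V * ((3 * 2 ^ k) * (3 * 2 ^ k)) := by gcongr <;> omega
      _ = _ := by ring
  · intro q hq
    have hq := (Finset.mem_filter.1 hq).2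
    unfold ddn at hq
    rw [max_lt_iff] at hq
    have c1 : |q.1 - p.1| < 2 ^ k * 2 ^ j := by
      rw [abs_sub_comm, Int.abs_eq_natAbs]; exact_mod_cast hq.1
    have c2 : |q.2 - p.2| < 2 ^ k * 2 ^ j := by
      rw [abs_sub_comm, Int.abs_eq_natAbs]; exact_mod_cast hq.2
    have d1 := abs_le.1 (div_range c1)
    have d2 := abs_le.1 (div_range c2)
    refine ⟨by linarith [d1.1], by linarith [d1.2], by linarith [d2.1], by linarith [d2.2]⟩

lemma KK_sum (S : Finset (ℤ × ℤ)) (j V : ℕ)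
    (hV : ∀ Q, (S.filter (fun p => sqi j p = Q)).card ≤ V) (p : ℤ × ℤ) (c : ℝ) :
    ∑ q ∈ S, KK (2 ^ j) (((q.1 : ℝ) - c) - ((p.1 : ℝ) - c)) ((q.2 : ℝ) - p.2) ≤ 288 * V / 2 ^ j := by
  have hw : (0 : ℝ) < 2 ^ j := by positivity
  have ex : ∀ q, ∃ k : ℕ, ddn p q < 2 ^ k * 2 ^ j := fun q => ⟨ddn p q, by
    have := Nat.lt_two_pow_self (n := ddn p q)
    have h2 : 1 ≤ 2 ^ j := Nat.one_le_two_pow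
    nlinarith⟩
  have := layer_sum S (fun q => KK (2 ^ j) (((q.1 : ℝ) - c) - ((p.1 : ℝ) - c)) ((q.2 : ℝ) - p.2))
    (fun q => Nat.find (ex q)) (16 / 2 ^ j) (9 * V) (1 / 8) 4 (by positivity) (by positivity) (by norm_num) (by norm_num) ?_ ?_
  · refine this.trans (le_of_eq ?_)
    field_simp; ring
  · intro q _
    simp only [sub_sub_sub_cancel_right]
    rcases Nat.eq_zero_or_pos (Nat.find (ex q)) with h0 | h0
    · rw [h0]
      refine (KK_le hw _ _ (2 * 2 ^ j) (by positivity) (Or.inl (by linarith [abs_nonneg ((q.1 : ℝ) - p.1)]))).trans ?_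
      rw [pow_zero, mul_one, div_le_div_iff₀ (by positivity) hw]
      have : (0 : ℝ) ≤ (2 ^ j) ^ 3 := by positivity
      nlinarith
    · obtain ⟨k, hk⟩ : ∃ k, Nat.find (ex q) = k + 1 := ⟨Nat.find (ex q) - 1, by omega⟩
      have hmin := Nat.find_min (ex q) (m := k) (by omega)
      push Not at hmin
      rw [hk]
      have hR : (0 : ℝ) < 2 ^ k * 2 ^ j := by positivity
      have hmin' : (2 : ℝ) ^ k * 2 ^ j ≤ |(q.1 : ℝ) - p.1| ∨ (2 : ℝ) ^ k * 2 ^ j ≤ |(q.2 : ℝ) - p.2| := by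
        unfold ddn at hmin
        rcases le_max_iff.1 hmin with h | h
        · left
          have h' : (2 : ℤ) ^ k * 2 ^ j ≤ |p.1 - q.1| := by rw [Int.abs_eq_natAbs]; exact_mod_cast h
          rw [abs_sub_comm] at h'
          exact_mod_cast h'
        · right
          have h' : (2 : ℤ) ^ k * 2 ^ j ≤ |p.2 - q.2| := by rw [Int.abs_eq_natAbs]; exact_mod_cast h
          rw [abs_sub_comm] at h'
          exact_mod_cast h'
      refine (KK_le hw _ _ (2 ^ k * 2 ^ j) hR (hmin'.imp (fun h => by linarith) id)).trans (le_of_eq ?_)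
      have h8 : (1 / 8 : ℝ) ^ (k + 1) = 1 / (8 * (2 ^ k) ^ 3) := by
        rw [pow_succ, div_pow, one_pow, ← pow_mul, mul_comm k 3, pow_mul]; norm_num
      rw [h8]
      field_simp
      norm_num
  · intro k
    have hb := box_count S j V hV p k
    have : (S.filter (fun q => Nat.find (ex q) = k)).card ≤ 9 * 4 ^ k * V := by
      refine le_trans (Finset.card_le_card ?_) hb
      intro q hq
      rw [Finset.mem_filter] at hq ⊢
      refine ⟨hq.1, ?_⟩
      have := Nat.find_spec (ex q)
      rwa [hq.2] at this
    calc ((S.filter (fun q => Nat.find (ex q) = k)).card : ℝ) ≤ ((9 * 4 ^ k * V : ℕ) : ℝ) := by exact_mod_cast this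
      _ = 9 * V * 4 ^ k := by push_cast; ring

/-- Points of the fat strip `σ` at scale `2^i`. -/
def strip (P : Finset (ℤ × ℤ)) (i : ℕ) (σ : ℤ) : Finset (ℤ × ℤ) :=
  P.filter (fun p => |p.1 / 2 ^ i - σ| ≤ 2)

lemma strip_x {P : Finset (ℤ × ℤ)} {i : ℕ} {σ : ℤ} {p : ℤ × ℤ} (hp : p ∈ strip P i σ) :
    |(p.1 : ℝ) - σ * 2 ^ i| ≤ 3 * 2 ^ i := by
  have h := (Finset.mem_filter.1 hp).2
  have hpos : (0 : ℤ) < 2 ^ i := by positivity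
  have a1 := Int.ediv_mul_le p.1 hpos.ne'
  have a2 := Int.lt_ediv_add_one_mul_self p.1 hpos
  rw [abs_le] at h
  have : |p.1 - σ * 2 ^ i| ≤ 3 * 2 ^ i := by
    rw [abs_le]; constructor <;> nlinarith
  exact_mod_cast this

/-- the smoothed counting function -/
def ff (P : Finset (ℤ × ℤ)) (D : ℝ) (i : ℕ) (σ : ℤ) (w : ℝ) (t : ℤ × ℤ) : ℝ :=
  ∑ q ∈ strip P i σ, PK w (uu D t q)

lemma top_bound (P : Finset (ℤ × ℤ)) (D : ℝ) (hD : 0 < D) (i V : ℕ)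
    (hV : ∀ Q, (P.filter (fun p => sqi i p = Q)).card ≤ V) (σ : ℤ) (t : ℤ × ℤ) (ht : |(t.1 : ℝ)| ≤ D) :
    ff P D i σ (2 ^ i) t ≤ 440 * V / 2 ^ i := by
  have hw : (0 : ℝ) < 2 ^ i := by positivity
  have ha : |(t.1 : ℝ) / D| ≤ 1 := by rw [abs_div, abs_of_pos hD, div_le_one hD]; exact ht
  have ex : ∀ q, ∃ k : ℕ, |uu D t q| < 2 ^ k * 2 ^ i := fun q => by
    obtain ⟨k, hk⟩ := pow_unbounded_of_one_lt (|uu D t q|) (one_lt_two (α := ℝ))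
    exact ⟨k, by
      have h2 : (1 : ℝ) ≤ 2 ^ i := one_le_pow₀ (by norm_num)
      have : (0 : ℝ) < 2 ^ k := by positivity
      nlinarith⟩
  have := layer_sum (strip P i σ) (fun q => PK (2 ^ i) (uu D t q))
    (fun q => Nat.find (ex q)) (4 / 2 ^ i) (55 * V) (1 / 4) 2 (by positivity) (by positivity) (by norm_num) (by norm_num) ?_ ?_
  · refine this.trans (le_of_eq ?_)
    field_simp; ring
  · intro q _
    rcases Nat.eq_zero_or_pos (Nat.find (ex q)) with h0 | h0
    · rw [h0]
      refine (PK_le hw _).trans ?_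
      rw [pow_zero, mul_one]
      gcongr; norm_num
    · obtain ⟨k, hk⟩ : ∃ k, Nat.find (ex q) = k + 1 := ⟨Nat.find (ex q) - 1, by omega⟩
      have hmin := Nat.find_min (ex q) (m := k) (by omega)
      push Not at hmin
      rw [hk]
      have h8 : (1 / 4 : ℝ) ^ (k + 1) = 1 / (4 * (2 ^ k) ^ 2) := by
        rw [pow_succ, div_pow, one_pow, ← pow_mul, mul_comm k 2, pow_mul]; norm_num
      rw [h8]
      unfold PK
      have hsq : (2 ^ k * 2 ^ i) ^ 2 ≤ uu D t q ^ 2 := by rw [← sq_abs (uu D t q)]; gcongr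
      have e : 4 / 2 ^ i * (1 / (4 * (2 ^ k : ℝ) ^ 2)) = 2 ^ i / (2 ^ k * 2 ^ i) ^ 2 := by field_simp
      rw [e]
      refine div_le_div_of_nonneg_left hw.le (by positivity) ?_
      nlinarith [sq_nonneg ((2 : ℝ) ^ i)]
  · intro k
    set S := (strip P i σ).filter (fun q => Nat.find (ex q) = k) with hS
    -- center row
    set y0 : ℝ := (t.1 : ℝ) / D * (σ * 2 ^ i) + t.2 with hy0
    have hrow : ∀ q ∈ S, |(q.2 : ℝ) - y0| < (2 ^ k + 3) * 2 ^ i := by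
      intro q hq
      rw [hS, Finset.mem_filter] at hq
      have h1 := Nat.find_spec (ex q)
      rw [hq.2] at h1
      have h2 := strip_x hq.1
      have e : (q.2 : ℝ) - y0 = uu D t q + (t.1 : ℝ) / D * ((q.1 : ℝ) - σ * 2 ^ i) := by
        rw [hy0]; unfold uu; ring
      rw [e]
      refine (abs_add_le _ _).trans_lt ?_
      rw [abs_mul]
      have : |(t.1 : ℝ) / D| * |(q.1 : ℝ) - σ * 2 ^ i| ≤ 1 * (3 * 2 ^ i) := by gcongr
      nlinarith
    set z : ℤ := ⌊y0 / 2 ^ i⌋ with hz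
    have hz1 : (z : ℝ) * 2 ^ i ≤ y0 := by
      have := Int.floor_le (y0 / 2 ^ i); rw [← hz, le_div_iff₀ hw] at this; exact this
    have hz2 : y0 < ((z : ℝ) + 1) * 2 ^ i := by
      have := Int.lt_floor_add_one (y0 / 2 ^ i); rw [← hz, div_lt_iff₀ hw] at this; exact this
    have := rect_count S i V
      (fun Q => (Finset.card_le_card (Finset.filter_subset_filter _ ((Finset.filter_subset _ _).trans (Finset.filter_subset _ _)))).trans (hV Q))
      (σ - 2) (σ + 2) (z - (2 ^ k + 4)) (z + (2 ^ k + 4)) ?_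
    · have e1 : (σ + 2 + 1 - (σ - 2)).toNat = 5 := by
        have : (σ + 2 + 1 - (σ - 2)) = 5 := by ring
        rw [this]; rfl
      have e2 : (z + (2 ^ k + 4) + 1 - (z - (2 ^ k + 4))).toNat = 2 * 2 ^ k + 9 := by
        have : z + (2 ^ k + 4) + 1 - (z - (2 ^ k + 4)) = ((2 * 2 ^ k + 9 : ℕ) : ℤ) := by push_cast; ring
        rw [this, Int.toNat_natCast]
      rw [e1, e2] at this
      have h1 : 1 ≤ 2 ^ k := Nat.one_le_two_pow
      have h3 : S.card ≤ 55 * V * 2 ^ k := by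
        refine this.trans ?_
        calc V * (5 * (2 * 2 ^ k + 9)) ≤ V * (5 * (11 * 2 ^ k)) := by gcongr; omega
          _ = _ := by ring
      exact_mod_cast h3
    · intro q hq
      have h1 := hrow q hq
      have h2 := (Finset.mem_filter.1 (Finset.mem_filter.1 hq).1).2
      rw [abs_le] at h2
      rw [abs_lt] at h1
      have hpos : (0 : ℤ) < 2 ^ i := by positivity
      have a1 := Int.ediv_mul_le q.2 hpos.ne'
      have a2 := Int.lt_ediv_add_one_mul_self q.2 hpos
      have a1' : ((q.2 / 2 ^ i : ℤ) : ℝ) * 2 ^ i ≤ q.2 := by exact_mod_cast a1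
      have a2' : (q.2 : ℝ) < (((q.2 / 2 ^ i : ℤ) : ℝ) + 1) * 2 ^ i := by exact_mod_cast a2
      refine ⟨by linarith [h2.1], by linarith [h2.2], ?_, ?_⟩
      · have : (z : ℝ) - (2 ^ k + 4) < ((q.2 / 2 ^ i : ℤ) : ℝ) := by
          by_contra hh; push Not at hh
          nlinarith [h1.1]
        have : z - (2 ^ k + 4) < q.2 / 2 ^ i := by exact_mod_cast this
        exact this.le
      · have : ((q.2 / 2 ^ i : ℤ) : ℝ) < z + (2 ^ k + 4) := by
          by_contra hh; push Not at hh
          nlinarith [h1.2]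
        have : q.2 / 2 ^ i < z + (2 ^ k + 4) := by exact_mod_cast this
        exact this.le

lemma near_count (P : Finset (ℤ × ℤ)) (D : ℝ) (i : ℕ) (σ : ℤ) (w : ℝ) (hw : 0 < w) (t : ℤ × ℤ) (c : ℝ)
    (S : Finset (ℤ × ℤ)) (hS : S ⊆ strip P i σ) (h : ∀ q ∈ S, |uu D t q| ≤ c * w) :
    (S.card : ℝ) ≤ (1 + c ^ 2) * w * ff P D i σ w t := by
  have h1 : (S.card : ℝ) * (1 / ((1 + c ^ 2) * w)) ≤ ff P D i σ w t := by
    unfold ff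
    rw [← nsmul_eq_mul, ← Finset.sum_const]
    refine le_trans (Finset.sum_le_sum fun q hq => ?_)
      (Finset.sum_le_sum_of_subset_of_nonneg hS fun q _ _ => (PK_pos hw _).le)
    unfold PK
    have h2 := h q hq
    have h3 : uu D t q ^ 2 ≤ (c * w) ^ 2 := by rw [← sq_abs (uu D t q)]; gcongr
    rw [div_le_div_iff₀ (by positivity) (by positivity)]
    nlinarith
  have hp : 0 < (1 + c ^ 2) * w := by positivity
  rw [mul_one_div, div_le_iff₀ hp] at h1
  linarith

lemma PK_double {w : ℝ} (hw : 0 < w) (u : ℝ) : PK w u ≤ 2 * PK (2 * w) u := by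
  unfold PK
  rw [← mul_div_assoc, div_le_div_iff₀ (by positivity) (by positivity)]
  nlinarith [mul_nonneg hw.le (sq_nonneg u)]

lemma PK_harnack {w θ u u' : ℝ} (hw : 0 < w) (h0 : 0 ≤ θ) (h1 : θ ≤ 1 / 4) (h : |u - u'| ≤ θ * w) :
    (1 - 2 * θ) * PK w u ≤ PK w u' ∧ PK w u' ≤ (1 + 2 * θ) * PK w u := by
  unfold PK
  have hA := PK_den_pos hw u
  have hB := PK_den_pos hw u'
  obtain ⟨e, rfl⟩ : ∃ e, u' = u + e := ⟨u' - u, by ring⟩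
  have he : |e| ≤ θ * w := by rw [show u - (u + e) = -e by ring, abs_neg] at h; exact h
  have he2 : e ^ 2 ≤ θ ^ 2 * w ^ 2 := by rw [← sq_abs e, ← mul_pow]; gcongr
  have hcross : |2 * u * e| ≤ θ * (w ^ 2 + u ^ 2) := by
    rw [abs_mul, abs_mul, abs_of_pos (by norm_num : (0 : ℝ) < 2)]
    have h3 : |u| * |e| ≤ |u| * (θ * w) := by gcongr
    have : 2 * (|u| * w) ≤ w ^ 2 + u ^ 2 := by nlinarith [sq_abs u, sq_nonneg (|u| - w)]
    nlinarith
  rw [abs_le] at hcross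
  have hθ2 : θ ^ 2 ≤ θ / 4 := by nlinarith
  have hu0 := sq_nonneg u
  have hw0 := sq_nonneg w
  have h5 : θ ^ 2 * w ^ 2 ≤ θ / 4 * (w ^ 2 + u ^ 2) := by nlinarith
  constructor
  · rw [← mul_div_assoc, div_le_div_iff₀ hA hB]
    have : (1 - 2 * θ) * (w ^ 2 + (u + e) ^ 2) ≤ w ^ 2 + u ^ 2 := by
      have : w ^ 2 + (u + e) ^ 2 ≤ (1 + θ + θ / 4) * (w ^ 2 + u ^ 2) := by nlinarith
      have h6 : (1 - 2 * θ) * (w ^ 2 + (u + e) ^ 2) ≤ (1 - 2 * θ) * ((1 + θ + θ / 4) * (w ^ 2 + u ^ 2)) := by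
        apply mul_le_mul_of_nonneg_left this; linarith
      nlinarith [mul_nonneg h0 hA.le, mul_nonneg (sq_nonneg θ) hA.le]
    nlinarith
  · rw [← mul_div_assoc, div_le_div_iff₀ hB hA]
    have : w ^ 2 + u ^ 2 ≤ (1 + 2 * θ) * (w ^ 2 + (u + e) ^ 2) := by
      have : (1 - θ) * (w ^ 2 + u ^ 2) ≤ w ^ 2 + (u + e) ^ 2 := by nlinarith [sq_nonneg e]
      have h6 : (1 + 2 * θ) * ((1 - θ) * (w ^ 2 + u ^ 2)) ≤ (1 + 2 * θ) * (w ^ 2 + (u + e) ^ 2) := by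
        apply mul_le_mul_of_nonneg_left this; linarith
      nlinarith [mul_nonneg h0 hA.le, mul_nonneg (sq_nonneg θ) hA.le]
    nlinarith

lemma seq_lemma (n i : ℕ) (hi : i ≤ n) (a : ℕ → ℝ) (A : ℝ) (hA : 0 < A) (h0 : 3 * A ≤ a 0) (hi' : a i < A)
    (hd : ∀ j, a j ≤ 2 * a (j + 1)) :
    ∃ j < i, A ≤ a j ∧ a j ≤ 6 * A ∧ a j / (n + 2) ≤ a j - a (j + 1) := by
  set θ : ℝ := 1 + 1 / (n + 1) with hθ
  have hn : (0 : ℝ) < n + 1 := by positivity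
  have hθ1 : 1 ≤ θ := by rw [hθ]; have : (0 : ℝ) < 1 / (n + 1) := by positivity
                         linarith
  have hθ0 : 0 < θ := by linarith
  have hpow : ∀ k ≤ n, θ ^ k ≤ 3 := by
    intro k hk
    have h1 : θ ≤ Real.exp (1 / (n + 1)) := by
      have := Real.add_one_le_exp (1 / ((n : ℝ) + 1)); rw [hθ]; linarith
    calc θ ^ k ≤ θ ^ (n + 1) := pow_le_pow_right₀ hθ1 (by omega)
      _ ≤ Real.exp (1 / (n + 1)) ^ (n + 1) := by gcongr
      _ = Real.exp 1 := by rw [← Real.exp_nat_mul]; congr 1; push_cast; field_simp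
      _ ≤ 3 := Real.exp_one_lt_three.le
  have ex : ∃ j, ¬ (A * θ ^ (i - j) ≤ a j) := ⟨i, by simpa using hi'⟩
  have hpos : Nat.find ex ≠ 0 := by
    intro h
    have := Nat.find_spec ex
    rw [h] at this
    apply this
    have := hpow i hi
    simp only [Nat.sub_zero]
    nlinarith
  have hle : Nat.find ex ≤ i := Nat.find_le (by simpa using hi')
  obtain ⟨j, hj⟩ : ∃ j, Nat.find ex = j + 1 := ⟨Nat.find ex - 1, by omega⟩
  have hs := Nat.find_spec ex
  rw [hj] at hs; push Not at hs
  have hm := Nat.find_min ex (m := j) (by omega)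
  push Not at hm
  have hji : j < i := by omega
  have e : i - j = (i - (j + 1)) + 1 := by omega
  have b1 : θ ^ (i - (j + 1)) ≤ 3 := hpow _ (by omega)
  have b2 : 1 ≤ θ ^ (i - j) := one_le_pow₀ hθ1
  refine ⟨j, hji, by nlinarith, ?_, ?_⟩
  · have := hd j
    nlinarith
  · rw [e, pow_succ] at hm
    have h1 : a (j + 1) * θ ≤ a j := by nlinarith
    have h2 : θ = (n + 2) / (n + 1) := by rw [hθ]; field_simp; ring
    rw [h2, ← mul_div_assoc, div_le_iff₀ hn] at h1
    rw [div_le_iff₀ (by positivity)]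
    nlinarith


/-- The discretised configuration, in units of `δ = 2^{-n}`. -/
structure Cfg where
  n : ℕ
  g : ℕ
  s : ℝ
  M : ℝ
  K : ℝ
  U : ℝ
  P : Finset (ℤ × ℤ)
  T : Finset (ℤ × ℤ)
  Tp : ℤ × ℤ → Finset (ℤ × ℤ)
  hs0 : 0 < s
  hs1 : s ≤ 1
  hM : 0 < M
  hK : 1 ≤ K
  hU : 1 ≤ U
  hP : P.Nonempty
  h1 : ∀ p ∈ P, 0 ≤ p.1 ∧ p.1 < 2 ^ n ∧ 0 ≤ p.2 ∧ p.2 < 2 ^ n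
  h2T : ∀ p ∈ P, Tp p ⊆ T
  h2k : ∀ p ∈ P, ∀ t ∈ Tp p, |(t.1 : ℝ)| ≤ 2 ^ n
  h2u : ∀ p ∈ P, ∀ t ∈ Tp p, |uu (2 ^ n) t p| ≤ 4
  h3a : ∀ p ∈ P, M ≤ 2 * ((Tp p).card : ℝ)
  h3b : ∀ p ∈ P, ((Tp p).card : ℝ) ≤ 2 * M
  h4 : ∀ p ∈ P, ∀ a0 ρ : ℝ, 1 / 2 ^ n ≤ ρ → ρ ≤ 1 →
    (((Tp p).filter (fun t => |(t.1 : ℝ) / 2 ^ n - a0| ≤ ρ)).card : ℝ) ≤ K * ρ ^ s * M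
  hbig : ∀ j, g ≤ j → j ≤ n → ∀ p ∈ P,
    ((P.filter (fun q => sqi j q = sqi j p)).card : ℝ) ≤ K * (2 ^ j / 2 ^ n : ℝ) ^ (2 - s) * P.card
  hsmall : ∀ j, j ≤ g → ∀ p ∈ P,
    ((P.filter (fun q => ddn p q ≤ 2 ^ j)).card : ℝ) ≤ K * ((2 : ℝ) ^ j) ^ s
  hunif : ∀ j, j ≤ n → ∀ p ∈ P, ∀ q ∈ P,
    ((P.filter (fun q => sqi j q = sqi j p)).card : ℝ) ≤ U * (P.filter (fun q' => sqi j q' = sqi j q)).card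

namespace Cfg
variable (c : Cfg)

lemma ddn_lt {p q : ℤ × ℤ} (hp : p ∈ c.P) (hq : q ∈ c.P) : ddn p q < 2 ^ c.n := by
  have a := c.h1 p hp
  have b := c.h1 q hq
  unfold ddn
  zify
  rw [max_lt_iff, abs_lt, abs_lt]
  refine ⟨⟨?_, ?_⟩, ⟨?_, ?_⟩⟩ <;> omega

lemma common_slope {p q : ℤ × ℤ} (hp : p ∈ c.P) (hq : q ∈ c.P) (i : ℕ) (hi : 4 ≤ i)
    (h : 2 ^ i ≤ ddn p q) :
    ∃ a0 : ℝ, ∀ t ∈ c.Tp p, t ∈ c.Tp q → |(t.1 : ℝ) / 2 ^ c.n - a0| ≤ 16 / 2 ^ i := by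
  refine ⟨((p.2 : ℝ) - q.2) / ((p.1 : ℝ) - q.1), ?_⟩
  intro t htp htq
  have hD : (0 : ℝ) < 2 ^ c.n := by positivity
  have u1 := c.h2u p hp t htp
  have u2 := c.h2u q hq t htq
  have hk := c.h2k p hp t htp
  have ha : |(t.1 : ℝ) / 2 ^ c.n| ≤ 1 := by rw [abs_div, abs_of_pos hD, div_le_one hD]; exact hk
  set a := (t.1 : ℝ) / 2 ^ c.n with hadef
  unfold uu at u1 u2
  rw [← hadef] at u1 u2
  set X := (p.1 : ℝ) - q.1 with hX
  set Y := (p.2 : ℝ) - q.2 with hY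
  have h16 : (16 : ℝ) ≤ 2 ^ i := by
    calc (16 : ℝ) = 2 ^ 4 := by norm_num
      _ ≤ 2 ^ i := pow_le_pow_right₀ (by norm_num) hi
  have h8 : |Y - a * X| ≤ 8 := by
    have e : Y - a * X = ((p.2 : ℝ) - a * p.1 - t.2) - ((q.2 : ℝ) - a * q.1 - t.2) := by rw [hX, hY]; ring
    rw [e]
    refine (abs_sub _ _).trans ?_
    linarith
  have hdd : (2 : ℝ) ^ i ≤ |X| ∨ (2 : ℝ) ^ i ≤ |Y| := by
    unfold ddn at h
    rcases le_max_iff.1 h with h | h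
    · left
      have h' : (2 : ℤ) ^ i ≤ |p.1 - q.1| := by rw [Int.abs_eq_natAbs]; exact_mod_cast h
      rw [hX]; exact_mod_cast h'
    · right
      have h' : (2 : ℤ) ^ i ≤ |p.2 - q.2| := by rw [Int.abs_eq_natAbs]; exact_mod_cast h
      rw [hY]; exact_mod_cast h'
  have hXlow : (2 : ℝ) ^ i / 2 ≤ |X| := by
    rcases hdd with h | h
    · linarith
    · have : |Y| ≤ |Y - a * X| + |a * X| := by
        have := abs_add_le (Y - a * X) (a * X); simpa using this
      rw [abs_mul] at this
      have h3 : |a| * |X| ≤ 1 * |X| := by gcongr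
      linarith
  have hXpos : 0 < |X| := by linarith
  have hX0 : X ≠ 0 := abs_pos.1 hXpos
  have e : a - Y / X = -((Y - a * X) / X) := by field_simp; ring
  rw [e, abs_neg, abs_div, div_le_div_iff₀ hXpos (by positivity)]
  nlinarith

lemma common_kauf {p q : ℤ × ℤ} (hp : p ∈ c.P) (hq : q ∈ c.P) (i : ℕ) (h : i ≠ 0 → 2 ^ i ≤ ddn p q) :
    ((c.Tp p ∩ c.Tp q).card : ℝ) ≤ 32 * c.K * ((2 : ℝ) ^ i) ^ (-c.s) * c.M := by
  have hK := c.hK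
  have hM := c.hM
  have hs0 := c.hs0
  have hs1 := c.hs1
  have h2i : (0 : ℝ) < 2 ^ i := by positivity
  by_cases hi : 4 ≤ i
  · have h := h (by omega)
    obtain ⟨a0, ha0⟩ := c.common_slope hp hq i hi h
    have hin : i < c.n := by
      have := c.ddn_lt hp hq
      exact (Nat.pow_lt_pow_iff_right (by norm_num : 1 < 2)).1 (lt_of_le_of_lt h this)
    have h16 : (16 : ℝ) ≤ 2 ^ i := by
      calc (16 : ℝ) = 2 ^ 4 := by norm_num
        _ ≤ 2 ^ i := pow_le_pow_right₀ (by norm_num) hi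
    have h5 : (2 : ℝ) ^ i ≤ 2 ^ c.n := pow_le_pow_right₀ (by norm_num) hin.le
    have h4 := c.h4 p hp a0 (16 / 2 ^ i) (by
        rw [div_le_div_iff₀ (by positivity) h2i]; nlinarith) (by rw [div_le_one h2i]; exact h16)
    calc ((c.Tp p ∩ c.Tp q).card : ℝ)
        ≤ (((c.Tp p).filter (fun t => |(t.1 : ℝ) / 2 ^ c.n - a0| ≤ 16 / 2 ^ i)).card : ℝ) := by
          have : (c.Tp p ∩ c.Tp q) ⊆ (c.Tp p).filter (fun t => |(t.1 : ℝ) / 2 ^ c.n - a0| ≤ 16 / 2 ^ i) := by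
            intro t ht
            rw [Finset.mem_inter] at ht
            exact Finset.mem_filter.2 ⟨ht.1, ha0 t ht.1 ht.2⟩
          exact_mod_cast Finset.card_le_card this
      _ ≤ _ := h4
      _ = c.K * ((16 : ℝ) ^ c.s * ((2 : ℝ) ^ i) ^ (-c.s)) * c.M := by
          rw [Real.div_rpow (by norm_num) h2i.le, Real.rpow_neg h2i.le]; rfl
      _ ≤ c.K * (32 * ((2 : ℝ) ^ i) ^ (-c.s)) * c.M := by
          have : (16 : ℝ) ^ c.s ≤ 16 ^ (1 : ℝ) := Real.rpow_le_rpow_of_exponent_le (by norm_num) hs1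
          rw [Real.rpow_one] at this
          have : (16 : ℝ) ^ c.s ≤ 32 := by linarith
          gcongr
      _ = _ := by ring
  · have hle : (2 : ℝ) ^ i ≤ 16 := by
      calc (2 : ℝ) ^ i ≤ 2 ^ 4 := pow_le_pow_right₀ (by norm_num) (by omega)
        _ = 16 := by norm_num
    have h1 : 1 / 16 ≤ ((2 : ℝ) ^ i) ^ (-c.s) := by
      rw [Real.rpow_neg h2i.le, ← one_div]
      apply one_div_le_one_div_of_le (by positivity)
      calc ((2 : ℝ) ^ i) ^ c.s ≤ ((2 : ℝ) ^ i) ^ (1 : ℝ) :=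
            Real.rpow_le_rpow_of_exponent_le (one_le_pow₀ (by norm_num)) hs1
        _ ≤ 16 := by rw [Real.rpow_one]; exact hle
    have h2 : ((c.Tp p ∩ c.Tp q).card : ℝ) ≤ 2 * c.M := by
      refine le_trans ?_ (c.h3b p hp)
      exact_mod_cast Finset.card_le_card Finset.inter_subset_left
    have h3 : 1 * (1 / 16) ≤ c.K * ((2 : ℝ) ^ i) ^ (-c.s) := by gcongr
    nlinarith

/-- A family of tubes through `p` whose slopes lie in an interval. -/
lemma slope_count {p : ℤ × ℤ} (hp : p ∈ c.P) (S : Finset (ℤ × ℤ)) (hS : S ⊆ c.Tp p) (a0 ρ : ℝ) (hρ : 0 ≤ ρ)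
    (h : ∀ t ∈ S, |(t.1 : ℝ) - a0| ≤ ρ) : (S.card : ℝ) ≤ 9 * (2 * ρ + 1) := by
  have hfib : ∀ k ∈ S.image Prod.fst, (S.filter (fun t => t.1 = k)).card ≤ 9 := by
    intro k _
    set y0 : ℝ := (p.2 : ℝ) - (k : ℝ) / 2 ^ c.n * p.1 with hy0
    have hinj : Set.InjOn Prod.snd (↑(S.filter (fun t => t.1 = k)) : Set (ℤ × ℤ)) := by
      intro t ht t' ht' hh
      simp only [Finset.coe_filter, Set.mem_ofPred_eq] at ht ht'
      exact Prod.ext (ht.2.trans ht'.2.symm) hh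
    rw [← Finset.card_image_of_injOn hinj]
    have hsub : (S.filter (fun t => t.1 = k)).image Prod.snd ⊆ Finset.Icc (⌈y0 - 4⌉) (⌊y0 + 4⌋) := by
      intro l hl
      obtain ⟨t, ht, rfl⟩ := Finset.mem_image.1 hl
      obtain ⟨htS, htk⟩ := Finset.mem_filter.1 ht
      have hu := c.h2u p hp t (hS htS)
      unfold uu at hu
      rw [htk, ← hy0, abs_le] at hu
      rw [Finset.mem_Icc, Int.ceil_le, Int.le_floor]
      constructor <;> linarith [hu.1, hu.2]
    refine (Finset.card_le_card hsub).trans ?_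
    rw [Int.card_Icc]
    have a1 := Int.le_ceil (y0 - 4)
    have a2 := Int.floor_le (y0 + 4)
    have : (⌊y0 + 4⌋ : ℝ) - ⌈y0 - 4⌉ ≤ 8 := by linarith
    have : ⌊y0 + 4⌋ - ⌈y0 - 4⌉ ≤ 8 := by exact_mod_cast this
    omega
  have hcard := Finset.card_le_mul_card_image S 9 hfib
  have himg : ((S.image Prod.fst).card : ℝ) ≤ 2 * ρ + 1 := by
    have hsub : S.image Prod.fst ⊆ Finset.Icc (⌈a0 - ρ⌉) (⌊a0 + ρ⌋) := by
      intro k hk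
      obtain ⟨t, ht, rfl⟩ := Finset.mem_image.1 hk
      have := h t ht
      rw [abs_le] at this
      rw [Finset.mem_Icc, Int.ceil_le, Int.le_floor]
      constructor <;> linarith [this.1, this.2]
    have h1 := Finset.card_le_card hsub
    rw [Int.card_Icc] at h1
    have a1 := Int.le_ceil (a0 - ρ)
    have a2 := Int.floor_le (a0 + ρ)
    rcases le_total 0 (⌊a0 + ρ⌋ + 1 - ⌈a0 - ρ⌉) with h0 | h0
    · have h2 : ((S.image Prod.fst).card : ℤ) ≤ ⌊a0 + ρ⌋ + 1 - ⌈a0 - ρ⌉ := by omega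
      have h3 : ((S.image Prod.fst).card : ℝ) ≤ ⌊a0 + ρ⌋ + 1 - ⌈a0 - ρ⌉ := by exact_mod_cast h2
      linarith
    · have h2 : (S.image Prod.fst).card = 0 := by omega
      rw [h2]; push_cast; linarith
  calc (S.card : ℝ) ≤ 9 * (S.image Prod.fst).card := by exact_mod_cast hcard
    _ ≤ _ := by gcongr

lemma common_E2 {p q : ℤ × ℤ} (hp : p ∈ c.P) (hq : q ∈ c.P) (i : ℕ) (hin : i ≤ c.n) (h : i ≠ 0 → 2 ^ i ≤ ddn p q) :
    ((c.Tp p ∩ c.Tp q).card : ℝ) ≤ 432 * 2 ^ c.n / 2 ^ i := by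
  have h2i : (0 : ℝ) < 2 ^ i := by positivity
  have hD : (0 : ℝ) < 2 ^ c.n := by positivity
  have h5 : (2 : ℝ) ^ i ≤ 2 ^ c.n := pow_le_pow_right₀ (by norm_num) hin
  by_cases hi : 4 ≤ i
  · obtain ⟨a0, ha0⟩ := c.common_slope hp hq i hi (h (by omega))
    have := c.slope_count hp (c.Tp p ∩ c.Tp q) Finset.inter_subset_left (a0 * 2 ^ c.n) (16 / 2 ^ i * 2 ^ c.n) (by positivity) ?_
    · refine this.trans ?_
      have : 1 ≤ (2 : ℝ) ^ c.n / 2 ^ i := by rw [le_div_iff₀ h2i]; linarith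
      have e : 16 / (2 : ℝ) ^ i * 2 ^ c.n = 16 * (2 ^ c.n / 2 ^ i) := by ring
      rw [e, mul_div_assoc]
      linarith
    · intro t ht
      rw [Finset.mem_inter] at ht
      have := ha0 t ht.1 ht.2
      have e : (t.1 : ℝ) - a0 * 2 ^ c.n = ((t.1 : ℝ) / 2 ^ c.n - a0) * 2 ^ c.n := by field_simp
      rw [e, abs_mul, abs_of_pos hD]
      gcongr
  · have hle : (2 : ℝ) ^ i ≤ 2 ^ 3 := pow_le_pow_right₀ (by norm_num) (by omega)
    have := c.slope_count hp (c.Tp p ∩ c.Tp q) Finset.inter_subset_left 0 (2 ^ c.n) (by positivity) ?_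
    · refine this.trans ?_
      have h1 : (1 : ℝ) ≤ 2 ^ c.n := one_le_pow₀ (by norm_num)
      rw [le_div_iff₀ h2i]
      calc 9 * (2 * (2 : ℝ) ^ c.n + 1) * 2 ^ i ≤ 9 * (2 * (2 : ℝ) ^ c.n + 2 ^ c.n) * 2 ^ 3 := by gcongr
        _ ≤ _ := by norm_num; linarith
    · intro t ht
      rw [sub_zero]
      exact c.h2k p hp t (Finset.mem_inter.1 ht).1

lemma log_lt {p q : ℤ × ℤ} (hp : p ∈ c.P) (hq : q ∈ c.P) : Nat.log 2 (ddn p q) ∈ Finset.range (c.n + 1) := by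
  have := c.ddn_lt hp hq
  rw [Finset.mem_range]
  have h2 := Nat.log_mono_right (b := 2) this.le
  rw [Nat.log_pow (by norm_num)] at h2
  omega

lemma kaufman {p : ℤ × ℤ} (hp : p ∈ c.P) :
    ∑ q ∈ c.P.filter (fun q => ddn p q ≤ 2 ^ c.g), ((c.Tp p ∩ c.Tp q).card : ℝ) ≤
      64 * c.K ^ 2 * (c.n + 2) * c.M := by
  have hK := c.hK
  have hM := c.hM
  have hs0 := c.hs0
  have hs1 := c.hs1
  rw [← Finset.sum_fiberwise_of_maps_to (s := c.P.filter (fun q => ddn p q ≤ 2 ^ c.g)) (t := Finset.range (c.n + 1))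
    (g := fun q => Nat.log 2 (ddn p q)) (fun q hq => c.log_lt hp (Finset.mem_filter.1 hq).1)]
  calc _ ≤ ∑ i ∈ Finset.range (c.n + 1), 64 * c.K ^ 2 * c.M := by
        refine Finset.sum_le_sum fun i _ => ?_
        set F := (c.P.filter (fun q => ddn p q ≤ 2 ^ c.g)).filter (fun q => Nat.log 2 (ddn p q) = i) with hF
        have h2i : (0 : ℝ) < 2 ^ i := by positivity
        have hFc : (F.card : ℝ) ≤ 2 * c.K * ((2 : ℝ) ^ i) ^ c.s := by
          by_cases hig : i + 1 ≤ c.g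
          · have h1 := c.hsmall (i + 1) hig p hp
            have h2 : F ⊆ c.P.filter (fun q => ddn p q ≤ 2 ^ (i + 1)) := by
              intro q hq
              rw [hF, Finset.mem_filter, Finset.mem_filter] at hq
              refine Finset.mem_filter.2 ⟨hq.1.1, ?_⟩
              have := Nat.lt_pow_succ_log_self (b := 2) (by norm_num) (ddn p q)
              rw [hq.2] at this
              exact this.le
            have h3 : (F.card : ℝ) ≤ _ := le_trans (by exact_mod_cast Finset.card_le_card h2) h1
            refine h3.trans ?_
            rw [pow_succ, Real.mul_rpow h2i.le (by norm_num)]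
            have : (2 : ℝ) ^ c.s ≤ 2 ^ (1 : ℝ) := Real.rpow_le_rpow_of_exponent_le (by norm_num) hs1
            rw [Real.rpow_one] at this
            calc c.K * (((2 : ℝ) ^ i) ^ c.s * 2 ^ c.s) ≤ c.K * (((2 : ℝ) ^ i) ^ c.s * 2) := by gcongr
              _ = _ := by ring
          · have h1 := c.hsmall c.g le_rfl p hp
            have h3 : (F.card : ℝ) ≤ _ := le_trans (by exact_mod_cast Finset.card_le_card (Finset.filter_subset _ _)) h1
            refine h3.trans ?_
            have : ((2 : ℝ) ^ c.g) ^ c.s ≤ ((2 : ℝ) ^ i) ^ c.s := by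
              apply Real.rpow_le_rpow (by positivity) _ hs0.le
              exact pow_le_pow_right₀ (by norm_num) (by omega)
            have h0 : 0 ≤ ((2 : ℝ) ^ i) ^ c.s := by positivity
            nlinarith
        calc ∑ q ∈ F, ((c.Tp p ∩ c.Tp q).card : ℝ)
            ≤ ∑ q ∈ F, 32 * c.K * ((2 : ℝ) ^ i) ^ (-c.s) * c.M := by
              refine Finset.sum_le_sum fun q hq => ?_
              rw [hF, Finset.mem_filter, Finset.mem_filter] at hq
              refine c.common_kauf hp hq.1.1 i fun hi0 => ?_
              have : ddn p q ≠ 0 := by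
                intro h0
                have := hq.2
                rw [h0] at this
                simp at this
                exact hi0 this.symm
              have h2 := Nat.pow_log_le_self 2 this
              rwa [hq.2] at h2
          _ = F.card * (32 * c.K * ((2 : ℝ) ^ i) ^ (-c.s) * c.M) := by rw [Finset.sum_const, nsmul_eq_mul]
          _ ≤ (2 * c.K * ((2 : ℝ) ^ i) ^ c.s) * (32 * c.K * ((2 : ℝ) ^ i) ^ (-c.s) * c.M) := by gcongr
          _ = 64 * c.K ^ 2 * c.M * (((2 : ℝ) ^ i) ^ c.s * ((2 : ℝ) ^ i) ^ (-c.s)) := by ring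
          _ = 64 * c.K ^ 2 * c.M := by rw [← Real.rpow_add h2i]; simp
    _ = 64 * c.K ^ 2 * (c.n + 1) * c.M := by rw [Finset.sum_const, nsmul_eq_mul, Finset.card_range]; push_cast; ring
    _ ≤ _ := by gcongr; norm_num

end Cfg


namespace Cfg
variable (c : Cfg)

def Inc : Finset ((ℤ × ℤ) × (ℤ × ℤ)) := (c.P ×ˢ c.T).filter (fun x => x.2 ∈ c.Tp x.1)

def Pt (t : ℤ × ℤ) : Finset (ℤ × ℤ) := c.P.filter (fun p => t ∈ c.Tp p)

def K1 : ℝ := 512 * c.K ^ 2 * (c.n + 2)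

def r : ℝ := (c.Inc.card : ℝ) / c.T.card

def nearT (x : (ℤ × ℤ) × (ℤ × ℤ)) : Finset (ℤ × ℤ) :=
  c.P.filter (fun q => x.2 ∈ c.Tp q ∧ ddn x.1 q ≤ 2 ^ c.g)

def I1 : Finset ((ℤ × ℤ) × (ℤ × ℤ)) :=
  c.Inc.filter (fun x => c.r / 2 ≤ ((c.Pt x.2).card : ℝ) ∧ ((c.nearT x).card : ℝ) ≤ c.K1)

lemma mem_Inc {x : (ℤ × ℤ) × (ℤ × ℤ)} : x ∈ c.Inc ↔ x.1 ∈ c.P ∧ x.2 ∈ c.Tp x.1 := by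
  unfold Inc
  rw [Finset.mem_filter, Finset.mem_product]
  constructor
  · rintro ⟨⟨a, b⟩, d⟩; exact ⟨a, d⟩
  · rintro ⟨a, d⟩; exact ⟨⟨a, c.h2T _ a d⟩, d⟩

lemma sum_Inc (f : (ℤ × ℤ) × (ℤ × ℤ) → ℝ) :
    ∑ x ∈ c.Inc, f x = ∑ p ∈ c.P, ∑ t ∈ c.Tp p, f (p, t) := by
  unfold Inc
  rw [Finset.sum_filter, Finset.sum_product]
  refine Finset.sum_congr rfl fun p hp => ?_
  rw [← Finset.sum_filter]
  refine Finset.sum_congr ?_ fun _ _ => rfl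
  ext t
  rw [Finset.mem_filter]
  exact ⟨fun h => h.2, fun h => ⟨c.h2T p hp h, h⟩⟩

lemma Inc_card : (c.Inc.card : ℝ) = ∑ p ∈ c.P, ((c.Tp p).card : ℝ) := by
  have := c.sum_Inc (fun _ => 1)
  simpa using this

lemma Inc_ge : c.M * c.P.card ≤ 2 * c.Inc.card := by
  rw [Inc_card, Finset.mul_sum]
  calc c.M * c.P.card = ∑ p ∈ c.P, c.M := by rw [Finset.sum_const, nsmul_eq_mul]; ring
    _ ≤ _ := Finset.sum_le_sum fun p hp => c.h3a p hp

lemma N_pos : (0 : ℝ) < c.P.card := by exact_mod_cast c.hP.card_pos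

lemma Inc_pos : (0 : ℝ) < c.Inc.card := by
  have := c.Inc_ge
  have := mul_pos c.hM c.N_pos
  linarith

lemma T_pos : (0 : ℝ) < c.T.card := by
  have h := c.Inc_pos
  have h' : 0 < c.Inc.card := by exact_mod_cast h
  obtain ⟨x, hx⟩ := Finset.card_pos.1 h'
  rw [mem_Inc] at hx
  have : 0 < c.T.card := Finset.card_pos.2 ⟨x.2, c.h2T _ hx.1 hx.2⟩
  exact_mod_cast this

lemma r_mul : c.r * c.T.card = c.Inc.card := by
  unfold r; exact div_mul_cancel₀ _ c.T_pos.ne'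

lemma r_pos : 0 < c.r := div_pos c.Inc_pos c.T_pos

lemma K1_pos : 0 < c.K1 := by
  have := c.hK
  unfold K1; positivity

lemma lost1 : ((c.Inc.filter (fun x => ¬ (c.r / 2 ≤ ((c.Pt x.2).card : ℝ)))).card : ℝ) ≤ c.Inc.card / 2 := by
  rw [← c.r_mul]
  set F := c.Inc.filter (fun x => ¬ (c.r / 2 ≤ ((c.Pt x.2).card : ℝ))) with hF
  have hmap : ∀ x ∈ F, x.2 ∈ c.T := fun x hx => by
    have := (c.mem_Inc).1 (Finset.mem_filter.1 hx).1
    exact c.h2T _ this.1 this.2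
  have h1 := Finset.card_eq_sum_card_fiberwise (s := F) (t := c.T) (f := Prod.snd) hmap
  rw [h1]; push_cast
  calc ∑ t ∈ c.T, ((F.filter (fun x => x.2 = t)).card : ℝ) ≤ ∑ t ∈ c.T, c.r / 2 := by
        refine Finset.sum_le_sum fun t _ => ?_
        rcases Finset.eq_empty_or_nonempty (F.filter (fun x => x.2 = t)) with h | ⟨x, hx⟩
        · rw [h]; have := c.r_pos; simp; linarith
        · have hx' := Finset.mem_filter.1 hx
          have hx2 := (Finset.mem_filter.1 hx'.1).2
          push Not at hx2
          rw [hx'.2] at hx2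
          refine le_trans ?_ hx2.le
          have : (F.filter (fun x => x.2 = t)).card ≤ (c.Pt t).card := by
            refine Finset.card_le_card_of_injOn Prod.fst ?_ ?_
            · intro y hy
              have hy' := Finset.mem_filter.1 hy
              have := (c.mem_Inc).1 (Finset.mem_filter.1 hy'.1).1
              refine Finset.mem_coe.2 (Finset.mem_filter.2 ⟨this.1, ?_⟩)
              rw [← hy'.2]; exact this.2
            · intro y hy z hz hyz
              have hy' := Finset.mem_filter.1 hy
              have hz' := Finset.mem_filter.1 hz
              exact Prod.ext hyz (hy'.2.trans hz'.2.symm)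
          exact_mod_cast this
    _ = c.r * c.T.card / 2 := by rw [Finset.sum_const, nsmul_eq_mul]; ring

lemma lost2 : ((c.Inc.filter (fun x => ¬ (((c.nearT x).card : ℝ) ≤ c.K1))).card : ℝ) ≤ c.Inc.card / 4 := by
  set F := c.Inc.filter (fun x => ¬ (((c.nearT x).card : ℝ) ≤ c.K1)) with hF
  have h1 : (F.card : ℝ) * c.K1 ≤ ∑ x ∈ c.Inc, ((c.nearT x).card : ℝ) := by
    rw [← nsmul_eq_mul, ← Finset.sum_const]
    refine le_trans (Finset.sum_le_sum fun x hx => ?_)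
      (Finset.sum_le_sum_of_subset_of_nonneg (Finset.filter_subset _ _) fun x _ _ => by positivity)
    have := (Finset.mem_filter.1 hx).2
    push Not at this
    exact this.le
  have h2 : ∑ x ∈ c.Inc, ((c.nearT x).card : ℝ) ≤ ∑ p ∈ c.P, 64 * c.K ^ 2 * (c.n + 2) * c.M := by
    rw [sum_Inc]
    refine Finset.sum_le_sum fun p hp => ?_
    refine le_trans (le_of_eq ?_) (c.kaufman hp)
    have e1 : ∀ t, ((c.nearT (p, t)).card : ℝ) = ∑ q ∈ c.P.filter (fun q => ddn p q ≤ 2 ^ c.g), if t ∈ c.Tp q then (1 : ℝ) else 0 := by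
      intro t
      unfold nearT
      rw [Finset.sum_boole, Finset.filter_filter]
      congr 2
      ext q; simp only [Finset.mem_filter]; tauto
    simp_rw [e1]
    rw [Finset.sum_comm]
    refine Finset.sum_congr rfl fun q _ => ?_
    rw [Finset.sum_boole]
    congr 2
  rw [Finset.sum_const, nsmul_eq_mul] at h2
  have h3 := c.Inc_ge
  have hK1 := c.K1_pos
  have h4 : (F.card : ℝ) * c.K1 ≤ (c.Inc.card / 4) * c.K1 := by
    refine (h1.trans h2).trans ?_
    have : (c.P.card : ℝ) * (64 * c.K ^ 2 * (c.n + 2) * c.M) = c.M * c.P.card * (c.K1 / 8) := by unfold K1; ring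
    rw [this]
    have := mul_le_mul_of_nonneg_right h3 (by positivity : 0 ≤ c.K1 / 8)
    linarith
  exact le_of_mul_le_mul_right h4 hK1

lemma I1_card : (c.Inc.card : ℝ) ≤ 4 * c.I1.card := by
  have h1 := c.lost1
  have h2 := c.lost2
  have : c.Inc ⊆ c.I1 ∪ (c.Inc.filter (fun x => ¬ (c.r / 2 ≤ ((c.Pt x.2).card : ℝ))) ∪
      c.Inc.filter (fun x => ¬ (((c.nearT x).card : ℝ) ≤ c.K1))) := by
    intro x hx
    simp only [Finset.mem_union, I1, Finset.mem_filter]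
    tauto
  have h3 := (Finset.card_le_card this).trans ((Finset.card_union_le _ _).trans (Nat.add_le_add_left (Finset.card_union_le _ _) _))
  have h4 : (c.Inc.card : ℝ) ≤ c.I1.card + ((c.Inc.filter (fun x => ¬ (c.r / 2 ≤ ((c.Pt x.2).card : ℝ)))).card +
      (c.Inc.filter (fun x => ¬ (((c.nearT x).card : ℝ) ≤ c.K1))).card) := by exact_mod_cast h3
  linarith

def lvl (x : (ℤ × ℤ) × (ℤ × ℤ)) (i : ℕ) : Finset (ℤ × ℤ) :=
  (c.Pt x.2).filter (fun q => Nat.log 2 (ddn x.1 q) = i)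

lemma exists_lvl {x : (ℤ × ℤ) × (ℤ × ℤ)} (hx : x ∈ c.I1) (hr : 2 * (c.n + 1) * c.K1 < c.r) :
    ∃ i, c.g ≤ i ∧ i ≤ c.n ∧ ((c.Pt x.2).card : ℝ) / (c.n + 1) ≤ (c.lvl x i).card := by
  unfold I1 at hx
  obtain ⟨hxI, hx1, hx2⟩ := Finset.mem_filter.1 hx
  obtain ⟨hp, ht⟩ := c.mem_Inc.1 hxI
  have hmap : ∀ q ∈ c.Pt x.2, Nat.log 2 (ddn x.1 q) ∈ Finset.range (c.n + 1) := fun q hq =>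
    c.log_lt hp (Finset.mem_filter.1 hq).1
  have h1 := Finset.card_eq_sum_card_fiberwise hmap
  have h2 : ∑ i ∈ Finset.range (c.n + 1), ((c.Pt x.2).card : ℝ) / (c.n + 1) ≤
      ∑ i ∈ Finset.range (c.n + 1), ((c.lvl x i).card : ℝ) := by
    rw [Finset.sum_const, nsmul_eq_mul, Finset.card_range]
    have e : ((c.n + 1 : ℕ) : ℝ) * (((c.Pt x.2).card : ℝ) / (c.n + 1)) = (c.Pt x.2).card := by
      push_cast; field_simp
    rw [e]
    exact_mod_cast h1.le
  obtain ⟨i, hi, hle⟩ := Finset.exists_le_of_sum_le (by simp) h2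
  refine ⟨i, ?_, by rw [Finset.mem_range] at hi; omega, hle⟩
  by_contra hg
  push Not at hg
  have hsub : c.lvl x i ⊆ c.nearT x := by
    intro q hq
    obtain ⟨hq1, hq2⟩ := Finset.mem_filter.1 hq
    obtain ⟨hq3, hq4⟩ := Finset.mem_filter.1 hq1
    refine Finset.mem_filter.2 ⟨hq3, hq4, ?_⟩
    have := Nat.lt_pow_succ_log_self (b := 2) (by norm_num) (ddn x.1 q)
    rw [hq2] at this
    exact this.le.trans (Nat.pow_le_pow_right (by norm_num) hg)
  have h3 : ((c.lvl x i).card : ℝ) ≤ (c.nearT x).card := by exact_mod_cast Finset.card_le_card hsub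
  have hn : (0 : ℝ) < c.n + 1 := by positivity
  rw [div_le_iff₀ hn] at hle
  have hK1 := c.K1_pos
  nlinarith

def CA : ℝ := 2 * 10 ^ 12

def A : ℝ := CA * c.K ^ 2 * (c.n + 2) ^ 6 * c.P.card / 2 ^ c.n

lemma A_pos : 0 < c.A := by
  have := c.hK
  have := c.N_pos
  unfold A CA; positivity

/-- sup of square counts -/
lemma exists_V (j : ℕ) : ∃ p ∈ c.P, ∀ Q, (c.P.filter (fun q => sqi j q = Q)).card ≤
    (c.P.filter (fun q => sqi j q = sqi j p)).card := by
  obtain ⟨p, hp, hmax⟩ := Finset.exists_max_image c.P (fun p => (c.P.filter (fun q => sqi j q = sqi j p)).card) c.hP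
  refine ⟨p, hp, fun Q => ?_⟩
  rcases Finset.eq_empty_or_nonempty (c.P.filter (fun q => sqi j q = Q)) with h | ⟨q, hq⟩
  · rw [h]; simp
  · obtain ⟨h1, h2⟩ := Finset.mem_filter.1 hq
    rw [← h2]; exact hmax q h1

/-- arithmetic: `d^{1-s} δ^{2-s} ≤ δ` -/
lemma big_div {i : ℕ} (hi : i ≤ c.n) : ((2 : ℝ) ^ i / 2 ^ c.n) ^ (2 - c.s) / 2 ^ i ≤ 1 / 2 ^ c.n := by
  have h2i : (0 : ℝ) < 2 ^ i := by positivity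
  have hD : (0 : ℝ) < 2 ^ c.n := by positivity
  have hle : (2 : ℝ) ^ i / 2 ^ c.n ≤ 1 := by
    rw [div_le_one hD]; exact pow_le_pow_right₀ (by norm_num) hi
  have h1 : ((2 : ℝ) ^ i / 2 ^ c.n) ^ (2 - c.s) ≤ ((2 : ℝ) ^ i / 2 ^ c.n) ^ (1 : ℝ) :=
    Real.rpow_le_rpow_of_exponent_ge (by positivity) hle (by linarith [c.hs1])
  rw [Real.rpow_one] at h1
  rw [div_le_div_iff₀ h2i hD]
  calc _ ≤ (2 : ℝ) ^ i / 2 ^ c.n * 2 ^ c.n := by gcongr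
    _ = _ := by field_simp

lemma top_lt {i : ℕ} (hg : c.g ≤ i) (hi : i ≤ c.n) (σ : ℤ) (t : ℤ × ℤ) (ht : |(t.1 : ℝ)| ≤ 2 ^ c.n) :
    ff c.P (2 ^ c.n) i σ (2 ^ i) t < c.A := by
  obtain ⟨p, hp, hV⟩ := c.exists_V i
  have h1 := top_bound c.P (2 ^ c.n) (by positivity) i _ hV σ t ht
  have h2 := c.hbig i hg hi p hp
  have h3 := c.big_div hi
  have hK := c.hK
  have hN := c.N_pos
  have h2i : (0 : ℝ) < 2 ^ i := by positivity
  have hD : (0 : ℝ) < 2 ^ c.n := by positivity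
  calc _ ≤ _ := h1
    _ ≤ 440 * (c.K * (2 ^ i / 2 ^ c.n : ℝ) ^ (2 - c.s) * c.P.card) / 2 ^ i := by gcongr
    _ = 440 * c.K * c.P.card * ((2 ^ i / 2 ^ c.n : ℝ) ^ (2 - c.s) / 2 ^ i) := by ring
    _ ≤ 440 * c.K * c.P.card * (1 / 2 ^ c.n) := by gcongr
    _ < CA * (c.K * 1) * 1 * c.P.card * (1 / 2 ^ c.n) := by
        have : 0 < c.K * c.P.card * (1 / 2 ^ c.n) := by positivity
        unfold CA
        nlinarith
    _ ≤ CA * (c.K * c.K) * (c.n + 2) ^ 6 * c.P.card * (1 / 2 ^ c.n) := by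
        have : (1 : ℝ) ≤ (c.n + 2) ^ 6 := one_le_pow₀ (by linarith [(Nat.cast_nonneg c.n : (0 : ℝ) ≤ c.n)])
        have : (0 : ℝ) ≤ CA := by unfold CA; positivity
        gcongr
    _ = c.A := by unfold A; ring

structure Good (x : (ℤ × ℤ) × (ℤ × ℤ)) (i j : ℕ) : Prop where
  hg : c.g ≤ i
  hi : i ≤ c.n
  hj : j < i
  hl : ((c.Pt x.2).card : ℝ) / (c.n + 1) ≤ (c.lvl x i).card
  h1 : c.A ≤ ff c.P (2 ^ c.n) i (x.1.1 / 2 ^ i) (2 ^ j) x.2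
  h2 : ff c.P (2 ^ c.n) i (x.1.1 / 2 ^ i) (2 ^ j) x.2 ≤ 6 * c.A
  h3 : ff c.P (2 ^ c.n) i (x.1.1 / 2 ^ i) (2 ^ j) x.2 / (c.n + 2) ≤
    ff c.P (2 ^ c.n) i (x.1.1 / 2 ^ i) (2 ^ j) x.2 - ff c.P (2 ^ c.n) i (x.1.1 / 2 ^ i) (2 * 2 ^ j) x.2

lemma lvl_strip {x : (ℤ × ℤ) × (ℤ × ℤ)} {i : ℕ} : c.lvl x i ⊆ strip c.P i (x.1.1 / 2 ^ i) := by
  intro q hq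
  obtain ⟨hq1, hq2⟩ := Finset.mem_filter.1 hq
  obtain ⟨hq3, hq4⟩ := Finset.mem_filter.1 hq1
  refine Finset.mem_filter.2 ⟨hq3, ?_⟩
  have := Nat.lt_pow_succ_log_self (b := 2) (by norm_num) (ddn x.1 q)
  rw [hq2] at this
  apply div_range
  unfold ddn at this
  have h := (max_lt_iff.1 this).1
  rw [abs_sub_comm, Int.abs_eq_natAbs]
  have h' : ((x.1.1 - q.1).natAbs : ℤ) < 2 ^ (i + 1) := by exact_mod_cast h
  rw [pow_succ] at h'
  linarith

lemma exists_good {x : (ℤ × ℤ) × (ℤ × ℤ)} (hx : x ∈ c.I1) (hr : 2 * (c.n + 1) * c.K1 < c.r)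
    (hr2 : 102 * (c.n + 1) * c.A ≤ c.r) : ∃ i j, c.Good x i j := by
  obtain ⟨i, hg, hi, hl⟩ := c.exists_lvl hx hr
  obtain ⟨hxI, hx1, hx2⟩ := Finset.mem_filter.1 hx
  obtain ⟨hp, ht⟩ := c.mem_Inc.1 hxI
  have hn : (0 : ℝ) < c.n + 1 := by positivity
  have hnear := near_count c.P (2 ^ c.n) i (x.1.1 / 2 ^ i) 1 one_pos x.2 4 (c.lvl x i) c.lvl_strip (by
    intro q hq
    obtain ⟨hq1, hq2⟩ := Finset.mem_filter.1 hq
    obtain ⟨hq3, hq4⟩ := Finset.mem_filter.1 hq1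
    rw [mul_one]
    exact c.h2u q hq3 x.2 hq4)
  have ha0 : 3 * c.A ≤ ff c.P (2 ^ c.n) i (x.1.1 / 2 ^ i) (2 ^ 0) x.2 := by
    rw [pow_zero]
    norm_num at hnear
    rw [div_le_iff₀ hn] at hl
    nlinarith
  obtain ⟨j, hji, b1, b2, b3⟩ := seq_lemma c.n i hi (fun j => ff c.P (2 ^ c.n) i (x.1.1 / 2 ^ i) (2 ^ j) x.2)
    c.A c.A_pos ha0 (c.top_lt hg hi _ _ (c.h2k _ hp _ ht)) (by
      intro j
      simp only [ff]
      rw [Finset.mul_sum]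
      refine Finset.sum_le_sum fun q _ => ?_
      rw [pow_succ, mul_comm ((2 : ℝ) ^ j) 2]
      exact PK_double (by positivity) _)
  refine ⟨i, j, hg, hi, hji, hl, b1, b2, ?_⟩
  rw [pow_succ, mul_comm ((2 : ℝ) ^ j) 2] at b3
  exact b3

def I3 (i j : ℕ) : Finset ((ℤ × ℤ) × (ℤ × ℤ)) := c.I1.filter (fun x => c.Good x i j)

lemma exists_I3 (hr : 2 * (c.n + 1) * c.K1 < c.r) (hr2 : 102 * (c.n + 1) * c.A ≤ c.r) :
    ∃ i j, (c.I1.card : ℝ) ≤ (c.n + 2) ^ 2 * (c.I3 i j).card := by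
  by_contra hcon
  push Not at hcon
  have hcov : c.I1 ⊆ (Finset.range (c.n + 1) ×ˢ Finset.range (c.n + 1)).biUnion (fun ij => c.I3 ij.1 ij.2) := by
    intro x hx
    obtain ⟨i, j, hgood⟩ := c.exists_good hx hr hr2
    have h1 := hgood.hi
    have h2 := hgood.hj
    refine Finset.mem_biUnion.2 ⟨(i, j), ?_, Finset.mem_filter.2 ⟨hx, hgood⟩⟩
    simp only [Finset.mem_product, Finset.mem_range]; omega
  have h1 := (Finset.card_le_card hcov).trans Finset.card_biUnion_le
  have h2 : (c.I1.card : ℝ) ≤ ∑ ij ∈ Finset.range (c.n + 1) ×ˢ Finset.range (c.n + 1), ((c.I3 ij.1 ij.2).card : ℝ) := by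
    exact_mod_cast h1
  have hI1 : (0 : ℝ) < c.I1.card := by
    have := c.I1_card
    have := c.Inc_pos
    linarith
  have hL : (0 : ℝ) < (c.n + 2) ^ 2 := by positivity
  have h3 : ∑ ij ∈ Finset.range (c.n + 1) ×ˢ Finset.range (c.n + 1), ((c.I3 ij.1 ij.2).card : ℝ) ≤
      ∑ ij ∈ Finset.range (c.n + 1) ×ˢ Finset.range (c.n + 1), (c.I1.card : ℝ) / (c.n + 2) ^ 2 := by
    refine Finset.sum_le_sum fun ij _ => ?_
    rw [le_div_iff₀ hL]
    linarith [hcon ij.1 ij.2]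
  rw [Finset.sum_const, nsmul_eq_mul, Finset.card_product, Finset.card_range] at h3
  push_cast at h3
  have h4 : ((c.n : ℝ) + 1) * (c.n + 1) * (c.I1.card / (c.n + 2) ^ 2) < c.I1.card := by
    rw [← mul_div_assoc, div_lt_iff₀ hL]
    nlinarith [(Nat.cast_nonneg c.n : (0 : ℝ) ≤ c.n)]
  linarith

end Cfg


lemma sum_le_image_mul {α β : Type*} [DecidableEq β] (s : Finset α) (f : α → β) (g : α → ℝ) (B : ℝ)
    (h : ∀ x ∈ s, ∑ y ∈ s.filter (fun y => f y = f x), g y ≤ B) :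
    ∑ x ∈ s, g x ≤ (s.image f).card * B := by
  rw [← Finset.sum_fiberwise_of_maps_to (t := s.image f) (g := f) (fun x hx => Finset.mem_image_of_mem f hx),
    ← nsmul_eq_mul, ← Finset.sum_const]
  refine Finset.sum_le_sum fun b hb => ?_
  obtain ⟨x, hx, rfl⟩ := Finset.mem_image.1 hb
  exact h x hx

lemma card_le_image_mul {α β : Type*} [DecidableEq β] (s : Finset α) (f : α → β) (B : ℝ)
    (h : ∀ x ∈ s, ((s.filter (fun y => f y = f x)).card : ℝ) ≤ B) :
    (s.card : ℝ) ≤ (s.image f).card * B := by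
  have := sum_le_image_mul s f (fun _ => 1) B (by intro x hx; simpa using h x hx)
  simpa using this

lemma strip_sum (S : Finset (ℤ × ℤ)) (i : ℕ) (Z : Finset ℤ) :
    ∑ σ ∈ Z, ((strip S i σ).card : ℝ) ≤ 5 * S.card := by
  have e : ∀ σ, ((strip S i σ).card : ℝ) = ∑ p ∈ S, if |p.1 / 2 ^ i - σ| ≤ 2 then (1 : ℝ) else 0 := by
    intro σ; unfold strip; rw [Finset.sum_boole]
  simp_rw [e]
  rw [Finset.sum_comm]
  calc _ ≤ ∑ p ∈ S, (5 : ℝ) := by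
        refine Finset.sum_le_sum fun p _ => ?_
        rw [Finset.sum_boole]
        have : (Z.filter (fun σ => |p.1 / 2 ^ i - σ| ≤ 2)) ⊆ Finset.Icc (p.1 / 2 ^ i - 2) (p.1 / 2 ^ i + 2) := by
          intro σ hσ
          have := (Finset.mem_filter.1 hσ).2
          rw [abs_le] at this
          rw [Finset.mem_Icc]; omega
        have h2 := Finset.card_le_card this
        rw [Int.card_Icc] at h2
        have h3 : (Z.filter (fun σ => |p.1 / 2 ^ i - σ| ≤ 2)).card ≤ 5 := by omega
        exact_mod_cast h3
    _ = _ := by rw [Finset.sum_const, nsmul_eq_mul]; ring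

namespace Cfg
variable (c : Cfg)

def L : ℝ := c.n + 2
def eta : ℝ := 1 / (64 * c.L)
def aT (t : ℤ × ℤ) : ℝ := (t.1 : ℝ) / 2 ^ c.n
def al (i j : ℕ) : ℝ := c.eta * 2 ^ j / 2 ^ i
def be (j : ℕ) : ℝ := c.eta * 2 ^ j
def bT (i : ℕ) (σ : ℤ) (t : ℤ × ℤ) : ℝ := t.2 + c.aT t * (σ * 2 ^ i)
def cell (i j : ℕ) (σ : ℤ) (t : ℤ × ℤ) : ℤ × ℤ := (⌊c.aT t / c.al i j⌋, ⌊c.bT i σ t / c.be j⌋)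

lemma L_ge : 2 ≤ c.L := by unfold L; linarith [(Nat.cast_nonneg c.n : (0 : ℝ) ≤ c.n)]
lemma L_pos : 0 < c.L := by linarith [c.L_ge]
lemma eta_pos : 0 < c.eta := by have := c.L_pos; unfold eta; positivity
lemma eta_le : c.eta ≤ 1 / 128 := by
  have := c.L_ge
  unfold eta
  rw [div_le_div_iff₀ (by positivity) (by norm_num)]; linarith
lemma al_pos (i j : ℕ) : 0 < c.al i j := by have := c.eta_pos; unfold al; positivity
lemma be_pos (j : ℕ) : 0 < c.be j := by have := c.eta_pos; unfold be; positivity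

lemma al_le (i j : ℕ) : c.al i j ≤ 2 ^ j / 2 ^ i := by
  have := c.eta_le
  have h2 := c.eta_pos
  unfold al
  gcongr
  have : (0 : ℝ) < 2 ^ j := by positivity
  nlinarith

lemma uu_eq (i : ℕ) (σ : ℤ) (t q : ℤ × ℤ) :
    uu (2 ^ c.n) t q = q.2 - c.aT t * (q.1 - σ * 2 ^ i) - c.bT i σ t := by
  unfold uu bT aT; ring

lemma floor_cell {x α : ℝ} (hα : 0 < α) : (⌊x / α⌋ : ℝ) * α ≤ x ∧ x < ((⌊x / α⌋ : ℝ) + 1) * α := by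
  constructor
  · rw [← le_div_iff₀ hα]; exact Int.floor_le _
  · rw [← div_lt_iff₀ hα]; exact Int.lt_floor_add_one _

/-- parameters in the cell of `t` give almost the same line over the strip -/
lemma cell_close {i j : ℕ} {σ : ℤ} {t q : ℤ × ℤ} (hq : q ∈ strip c.P i σ) {a b : ℝ}
    (h1 : ((c.cell i j σ t).1 : ℝ) * c.al i j ≤ a) (h2 : a < (((c.cell i j σ t).1 : ℝ) + 1) * c.al i j)
    (h3 : ((c.cell i j σ t).2 : ℝ) * c.be j ≤ b) (h4 : b < (((c.cell i j σ t).2 : ℝ) + 1) * c.be j) :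
    |c.aT t - a| ≤ c.al i j ∧
    |uu (2 ^ c.n) t q - ((q.2 : ℝ) - a * (q.1 - σ * 2 ^ i) - b)| ≤ 4 * c.eta * 2 ^ j := by
  obtain ⟨f1, f2⟩ := floor_cell (x := c.aT t) (c.al_pos i j)
  obtain ⟨f3, f4⟩ := floor_cell (x := c.bT i σ t) (c.be_pos j)
  have e1 : |c.aT t - a| ≤ c.al i j := by
    simp only [cell] at h1 h2
    rw [abs_le]; constructor <;> linarith
  have e2 : |c.bT i σ t - b| ≤ c.be j := by
    simp only [cell] at h3 h4
    rw [abs_le]; constructor <;> linarith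
  refine ⟨e1, ?_⟩
  rw [c.uu_eq i σ]
  have hx := strip_x hq
  have : (q.2 : ℝ) - c.aT t * (q.1 - σ * 2 ^ i) - c.bT i σ t - ((q.2 : ℝ) - a * (q.1 - σ * 2 ^ i) - b)
      = -((c.aT t - a) * (q.1 - σ * 2 ^ i) + (c.bT i σ t - b)) := by ring
  rw [this, abs_neg]
  calc _ ≤ |c.aT t - a| * |(q.1 : ℝ) - σ * 2 ^ i| + |c.bT i σ t - b| := by
        rw [← abs_mul]; exact abs_add_le _ _
    _ ≤ c.al i j * (3 * 2 ^ i) + c.be j := by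
        have := c.al_pos i j
        gcongr
    _ = _ := by unfold al be; field_simp; ring

lemma cell_close2 {i j : ℕ} {σ : ℤ} {t t0 q : ℤ × ℤ} (hq : q ∈ strip c.P i σ)
    (h : c.cell i j σ t = c.cell i j σ t0) :
    |c.aT t - c.aT t0| ≤ 2 ^ j / 2 ^ i ∧ |uu (2 ^ c.n) t q - uu (2 ^ c.n) t0 q| ≤ 2 ^ j := by
  obtain ⟨f1, f2⟩ := floor_cell (x := c.aT t0) (c.al_pos i j)
  obtain ⟨f3, f4⟩ := floor_cell (x := c.bT i σ t0) (c.be_pos j)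
  have := c.cell_close (t := t) (j := j) hq (a := c.aT t0) (b := c.bT i σ t0)
    (by rw [h]; exact f1) (by rw [h]; exact f2) (by rw [h]; exact f3) (by rw [h]; exact f4)
  rw [← c.uu_eq] at this
  refine ⟨this.1.trans (c.al_le i j), this.2.trans ?_⟩
  have h1 := c.eta_le
  have : (0 : ℝ) < 2 ^ j := by positivity
  nlinarith

lemma I3_mem {i j : ℕ} {x : (ℤ × ℤ) × (ℤ × ℤ)} (hx : x ∈ c.I3 i j) :
    x.1 ∈ c.P ∧ x.2 ∈ c.Tp x.1 ∧ c.Good x i j ∧ c.r / 2 ≤ ((c.Pt x.2).card : ℝ) ∧ ((c.nearT x).card : ℝ) ≤ c.K1 := by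
  obtain ⟨h1, h2⟩ := Finset.mem_filter.1 hx
  obtain ⟨h3, h4, h5⟩ := Finset.mem_filter.1 h1
  obtain ⟨h6, h7⟩ := c.mem_Inc.1 h3
  exact ⟨h6, h7, h2, h4, h5⟩

lemma self_strip {p : ℤ × ℤ} (hp : p ∈ c.P) (i : ℕ) : p ∈ strip c.P i (p.1 / 2 ^ i) := by
  refine Finset.mem_filter.2 ⟨hp, ?_⟩
  simp

lemma cell_hh {i j : ℕ} {x : (ℤ × ℤ) × (ℤ × ℤ)} (hx : x ∈ c.I3 i j) {σ : ℤ} (hσ : x.1.1 / 2 ^ i = σ) {a b : ℝ}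
    (h1 : ((c.cell i j σ x.2).1 : ℝ) * c.al i j ≤ a) (h2 : a < (((c.cell i j σ x.2).1 : ℝ) + 1) * c.al i j)
    (h3 : ((c.cell i j σ x.2).2 : ℝ) * c.be j ≤ b) (h4 : b < (((c.cell i j σ x.2).2 : ℝ) + 1) * c.be j) :
    |a| ≤ 2 ∧ c.A / (2 * c.L) ≤ hh (strip c.P i σ) (fun q => (q.1 : ℝ) - σ * 2 ^ i) (fun q => (q.2 : ℝ)) (2 ^ j) a b := by
  obtain ⟨hp, ht, hg, -, -⟩ := c.I3_mem hx
  subst hσ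
  have hw : (0 : ℝ) < 2 ^ j := by positivity
  have hL := c.L_pos
  have heta := c.eta_pos
  have heta' := c.eta_le
  constructor
  · have e1 := (c.cell_close (c.self_strip hp i) h1 h2 h3 h4).1
    have e2 := c.al_le i j
    have e3 : (2 : ℝ) ^ j / 2 ^ i ≤ 1 := by
      rw [div_le_one (by positivity)]; exact pow_le_pow_right₀ (by norm_num) hg.hj.le
    have e4 : |c.aT x.2| ≤ 1 := by
      unfold aT
      rw [abs_div, abs_of_pos (by positivity : (0 : ℝ) < 2 ^ c.n), div_le_one (by positivity)]
      exact c.h2k _ hp _ ht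
    rw [abs_le] at *
    constructor <;> linarith
  · have g1 := hg.h1
    have g3 := hg.h3
    set F := ff c.P (2 ^ c.n) i (x.1.1 / 2 ^ i) (2 ^ j) x.2 with hF
    set F2 := ff c.P (2 ^ c.n) i (x.1.1 / 2 ^ i) (2 * 2 ^ j) x.2 with hF2
    have hA := c.A_pos
    have key : (1 - 2 * (4 * c.eta)) * F - (1 + 2 * (4 * c.eta)) * F2 ≤
        hh (strip c.P i (x.1.1 / 2 ^ i)) (fun q => (q.1 : ℝ) - (x.1.1 / 2 ^ i : ℤ) * 2 ^ i) (fun q => (q.2 : ℝ)) (2 ^ j) a b := by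
      rw [hF, hF2]
      unfold ff hh
      rw [Finset.mul_sum, Finset.mul_sum, ← Finset.sum_sub_distrib]
      refine Finset.sum_le_sum fun q hq => ?_
      have e := (c.cell_close hq h1 h2 h3 h4).2
      have k1 := (PK_harnack hw (by positivity : 0 ≤ 4 * c.eta) (by linarith) e).1
      have k2 := (PK_harnack (by positivity : (0 : ℝ) < 2 * 2 ^ j) (by positivity : 0 ≤ 4 * c.eta) (by linarith)
        (e.trans (by nlinarith))).2
      linarith
    refine le_trans ?_ key
    have g3' : F / c.L ≤ F - F2 := g3
    have hFpos : 0 < F := lt_of_lt_of_le hA g1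
    have hFL : 0 < F / c.L := by positivity
    have hη : c.eta * F = F / c.L / 64 := by unfold eta; field_simp
    have hη2 : c.eta * F2 ≤ c.eta * F := by
      apply mul_le_mul_of_nonneg_left _ heta.le; linarith
    have hAL : c.A / (2 * c.L) ≤ F / c.L / 2 := by
      rw [div_div, mul_comm c.L 2]; gcongr
    nlinarith

def C1 : ℝ := 1179648000

/-- number of active cells over one strip -/
lemma cells_strip (i j : ℕ) (σ : ℤ) (V : ℕ) (hV : ∀ Q, (c.P.filter (fun q => sqi j q = Q)).card ≤ V) :
    ((((c.I3 i j).filter (fun x => x.1.1 / 2 ^ i = σ)).image (fun x => c.cell i j σ x.2)).card : ℝ) *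
      ((2 ^ j) ^ 3 * c.A ^ 2) ≤ 235929600 * c.L ^ 4 * 2 ^ i * (strip c.P i σ).card * V := by
  set C := ((c.I3 i j).filter (fun x => x.1.1 / 2 ^ i = σ)).image (fun x => c.cell i j σ x.2) with hC
  have hw : (0 : ℝ) < 2 ^ j := by positivity
  have hd : (0 : ℝ) < 2 ^ i := by positivity
  have hL := c.L_pos
  have hA := c.A_pos
  have en := energy (strip c.P i σ) (fun q => (q.1 : ℝ) - σ * 2 ^ i) (fun q => (q.2 : ℝ)) hw C (c.al i j) (c.be j)
    (c.A / (2 * c.L)) (c.al_pos i j) (c.be_pos j) (by positivity) (by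
      intro z hz a b h1 h2 h3 h4
      obtain ⟨x, hx, rfl⟩ := Finset.mem_image.1 hz
      obtain ⟨hx1, hx2⟩ := Finset.mem_filter.1 hx
      exact c.cell_hh hx1 hx2 h1 h2 h3 h4)
  have hVs : ∀ Q, ((strip c.P i σ).filter (fun q => sqi j q = Q)).card ≤ V := fun Q =>
    (Finset.card_le_card (Finset.filter_subset_filter _ (Finset.filter_subset _ _))).trans (hV Q)
  have s1 : ∑ p ∈ strip c.P i σ, ∑ q ∈ strip c.P i σ, KK (2 ^ j) (((q.1 : ℝ) - σ * 2 ^ i) - ((p.1 : ℝ) - σ * 2 ^ i)) ((q.2 : ℝ) - p.2)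
      ≤ (strip c.P i σ).card * (288 * V / 2 ^ j) := by
    rw [← nsmul_eq_mul, ← Finset.sum_const]
    exact Finset.sum_le_sum fun p _ => KK_sum _ j V hVs p _
  have hpi : Real.pi ^ 2 ≤ 10 := by nlinarith [Real.pi_lt_d2, Real.pi_pos]
  have h2 : (C.card : ℝ) * (c.al i j * c.be j * (c.A / (2 * c.L)) ^ 2 / 5) ≤
      10 * ((strip c.P i σ).card * (288 * V / 2 ^ j)) := by
    refine en.trans ?_
    have : 0 ≤ (strip c.P i σ).card * (288 * (V : ℝ) / 2 ^ j) := by positivity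
    calc _ ≤ Real.pi ^ 2 * ((strip c.P i σ).card * (288 * V / 2 ^ j)) := by gcongr
      _ ≤ _ := by gcongr
  have e1 : c.al i j * c.be j * (c.A / (2 * c.L)) ^ 2 / 5 = ((2 ^ j) ^ 3 * c.A ^ 2) / (81920 * c.L ^ 4 * 2 ^ i * 2 ^ j) := by
    unfold al be eta
    field_simp
    ring
  rw [e1, ← mul_div_assoc, div_le_iff₀ (by positivity)] at h2
  refine h2.trans (le_of_eq ?_)
  field_simp
  ring

def fc (i j : ℕ) (x : (ℤ × ℤ) × (ℤ × ℤ)) : ℤ × (ℤ × ℤ) := (x.1.1 / 2 ^ i, c.cell i j (x.1.1 / 2 ^ i) x.2)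

def CC (i j : ℕ) : Finset (ℤ × (ℤ × ℤ)) := (c.I3 i j).image (c.fc i j)

def PC (i j : ℕ) : Finset ((ℤ × ℤ) × (ℤ × (ℤ × ℤ))) := (c.I3 i j).image (fun x => (x.1, c.fc i j x))

lemma CC_card (i j : ℕ) (V : ℕ) (hV : ∀ Q, (c.P.filter (fun q => sqi j q = Q)).card ≤ V) :
    ((c.CC i j).card : ℝ) * ((2 ^ j) ^ 3 * c.A ^ 2) ≤ C1 * c.L ^ 4 * 2 ^ i * c.P.card * V := by
  have hL := c.L_pos
  have hA := c.A_pos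
  have h1 := Finset.card_eq_sum_card_image Prod.fst (c.CC i j)
  have h2 : ((c.CC i j).card : ℝ) = ∑ σ ∈ (c.CC i j).image Prod.fst, (((c.CC i j).filter (fun z => z.1 = σ)).card : ℝ) := by
    exact_mod_cast h1
  rw [h2, Finset.sum_mul]
  have h3 := strip_sum c.P i ((c.CC i j).image Prod.fst)
  calc _ ≤ ∑ σ ∈ (c.CC i j).image Prod.fst, 235929600 * c.L ^ 4 * 2 ^ i * (strip c.P i σ).card * V := by
        refine Finset.sum_le_sum fun σ _ => ?_
        refine le_trans ?_ (c.cells_strip i j σ V hV)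
        gcongr
        refine Finset.card_le_card_of_injOn Prod.snd ?_ ?_
        · intro z hz
          obtain ⟨hz1, hz2⟩ := Finset.mem_filter.1 hz
          obtain ⟨x, hx, rfl⟩ := Finset.mem_image.1 hz1
          refine Finset.mem_coe.2 (Finset.mem_image.2 ⟨x, Finset.mem_filter.2 ⟨hx, hz2⟩, ?_⟩)
          simp only [fc] at hz2 ⊢
          rw [hz2]
        · intro y hy z hz hyz
          have hy' := (Finset.mem_filter.1 hy).2
          have hz' := (Finset.mem_filter.1 hz).2
          exact Prod.ext (hy'.trans hz'.symm) hyz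
    _ = 235929600 * c.L ^ 4 * 2 ^ i * V * ∑ σ ∈ (c.CC i j).image Prod.fst, ((strip c.P i σ).card : ℝ) := by
        rw [Finset.mul_sum]
        refine Finset.sum_congr rfl fun σ _ => by ring
    _ ≤ 235929600 * c.L ^ 4 * 2 ^ i * V * (5 * c.P.card) := by gcongr
    _ = _ := by unfold C1; ring

/-- points near a good tube -/
lemma near_good {i j : ℕ} {x : (ℤ × ℤ) × (ℤ × ℤ)} (hx : x ∈ c.I3 i j) (S : Finset (ℤ × ℤ))
    (hS : S ⊆ strip c.P i (x.1.1 / 2 ^ i)) (h : ∀ q ∈ S, |uu (2 ^ c.n) x.2 q| ≤ 5 * 2 ^ j) :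
    (S.card : ℝ) ≤ 156 * 2 ^ j * c.A := by
  have h1 := near_count c.P (2 ^ c.n) i _ (2 ^ j) (by positivity) x.2 5 S hS h
  have h2 := (c.I3_mem hx).2.2.1.h2
  have hw : (0 : ℝ) < 2 ^ j := by positivity
  refine h1.trans ?_
  calc _ ≤ (1 + 5 ^ 2) * 2 ^ j * (6 * c.A) := by gcongr
    _ = _ := by ring

lemma one_le_w (j : ℕ) : (1 : ℝ) ≤ 2 ^ j := one_le_pow₀ (by norm_num)

lemma near5 {i j : ℕ} {σ : ℤ} {t t0 q : ℤ × ℤ} (hq : q ∈ strip c.P i σ)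
    (h : c.cell i j σ t = c.cell i j σ t0) (ht : t ∈ c.Tp q) : |uu (2 ^ c.n) t0 q| ≤ 5 * 2 ^ j := by
  have h1 := (c.cell_close2 hq h).2
  have h2 := c.h2u q (Finset.mem_filter.1 hq).1 t ht
  have h3 := one_le_w j
  rw [abs_le] at *
  constructor <;> linarith

lemma PC_card (i j : ℕ) : ((c.PC i j).card : ℝ) ≤ (c.CC i j).card * (156 * 2 ^ j * c.A) := by
  have e : (c.CC i j) = (c.PC i j).image Prod.snd := by
    unfold CC PC; rw [Finset.image_image]; rfl
  rw [e]
  refine card_le_image_mul _ _ _ fun y hy => ?_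
  obtain ⟨x, hx, rfl⟩ := Finset.mem_image.1 hy
  have hinj : ((c.PC i j).filter (fun y => y.2 = c.fc i j x)).card =
      (((c.PC i j).filter (fun y => y.2 = c.fc i j x)).image Prod.fst).card := by
    rw [Finset.card_image_of_injOn]
    intro y hy z hz hyz
    exact Prod.ext hyz ((Finset.mem_filter.1 hy).2.trans (Finset.mem_filter.1 hz).2.symm)
  simp only
  rw [hinj]
  have hmem : ∀ q ∈ ((c.PC i j).filter (fun y => y.2 = c.fc i j x)).image Prod.fst,
      q ∈ strip c.P i (x.1.1 / 2 ^ i) ∧ |uu (2 ^ c.n) x.2 q| ≤ 5 * 2 ^ j := by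
    intro q hq
    obtain ⟨y, hy, rfl⟩ := Finset.mem_image.1 hq
    obtain ⟨hy1, hy2⟩ := Finset.mem_filter.1 hy
    obtain ⟨z, hz, rfl⟩ := Finset.mem_image.1 hy1
    obtain ⟨hzp, hzt, -⟩ := c.I3_mem hz
    simp only [fc, Prod.mk.injEq] at hy2
    obtain ⟨e1, e2⟩ := hy2
    have hs := c.self_strip hzp i
    rw [e1] at hs e2
    exact ⟨hs, c.near5 hs e2 hzt⟩
  exact c.near_good hx _ (fun q hq => (hmem q hq).1) (fun q hq => (hmem q hq).2)

lemma PC_bound (i j : ℕ) (V : ℕ) (hV : ∀ Q, (c.P.filter (fun q => sqi j q = Q)).card ≤ V) :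
    ((c.PC i j).card : ℝ) * ((2 ^ j) ^ 2 * c.A) ≤ 156 * C1 * c.L ^ 4 * 2 ^ i * c.P.card * V := by
  have h1 := c.PC_card i j
  have h2 := c.CC_card i j V hV
  have hA := c.A_pos
  have hw : (0 : ℝ) < 2 ^ j := by positivity
  calc _ ≤ ((c.CC i j).card * (156 * 2 ^ j * c.A)) * ((2 ^ j) ^ 2 * c.A) := by gcongr
    _ = 156 * ((c.CC i j).card * ((2 ^ j) ^ 3 * c.A ^ 2)) := by ring
    _ ≤ 156 * (C1 * c.L ^ 4 * 2 ^ i * c.P.card * V) := by gcongr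
    _ = _ := by ring

end Cfg


namespace Cfg
variable (c : Cfg)

lemma pc_eq {i j : ℕ} {x y : (ℤ × ℤ) × (ℤ × ℤ)} (h : (y.1, c.fc i j y) = (x.1, c.fc i j x)) :
    y.1 = x.1 ∧ c.cell i j (x.1.1 / 2 ^ i) y.2 = c.cell i j (x.1.1 / 2 ^ i) x.2 := by
  have h1 : y.1 = x.1 := (Prod.mk.inj h).1
  have h2 : c.fc i j y = c.fc i j x := (Prod.mk.inj h).2
  refine ⟨h1, ?_⟩
  have h3 := congrArg Prod.snd h2
  simp only [fc] at h3
  rw [h1] at h3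
  exact h3

lemma fiber_K {i j : ℕ} (hi : i ≤ c.n) (hj : j < i) {x : (ℤ × ℤ) × (ℤ × ℤ)} (hx : x ∈ c.I3 i j) :
    (((c.I3 i j).filter (fun y => (y.1, c.fc i j y) = (x.1, c.fc i j x))).card : ℝ) ≤
      c.K * (2 ^ j / 2 ^ i : ℝ) ^ c.s * c.M := by
  obtain ⟨hp, ht, hg, -, -⟩ := c.I3_mem hx
  have hw := one_le_w j
  refine le_trans ?_ (c.h4 x.1 hp (c.aT x.2) (2 ^ j / 2 ^ i) ?_ ?_)
  · refine Nat.cast_le.2 ?_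
    refine Finset.card_le_card_of_injOn Prod.snd ?_ ?_
    · intro y hy
      obtain ⟨hy1, hy2⟩ := Finset.mem_filter.1 hy
      obtain ⟨hyp, hyt, -⟩ := c.I3_mem hy1
      obtain ⟨e1, e2⟩ := c.pc_eq hy2
      rw [e1] at hyt
      refine Finset.mem_coe.2 (Finset.mem_filter.2 ⟨hyt, ?_⟩)
      exact (c.cell_close2 (c.self_strip hp i) e2).1
    · intro y hy z hz hyz
      have hy' := (c.pc_eq (Finset.mem_filter.1 hy).2).1
      have hz' := (c.pc_eq (Finset.mem_filter.1 hz).2).1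
      exact Prod.ext (hy'.trans hz'.symm) hyz
  · have : (2 : ℝ) ^ i ≤ 2 ^ c.n := pow_le_pow_right₀ (by norm_num) hi
    gcongr
  · rw [div_le_one (by positivity)]; exact pow_le_pow_right₀ (by norm_num) hj.le

lemma I3_lower {i j : ℕ} (h : (c.I1.card : ℝ) ≤ (c.n + 2) ^ 2 * (c.I3 i j).card) :
    c.M * c.P.card ≤ 8 * c.L ^ 2 * (c.I3 i j).card := by
  have h1 := c.I1_card
  have h2 := c.Inc_ge
  have h3 : (c.I1.card : ℝ) ≤ c.L ^ 2 * (c.I3 i j).card := h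
  linarith

lemma I3_nonempty {i j : ℕ} (h : (c.I1.card : ℝ) ≤ (c.n + 2) ^ 2 * (c.I3 i j).card) :
    (c.I3 i j).Nonempty := by
  have h1 := c.I3_lower h
  have h2 := mul_pos c.hM c.N_pos
  rw [← Finset.card_pos]
  by_contra hcon
  have : (c.I3 i j).card = 0 := by omega
  rw [this] at h1
  norm_num at h1
  linarith

lemma exp_arith {i j : ℕ} (hi : i ≤ c.n) : (2 : ℝ) ^ i * (2 ^ j / 2 ^ i : ℝ) ^ c.s * (2 ^ j / 2 ^ c.n : ℝ) ^ (2 - c.s) ≤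
    (2 ^ j) ^ 2 / 2 ^ c.n := by
  have hw : (0 : ℝ) < 2 ^ j := by positivity
  have hd : (0 : ℝ) < 2 ^ i := by positivity
  have hD : (0 : ℝ) < 2 ^ c.n := by positivity
  have hdD : (2 : ℝ) ^ i ≤ 2 ^ c.n := pow_le_pow_right₀ (by norm_num) hi
  generalize (2 : ℝ) ^ j = w at *
  generalize (2 : ℝ) ^ i = d at *
  generalize (2 : ℝ) ^ c.n = D at *
  rw [Real.div_rpow hw.le hd.le, Real.div_rpow hw.le hD.le]
  have e1 : w ^ c.s * w ^ (2 - c.s) = w ^ 2 := by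
    rw [← Real.rpow_add hw, ← Real.rpow_natCast]; congr 1; push_cast; ring
  have e2 : d ^ c.s * d ^ (1 - c.s) = d := by
    rw [← Real.rpow_add hd]; simp
  have e3 : D ^ (2 - c.s) = D * D ^ (1 - c.s) := by
    nth_rewrite 2 [← Real.rpow_one D]
    rw [← Real.rpow_add hD]; congr 1; ring
  have h4 : d ^ (1 - c.s) ≤ D ^ (1 - c.s) := Real.rpow_le_rpow hd.le hdD (by linarith [c.hs1])
  have p1 : 0 < d ^ c.s := Real.rpow_pos_of_pos hd _
  have p2 : 0 < D ^ (1 - c.s) := Real.rpow_pos_of_pos hD _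
  have p3 : 0 < d ^ (1 - c.s) := Real.rpow_pos_of_pos hd _
  calc d * (w ^ c.s / d ^ c.s) * (w ^ (2 - c.s) / D ^ (2 - c.s))
      = (w ^ c.s * w ^ (2 - c.s)) * (d / d ^ c.s) / D ^ (2 - c.s) := by ring
    _ = w ^ 2 * d ^ (1 - c.s) / (D * D ^ (1 - c.s)) := by
        rw [e1, e3]
        congr 2
        rw [div_eq_iff p1.ne']; linarith
    _ ≤ w ^ 2 * D ^ (1 - c.s) / (D * D ^ (1 - c.s)) := by gcongr
    _ = _ := by field_simp

/-- the case `j ≥ g` is impossible -/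
lemma case_big {i j : ℕ} (h : (c.I1.card : ℝ) ≤ (c.n + 2) ^ 2 * (c.I3 i j).card) (hgj : c.g ≤ j) : False := by
  obtain ⟨x0, hx0⟩ := c.I3_nonempty h
  have hg := (c.I3_mem hx0).2.2.1
  obtain ⟨pm, hpm, hV⟩ := c.exists_V j
  have h1 := c.PC_bound i j _ hV
  have h2 := card_le_image_mul (c.I3 i j) (fun y => (y.1, c.fc i j y)) _ (fun x hx => c.fiber_K hg.hi hg.hj hx)
  have h3 := c.hbig j hgj (hg.hj.le.trans hg.hi) pm hpm
  have h4 := c.exp_arith (j := j) hg.hi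
  have h5 := c.I3_lower h
  have hA := c.A_pos
  have hL := c.L_pos
  have hK := c.hK
  have hM := c.hM
  have hN := c.N_pos
  have hw : (0 : ℝ) < 2 ^ j := by positivity
  have hd : (0 : ℝ) < 2 ^ i := by positivity
  have hD : (0 : ℝ) < 2 ^ c.n := by positivity
  set V : ℝ := ((c.P.filter (fun q => sqi j q = sqi j pm)).card : ℝ) with hVdef
  set X : ℝ := (2 ^ j / 2 ^ i : ℝ) ^ c.s with hX
  set Y : ℝ := (2 ^ j / 2 ^ c.n : ℝ) ^ (2 - c.s) with hY
  have hXp : 0 < X := Real.rpow_pos_of_pos (by positivity) _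
  have hYp : 0 < Y := Real.rpow_pos_of_pos (by positivity) _
  have hC1 : (0 : ℝ) < C1 := by unfold C1; norm_num
  change ((c.I3 i j).card : ℝ) ≤ (c.PC i j).card * (c.K * X * c.M) at h2
  have k1 : ((c.I3 i j).card : ℝ) * ((2 ^ j) ^ 2 * c.A) ≤
      156 * C1 * c.L ^ 4 * c.K ^ 2 * c.M * c.P.card ^ 2 * ((2 ^ j) ^ 2 / 2 ^ c.n) := by
    calc _ ≤ ((c.PC i j).card * (c.K * X * c.M)) * ((2 ^ j) ^ 2 * c.A) := by gcongr
      _ = ((c.PC i j).card * ((2 ^ j) ^ 2 * c.A)) * (c.K * X * c.M) := by ring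
      _ ≤ (156 * C1 * c.L ^ 4 * 2 ^ i * c.P.card * V) * (c.K * X * c.M) := by gcongr
      _ ≤ (156 * C1 * c.L ^ 4 * 2 ^ i * c.P.card * (c.K * Y * c.P.card)) * (c.K * X * c.M) := by gcongr
      _ = 156 * C1 * c.L ^ 4 * c.K ^ 2 * c.M * c.P.card ^ 2 * (2 ^ i * X * Y) := by ring
      _ ≤ _ := by gcongr
  have k2 : ((c.I3 i j).card : ℝ) * c.A ≤ 156 * C1 * c.L ^ 4 * c.K ^ 2 * c.M * c.P.card ^ 2 / 2 ^ c.n := by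
    have : (0 : ℝ) < (2 ^ j) ^ 2 := by positivity
    refine le_of_mul_le_mul_right ?_ this
    calc _ = ((c.I3 i j).card : ℝ) * ((2 ^ j) ^ 2 * c.A) := by ring
      _ ≤ _ := k1
      _ = _ := by ring
  have k3 : ((c.I3 i j).card : ℝ) * (CA * c.L ^ 2) ≤ 156 * C1 * (c.M * c.P.card) := by
    have hpos : 0 < c.K ^ 2 * c.L ^ 4 * c.P.card / 2 ^ c.n := by positivity
    refine le_of_mul_le_mul_right ?_ hpos
    calc _ = ((c.I3 i j).card : ℝ) * c.A := by unfold A L; ring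
      _ ≤ _ := k2
      _ = _ := by ring
  have hMN : 0 < c.M * c.P.card := mul_pos hM hN
  unfold CA C1 at *
  nlinarith

lemma fiber_tri {i j : ℕ} (hi : i ≤ c.n) (hj : j < i) {x : (ℤ × ℤ) × (ℤ × ℤ)} (hx : x ∈ c.I3 i j) :
    ∑ y ∈ (c.I3 i j).filter (fun y => (y.1, c.fc i j y) = (x.1, c.fc i j x)), ((c.lvl y i).card : ℝ) ≤
      156 * 2 ^ j * c.A * (432 * 2 ^ c.n / 2 ^ i) := by
  obtain ⟨hp, ht, hg, -, -⟩ := c.I3_mem hx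
  set Q := (strip c.P i (x.1.1 / 2 ^ i)).filter (fun q => |uu (2 ^ c.n) x.2 q| ≤ 5 * 2 ^ j ∧ 2 ^ i ≤ ddn x.1 q) with hQ
  have hQc : (Q.card : ℝ) ≤ 156 * 2 ^ j * c.A :=
    c.near_good hx Q (Finset.filter_subset _ _) (fun q hq => (Finset.mem_filter.1 hq).2.1)
  set Fb := (c.I3 i j).filter (fun y => (y.1, c.fc i j y) = (x.1, c.fc i j x)) with hFb
  have e1 : ∀ y ∈ Fb, ((c.lvl y i).card : ℝ) ≤ ∑ q ∈ Q, if y.2 ∈ c.Tp q then (1 : ℝ) else 0 := by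
    intro y hy
    obtain ⟨hy1, hy2⟩ := Finset.mem_filter.1 hy
    obtain ⟨a1, a2⟩ := c.pc_eq hy2
    rw [Finset.sum_boole]
    norm_cast
    refine Finset.card_le_card fun q hq => ?_
    have hs := c.lvl_strip hq
    rw [a1] at hs
    obtain ⟨q1, q2⟩ := Finset.mem_filter.1 hq
    obtain ⟨q3, q4⟩ := Finset.mem_filter.1 q1
    refine Finset.mem_filter.2 ⟨Finset.mem_filter.2 ⟨hs, c.near5 hs a2 q4, ?_⟩, q4⟩
    rw [a1] at q2
    have hne : ddn x.1 q ≠ 0 := by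
      intro h0; rw [h0] at q2; simp at q2; omega
    have := Nat.pow_log_le_self 2 hne
    rwa [q2] at this
  calc _ ≤ ∑ y ∈ Fb, ∑ q ∈ Q, (if y.2 ∈ c.Tp q then (1 : ℝ) else 0) := Finset.sum_le_sum e1
    _ = ∑ q ∈ Q, ∑ y ∈ Fb, (if y.2 ∈ c.Tp q then (1 : ℝ) else 0) := Finset.sum_comm
    _ ≤ ∑ q ∈ Q, (432 * 2 ^ c.n / 2 ^ i : ℝ) := by
        refine Finset.sum_le_sum fun q hq => ?_
        obtain ⟨b1, b2, b3⟩ := Finset.mem_filter.1 hq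
        refine le_trans ?_ (c.common_E2 hp (Finset.mem_filter.1 b1).1 i hi (fun _ => b3))
        rw [Finset.sum_boole]
        norm_cast
        refine Finset.card_le_card_of_injOn Prod.snd ?_ ?_
        · intro y hy
          obtain ⟨y1, y2⟩ := Finset.mem_filter.1 hy
          obtain ⟨y3, y4⟩ := Finset.mem_filter.1 y1
          have hyt := (c.I3_mem y3).2.1
          rw [(c.pc_eq y4).1] at hyt
          exact Finset.mem_coe.2 (Finset.mem_inter.2 ⟨hyt, y2⟩)
        · intro y hy z hz hyz
          have hy' := (c.pc_eq (Finset.mem_filter.1 (Finset.mem_filter.1 hy).1).2).1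
          have hz' := (c.pc_eq (Finset.mem_filter.1 (Finset.mem_filter.1 hz).1).2).1
          exact Prod.ext (hy'.trans hz'.symm) hyz
    _ = Q.card * (432 * 2 ^ c.n / 2 ^ i : ℝ) := by rw [Finset.sum_const, nsmul_eq_mul]
    _ ≤ _ := by gcongr

/-- estimate (2') -/
lemma est2 {i j : ℕ} (h : (c.I1.card : ℝ) ≤ (c.n + 2) ^ 2 * (c.I3 i j).card) (V : ℕ)
    (hV : ∀ Q, (c.P.filter (fun q => sqi j q = Q)).card ≤ V) :
    ((c.I3 i j).card : ℝ) * c.r * 2 ^ j ≤ 2 * 156 ^ 2 * 432 * C1 * c.L ^ 5 * c.P.card * V * 2 ^ c.n := by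
  obtain ⟨x0, hx0⟩ := c.I3_nonempty h
  have hg := (c.I3_mem hx0).2.2.1
  have h1 := c.PC_bound i j V hV
  have h2 := sum_le_image_mul (c.I3 i j) (fun y => (y.1, c.fc i j y)) (fun y => ((c.lvl y i).card : ℝ)) _
    (fun x hx => c.fiber_tri hg.hi hg.hj hx)
  change ∑ y ∈ c.I3 i j, ((c.lvl y i).card : ℝ) ≤ (c.PC i j).card * (156 * 2 ^ j * c.A * (432 * 2 ^ c.n / 2 ^ i)) at h2
  have hA := c.A_pos
  have hL := c.L_pos
  have hr := c.r_pos
  have hw : (0 : ℝ) < 2 ^ j := by positivity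
  have hd : (0 : ℝ) < 2 ^ i := by positivity
  have hD : (0 : ℝ) < 2 ^ c.n := by positivity
  have hC1 : (0 : ℝ) < C1 := by unfold C1; norm_num
  have h3 : ((c.I3 i j).card : ℝ) * (c.r / (2 * c.L)) ≤ ∑ y ∈ c.I3 i j, ((c.lvl y i).card : ℝ) := by
    rw [← nsmul_eq_mul, ← Finset.sum_const]
    refine Finset.sum_le_sum fun y hy => ?_
    obtain ⟨-, -, hgy, hy4, -⟩ := c.I3_mem hy
    refine le_trans ?_ hgy.hl
    have hn : (0 : ℝ) < c.n + 1 := by positivity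
    have : (c.n : ℝ) + 1 ≤ c.L := by unfold L; linarith
    calc c.r / (2 * c.L) = c.r / 2 / c.L := by rw [div_div]
      _ ≤ ((c.Pt y.2).card : ℝ) / (c.n + 1) := by gcongr
  have h4 := h3.trans h2
  have hpos : 0 < (2 ^ j * 2 ^ j * c.A : ℝ) := by positivity
  calc ((c.I3 i j).card : ℝ) * c.r * 2 ^ j = (((c.I3 i j).card : ℝ) * (c.r / (2 * c.L))) * (2 * c.L * 2 ^ j) := by
        field_simp
    _ ≤ ((c.PC i j).card * (156 * 2 ^ j * c.A * (432 * 2 ^ c.n / 2 ^ i))) * (2 * c.L * 2 ^ j) := by gcongr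
    _ = ((c.PC i j).card * ((2 ^ j) ^ 2 * c.A)) * (2 * c.L * 156 * (432 * 2 ^ c.n / 2 ^ i)) := by ring
    _ ≤ (156 * C1 * c.L ^ 4 * 2 ^ i * c.P.card * V) * (2 * c.L * 156 * (432 * 2 ^ c.n / 2 ^ i)) := by gcongr
    _ = _ := by field_simp

lemma sqi_coarse {i j : ℕ} (hj : j ≤ i) {p q : ℤ × ℤ} (h : sqi j p = sqi j q) : sqi i p = sqi i q := by
  obtain ⟨k, rfl⟩ := Nat.exists_eq_add_of_le hj
  simp only [sqi, Prod.mk.injEq] at *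
  have e : ∀ a : ℤ, a / 2 ^ (j + k) = a / 2 ^ j / 2 ^ k := fun a => by
    rw [pow_add, Int.ediv_ediv_of_nonneg (by positivity)]
  rw [e, e, e, e, h.1, h.2]; exact ⟨rfl, rfl⟩

lemma sqi_dist {j : ℕ} {p q : ℤ × ℤ} (h : sqi j p = sqi j q) : |p.1 - q.1| < 2 ^ j ∧ |p.2 - q.2| < 2 ^ j := by
  simp only [sqi, Prod.mk.injEq] at h
  have hpos : (0 : ℤ) < 2 ^ j := by positivity
  have a1 := Int.ediv_mul_le p.1 hpos.ne'
  have a2 := Int.lt_ediv_add_one_mul_self p.1 hpos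
  have b1 := Int.ediv_mul_le q.1 hpos.ne'
  have b2 := Int.lt_ediv_add_one_mul_self q.1 hpos
  have a3 := Int.ediv_mul_le p.2 hpos.ne'
  have a4 := Int.lt_ediv_add_one_mul_self p.2 hpos
  have b3 := Int.ediv_mul_le q.2 hpos.ne'
  have b4 := Int.lt_ediv_add_one_mul_self q.2 hpos
  rw [h.1] at a1 a2
  rw [h.2] at a3 a4
  rw [abs_lt, abs_lt]
  refine ⟨⟨?_, ?_⟩, ⟨?_, ?_⟩⟩ <;> linarith

/-- one `(σ, t)`: few good points -/
lemma fiber_st {i j : ℕ} (hj : j < i) (hjg : j ≤ c.g) {x : (ℤ × ℤ) × (ℤ × ℤ)} (hx : x ∈ c.I3 i j) {pm : ℤ × ℤ} (hpm : pm ∈ c.P) :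
    (((c.I3 i j).filter (fun y => (y.1.1 / 2 ^ i, y.2) = (x.1.1 / 2 ^ i, x.2))).card : ℝ) *
      (c.P.filter (fun q => sqi j q = sqi j pm)).card ≤ c.U * (c.K1 * (222 * 2 ^ j * c.A)) := by
  obtain ⟨hp, ht, hg, -, -⟩ := c.I3_mem hx
  set Fb := (c.I3 i j).filter (fun y => (y.1.1 / 2 ^ i, y.2) = (x.1.1 / 2 ^ i, x.2)) with hFb
  have hU := c.hU
  have hw := one_le_w j
  set Q := (strip c.P i (x.1.1 / 2 ^ i)).filter (fun q => |uu (2 ^ c.n) x.2 q| ≤ 6 * 2 ^ j) with hQ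
  have hQc : (Q.card : ℝ) ≤ 222 * 2 ^ j * c.A := by
    have h1 := near_count c.P (2 ^ c.n) i _ (2 ^ j) (by positivity) x.2 6 Q (Finset.filter_subset _ _)
      (fun q hq => (Finset.mem_filter.1 hq).2)
    refine h1.trans ?_
    calc _ ≤ (1 + 6 ^ 2) * 2 ^ j * (6 * c.A) := by have := hg.h2; gcongr
      _ = _ := by ring
  have hFb' : ∀ y ∈ Fb, y.1 ∈ c.P ∧ y.2 = x.2 ∧ y.1.1 / 2 ^ i = x.1.1 / 2 ^ i ∧ x.2 ∈ c.Tp y.1 ∧ ((c.nearT y).card : ℝ) ≤ c.K1 := by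
    intro y hy
    obtain ⟨hy1, hy2⟩ := Finset.mem_filter.1 hy
    obtain ⟨b1, b2, -, -, b3⟩ := c.I3_mem hy1
    have e1 : y.2 = x.2 := (Prod.mk.inj hy2).2
    have e2 : y.1.1 / 2 ^ i = x.1.1 / 2 ^ i := (Prod.mk.inj hy2).1
    rw [e1] at b2
    exact ⟨b1, e1, e2, b2, b3⟩
  have e1 : ∀ y ∈ Fb, ((c.P.filter (fun q => sqi j q = sqi j y.1)).card : ℝ) ≤ ∑ q ∈ Q, if sqi j q = sqi j y.1 then (1 : ℝ) else 0 := by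
    intro y hy
    obtain ⟨b1, b2, b3, b4, b5⟩ := hFb' y hy
    rw [Finset.sum_boole]
    norm_cast
    refine Finset.card_le_card fun q hq => ?_
    obtain ⟨q1, q2⟩ := Finset.mem_filter.1 hq
    have hco := sqi_coarse hj.le q2
    refine Finset.mem_filter.2 ⟨Finset.mem_filter.2 ⟨Finset.mem_filter.2 ⟨q1, ?_⟩, ?_⟩, q2⟩
    · have : q.1 / 2 ^ i = y.1.1 / 2 ^ i := congrArg Prod.fst hco
      rw [this, b3]; simp
    · obtain ⟨d1, d2⟩ := sqi_dist q2
      have hu := c.h2u _ b1 _ b4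
      have hk := c.h2k _ b1 _ b4
      have hk' : |(x.2.1 : ℝ) / 2 ^ c.n| ≤ 1 := by
        rw [abs_div, abs_of_pos (by positivity : (0 : ℝ) < 2 ^ c.n), div_le_one (by positivity)]; exact hk
      have d1' : |(q.1 : ℝ) - y.1.1| ≤ 2 ^ j := by exact_mod_cast d1.le
      have d2' : |(q.2 : ℝ) - y.1.2| ≤ 2 ^ j := by exact_mod_cast d2.le
      have : uu (2 ^ c.n) x.2 q = uu (2 ^ c.n) x.2 y.1 + ((q.2 : ℝ) - y.1.2) - (x.2.1 : ℝ) / 2 ^ c.n * ((q.1 : ℝ) - y.1.1) := by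
        unfold uu; ring
      have d3 : |(x.2.1 : ℝ) / 2 ^ c.n * ((q.1 : ℝ) - y.1.1)| ≤ 1 * 2 ^ j := by
        rw [abs_mul]; gcongr
      rw [this]
      rw [abs_le] at *
      constructor <;> linarith
  have e2 : ∀ q ∈ Q, ∑ y ∈ Fb, (if sqi j q = sqi j y.1 then (1 : ℝ) else 0) ≤ c.K1 := by
    intro q _
    rw [Finset.sum_boole]
    rcases Finset.eq_empty_or_nonempty (Fb.filter (fun y => sqi j q = sqi j y.1)) with h0 | ⟨y0, hy0⟩
    · rw [h0]; simpa using c.K1_pos.le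
    · obtain ⟨z1, z2⟩ := Finset.mem_filter.1 hy0
      obtain ⟨b1, b2, b3, b4, b5⟩ := hFb' y0 z1
      refine le_trans ?_ b5
      norm_cast
      refine Finset.card_le_card_of_injOn Prod.fst ?_ ?_
      · intro y hy
        obtain ⟨y1, y2⟩ := Finset.mem_filter.1 hy
        obtain ⟨a1, a2, a3, a4, a5⟩ := hFb' y y1
        refine Finset.mem_coe.2 (Finset.mem_filter.2 ⟨a1, by rw [b2]; exact a4, ?_⟩)
        have hd := sqi_dist (z2.symm.trans y2)
        have : ddn y0.1 y.1 ≤ 2 ^ j := by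
          unfold ddn; zify; exact max_le hd.1.le hd.2.le
        exact this.trans (Nat.pow_le_pow_right (by norm_num) hjg)
      · intro y hy z hz hyz
        have hy' := (hFb' y (Finset.mem_filter.1 hy).1).2.1
        have hz' := (hFb' z (Finset.mem_filter.1 hz).1).2.1
        exact Prod.ext hyz (hy'.trans hz'.symm)
  have hK1 := c.K1_pos
  calc _ = ∑ y ∈ Fb, ((c.P.filter (fun q => sqi j q = sqi j pm)).card : ℝ) := by rw [Finset.sum_const, nsmul_eq_mul]
    _ ≤ ∑ y ∈ Fb, c.U * ((c.P.filter (fun q => sqi j q = sqi j y.1)).card : ℝ) := by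
        refine Finset.sum_le_sum fun y hy => ?_
        exact c.hunif j (hj.le.trans hg.hi) pm hpm y.1 (hFb' y hy).1
    _ = c.U * ∑ y ∈ Fb, ((c.P.filter (fun q => sqi j q = sqi j y.1)).card : ℝ) := by rw [Finset.mul_sum]
    _ ≤ c.U * ∑ y ∈ Fb, ∑ q ∈ Q, (if sqi j q = sqi j y.1 then (1 : ℝ) else 0) := by
        apply mul_le_mul_of_nonneg_left (Finset.sum_le_sum e1); linarith
    _ = c.U * ∑ q ∈ Q, ∑ y ∈ Fb, (if sqi j q = sqi j y.1 then (1 : ℝ) else 0) := by rw [Finset.sum_comm]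
    _ ≤ c.U * ∑ q ∈ Q, c.K1 := by
        apply mul_le_mul_of_nonneg_left (Finset.sum_le_sum e2); linarith
    _ = c.U * (c.K1 * Q.card) := by rw [Finset.sum_const, nsmul_eq_mul, mul_comm c.K1]
    _ ≤ _ := by gcongr

/-- number of active `(σ, t)` -/
lemma st_card (i j : ℕ) :
    (((c.I3 i j).image (fun y => (y.1.1 / 2 ^ i, y.2))).card : ℝ) ≤ 5 * c.L * c.T.card := by
  set S := (c.I3 i j).image (fun y => (y.1.1 / 2 ^ i, y.2)) with hS
  have hL := c.L_pos
  have h1 := card_le_image_mul S Prod.snd (5 * c.L) (by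
    intro z hz
    obtain ⟨x, hx, rfl⟩ := Finset.mem_image.1 hz
    obtain ⟨hp, ht, hg, hr, -⟩ := c.I3_mem hx
    simp only
    set F := S.filter (fun y => y.2 = x.2) with hF
    have hPt : 0 < ((c.Pt x.2).card : ℝ) := lt_of_lt_of_le (by linarith [c.r_pos]) hr
    have hinj : F.card = (F.image Prod.fst).card := by
      rw [Finset.card_image_of_injOn]
      intro y hy z hz hyz
      exact Prod.ext hyz ((Finset.mem_filter.1 hy).2.trans (Finset.mem_filter.1 hz).2.symm)
    rw [hinj]
    have h2 := strip_sum (c.Pt x.2) i (F.image Prod.fst)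
    have h3 : ∑ σ ∈ F.image Prod.fst, ((c.Pt x.2).card : ℝ) / c.L ≤ ∑ σ ∈ F.image Prod.fst, ((strip (c.Pt x.2) i σ).card : ℝ) := by
      refine Finset.sum_le_sum fun σ hσ => ?_
      obtain ⟨y, hy, rfl⟩ := Finset.mem_image.1 hσ
      obtain ⟨hy1, hy2⟩ := Finset.mem_filter.1 hy
      obtain ⟨z, hz, rfl⟩ := Finset.mem_image.1 hy1
      have hgz := (c.I3_mem hz).2.2.1.hl
      simp only at hy2 ⊢
      rw [hy2] at hgz
      have hn : (0 : ℝ) < c.n + 1 := by positivity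
      have hnL : (c.n : ℝ) + 1 ≤ c.L := by unfold L; linarith
      calc _ ≤ ((c.Pt x.2).card : ℝ) / (c.n + 1) := by gcongr
        _ ≤ _ := hgz
        _ ≤ _ := by
          norm_cast
          refine Finset.card_le_card fun q hq => ?_
          have hs := (Finset.mem_filter.1 (c.lvl_strip hq)).2
          have hq' := (Finset.mem_filter.1 hq).1
          rw [hy2] at hq'
          exact Finset.mem_filter.2 ⟨hq', hs⟩
    rw [Finset.sum_const, nsmul_eq_mul] at h3
    have h4 := h3.trans h2
    rw [← mul_div_assoc, div_le_iff₀ hL] at h4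
    refine le_of_mul_le_mul_right ?_ hPt
    linarith)
  refine h1.trans ?_
  have : (S.image Prod.snd).card ≤ c.T.card := by
    refine Finset.card_le_card fun t ht => ?_
    obtain ⟨y, hy, rfl⟩ := Finset.mem_image.1 ht
    obtain ⟨z, hz, rfl⟩ := Finset.mem_image.1 hy
    obtain ⟨hp, ht, -⟩ := c.I3_mem hz
    exact c.h2T _ hp ht
  have h5 : ((S.image Prod.snd).card : ℝ) ≤ c.T.card := by exact_mod_cast this
  calc _ ≤ (c.T.card : ℝ) * (5 * c.L) := by gcongr
    _ = _ := by ring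

lemma est1 {i j : ℕ} (hj : j < i) (hjg : j ≤ c.g) {pm : ℤ × ℤ} (hpm : pm ∈ c.P) :
    ((c.I3 i j).card : ℝ) * (c.P.filter (fun q => sqi j q = sqi j pm)).card ≤
      1110 * c.L * c.T.card * c.U * c.K1 * 2 ^ j * c.A := by
  have hU := c.hU
  have hK1 := c.K1_pos
  have hA := c.A_pos
  have h1 := sum_le_image_mul (c.I3 i j) (fun y => (y.1.1 / 2 ^ i, y.2))
    (fun _ => ((c.P.filter (fun q => sqi j q = sqi j pm)).card : ℝ)) (c.U * (c.K1 * (222 * 2 ^ j * c.A))) (by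
      intro x hx
      rw [Finset.sum_const, nsmul_eq_mul]
      exact c.fiber_st hj hjg hx hpm)
  rw [Finset.sum_const, nsmul_eq_mul] at h1
  refine h1.trans ?_
  calc _ ≤ (5 * c.L * c.T.card) * (c.U * (c.K1 * (222 * 2 ^ j * c.A))) := by
        have := c.st_card i j
        gcongr
    _ = _ := by ring

end Cfg


namespace Cfg
variable (c : Cfg)

def CB : ℝ := 128 * (2 * 156 ^ 2 * 432 * C1) * 1110 * 512 * CA

lemma CB_big : 204 * CA ≤ CB ∧ 2048 ≤ CB := by
  unfold CB C1 CA; constructor <;> norm_num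

def X : ℝ := CB * c.L ^ 17 * c.K ^ 4 * c.U

lemma X_ge (k : ℕ) (hk : k ≤ 17) (b : ℝ) (hb0 : 0 ≤ b) (hb : b ≤ CB) : b * c.L ^ k * c.K ^ 2 ≤ c.X := by
  have hL := c.L_ge
  have hK := c.hK
  have hU := c.hU
  have h1 : c.L ^ k ≤ c.L ^ 17 := pow_le_pow_right₀ (by linarith) hk
  have h2 : c.K ^ 2 ≤ c.K ^ 4 := pow_le_pow_right₀ hK (by norm_num)
  have hCB : 0 ≤ CB := hb0.trans hb
  have hLp := c.L_pos
  unfold X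
  calc b * c.L ^ k * c.K ^ 2 ≤ CB * c.L ^ 17 * c.K ^ 4 * 1 := by rw [mul_one]; gcongr
    _ ≤ _ := by gcongr

lemma core : c.M * c.P.card ≤ c.X * c.T.card ∨ 2 ^ c.n * c.M ≤ c.X * c.T.card ∨
    c.M ^ 3 * c.P.card ≤ c.X * (c.T.card : ℝ) ^ 2 := by
  have hL := c.L_pos
  have hK := c.hK
  have hU := c.hU
  have hM := c.hM
  have hN := c.N_pos
  have hT := c.T_pos
  have hr0 := c.r_pos
  have hA := c.A_pos
  have hI := c.Inc_ge
  have hrm := c.r_mul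
  have hD : (0 : ℝ) < 2 ^ c.n := by positivity
  have hnL : (c.n : ℝ) + 1 ≤ c.L := by unfold L; linarith
  have hn1 : (0 : ℝ) < c.n + 1 := by positivity
  by_cases hr : c.r ≤ 2 * (c.n + 1) * c.K1
  · left
    have hK1 : c.K1 = 512 * c.K ^ 2 * c.L := rfl
    have h1 : c.r ≤ 2 * c.L * c.K1 := by
      refine hr.trans ?_
      have := c.K1_pos
      gcongr
    calc c.M * c.P.card ≤ 2 * (c.r * c.T.card) := by rw [hrm]; exact hI
      _ ≤ 2 * ((2 * c.L * c.K1) * c.T.card) := by gcongr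
      _ = (2048 * c.L ^ 2 * c.K ^ 2) * c.T.card := by rw [hK1]; ring
      _ ≤ _ := by
        have := c.X_ge 2 (by norm_num) 2048 (by norm_num) CB_big.2
        gcongr
  push Not at hr
  by_cases hr2 : c.r < 102 * (c.n + 1) * c.A
  · right; left
    have h1 : c.r ≤ 102 * c.L * c.A := by
      refine hr2.le.trans ?_
      gcongr
    have h2 : c.M * c.P.card ≤ 2 * ((102 * c.L * c.A) * c.T.card) := by
      calc c.M * c.P.card ≤ 2 * (c.r * c.T.card) := by rw [hrm]; exact hI
        _ ≤ _ := by gcongr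
    have hAe : c.A = CA * c.K ^ 2 * c.L ^ 6 * c.P.card / 2 ^ c.n := rfl
    have h3 : 2 ^ c.n * c.M ≤ (204 * CA * c.L ^ 7 * c.K ^ 2) * c.T.card := by
      refine le_of_mul_le_mul_right ?_ hN
      calc _ = 2 ^ c.n * (c.M * c.P.card) := by ring
        _ ≤ 2 ^ c.n * (2 * ((102 * c.L * c.A) * c.T.card)) := by gcongr
        _ = _ := by rw [hAe]; field_simp; ring
    refine h3.trans ?_
    have := c.X_ge 7 (by norm_num) (204 * CA) (by unfold CA; norm_num) CB_big.1
    gcongr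
  push Not at hr2
  right; right
  obtain ⟨i, j, hij⟩ := c.exists_I3 hr hr2
  obtain ⟨x0, hx0⟩ := c.I3_nonempty hij
  have hg := (c.I3_mem hx0).2.2.1
  by_cases hgj : c.g ≤ j
  · exact (c.case_big hij hgj).elim
  push Not at hgj
  obtain ⟨pm, hpm, hV⟩ := c.exists_V j
  have h1 := c.est1 (i := i) hg.hj hgj.le hpm
  have h2 := c.est2 hij _ hV
  have hVpos : (0 : ℝ) < ((c.P.filter (fun q => sqi j q = sqi j pm)).card : ℝ) := by
    have : 0 < (c.P.filter (fun q => sqi j q = sqi j pm)).card := Finset.card_pos.2 ⟨pm, Finset.mem_filter.2 ⟨hpm, rfl⟩⟩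
    exact_mod_cast this
  set V : ℝ := ((c.P.filter (fun q => sqi j q = sqi j pm)).card : ℝ) with hVd
  have h3 := c.I3_lower hij
  set I : ℝ := ((c.I3 i j).card : ℝ) with hId
  have hI0 : 0 ≤ I := by rw [hId]; positivity
  have hw : (0 : ℝ) < 2 ^ j := by positivity
  have hC1 : (0 : ℝ) < C1 := by unfold C1; norm_num
  have hK1 := c.K1_pos
  have hK1e : c.K1 = 512 * c.K ^ 2 * c.L := rfl
  have hAe : c.A = CA * c.K ^ 2 * c.L ^ 6 * c.P.card / 2 ^ c.n := rfl
  have k1 : I ^ 2 * c.r ≤ (2 * 156 ^ 2 * 432 * C1) * c.L ^ 5 * c.P.card * 2 ^ c.n * (1110 * c.L * c.T.card * c.U * c.K1 * c.A) := by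
    have hp : 0 < 2 ^ j * V := by positivity
    refine le_of_mul_le_mul_right ?_ hp
    calc _ = (I * c.r * 2 ^ j) * (I * V) := by ring
      _ ≤ (2 * 156 ^ 2 * 432 * C1 * c.L ^ 5 * c.P.card * V * 2 ^ c.n) * (1110 * c.L * c.T.card * c.U * c.K1 * 2 ^ j * c.A) := by
          gcongr
      _ = _ := by ring
  have k2 : I ^ 2 * c.r ≤ (2 * 156 ^ 2 * 432 * C1 * 1110 * 512 * CA) * c.L ^ 13 * c.K ^ 4 * c.U * c.P.card ^ 2 * c.T.card := by
    refine k1.trans (le_of_eq ?_)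
    rw [hK1e, hAe]; field_simp
  have k3 : (c.M * c.P.card) ^ 3 ≤ 128 * c.L ^ 4 * (I ^ 2 * c.r) * c.T.card := by
    have hMN : 0 ≤ c.M * c.P.card := by positivity
    calc (c.M * c.P.card) ^ 3 = (c.M * c.P.card) ^ 2 * (c.M * c.P.card) := by ring
      _ ≤ (8 * c.L ^ 2 * I) ^ 2 * (2 * (c.r * c.T.card)) := by
          rw [hrm]; gcongr
      _ = _ := by ring
  have hN2 : (0 : ℝ) < (c.P.card : ℝ) ^ 2 := by positivity
  refine le_of_mul_le_mul_right ?_ hN2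
  calc _ = (c.M * c.P.card) ^ 3 := by ring
    _ ≤ _ := k3
    _ ≤ 128 * c.L ^ 4 * ((2 * 156 ^ 2 * 432 * C1 * 1110 * 512 * CA) * c.L ^ 13 * c.K ^ 4 * c.U * c.P.card ^ 2 * c.T.card) * c.T.card := by
        gcongr
    _ = _ := by unfold X CB; ring

end Cfg


/-- number of points in the dyadic square of level `j` around `p` -/
def cnt (P : Finset (ℤ × ℤ)) (j : ℕ) (p : ℤ × ℤ) : ℕ := (P.filter (fun q => sqi j q = sqi j p)).card

lemma cnt_pos {P : Finset (ℤ × ℤ)} {j : ℕ} {p : ℤ × ℤ} (hp : p ∈ P) : 0 < cnt P j p :=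
  Finset.card_pos.2 ⟨p, Finset.mem_filter.2 ⟨hp, rfl⟩⟩

lemma box_card_le (n : ℕ) (P : Finset (ℤ × ℤ)) (hP : ∀ p ∈ P, 0 ≤ p.1 ∧ p.1 < 2 ^ n ∧ 0 ≤ p.2 ∧ p.2 < 2 ^ n) :
    P.card ≤ 4 ^ n := by
  have : P ⊆ Finset.Ico (0 : ℤ) (2 ^ n) ×ˢ Finset.Ico (0 : ℤ) (2 ^ n) := by
    intro p hp
    have := hP p hp
    simp only [Finset.mem_product, Finset.mem_Ico]; tauto
  have h := Finset.card_le_card this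
  rw [Finset.card_product, Int.card_Ico, sub_zero] at h
  have e : ((2 : ℤ) ^ n).toNat = 2 ^ n := by
    have : ((2 : ℤ) ^ n) = ((2 ^ n : ℕ) : ℤ) := by push_cast; rfl
    rw [this, Int.toNat_natCast]
  rw [e, ← mul_pow] at h
  exact h

lemma unif_step (n j : ℕ) (P : Finset (ℤ × ℤ)) (hne : P.Nonempty)
    (hP : ∀ p ∈ P, 0 ≤ p.1 ∧ p.1 < 2 ^ n ∧ 0 ≤ p.2 ∧ p.2 < 2 ^ n) :
    ∃ P' ⊆ P, P'.Nonempty ∧ P.card ≤ (2 * n + 1) * P'.card ∧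
      (∀ p ∈ P', ∀ q ∈ P, sqi j q = sqi j p → q ∈ P') ∧
      ∀ p ∈ P', ∀ q ∈ P', cnt P' j p ≤ 2 * cnt P' j q := by
  have hmap : ∀ p ∈ P, Nat.log 2 (cnt P j p) ∈ Finset.range (2 * n + 1) := by
    intro p hp
    rw [Finset.mem_range]
    have h1 : cnt P j p ≤ 2 ^ (2 * n) := by
      rw [pow_mul]
      exact (Finset.card_le_card (Finset.filter_subset _ _)).trans (box_card_le n P hP)
    have := Nat.log_mono_right (b := 2) h1
    rw [Nat.log_pow (by norm_num)] at this
    omega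
  have h1 := Finset.card_eq_sum_card_fiberwise hmap
  have hex : ∃ k ∈ Finset.range (2 * n + 1), P.card ≤ (2 * n + 1) * (P.filter (fun p => Nat.log 2 (cnt P j p) = k)).card := by
    by_contra hcon
    push Not at hcon
    have h2 : ∑ k ∈ Finset.range (2 * n + 1), (2 * n + 1) * (P.filter (fun p => Nat.log 2 (cnt P j p) = k)).card <
        ∑ k ∈ Finset.range (2 * n + 1), P.card := Finset.sum_lt_sum_of_nonempty (by simp) hcon
    rw [← Finset.mul_sum, Finset.sum_const, Finset.card_range, smul_eq_mul, ← h1] at h2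
    exact lt_irrefl _ h2
  obtain ⟨k, -, hk⟩ := hex
  set P' := P.filter (fun p => Nat.log 2 (cnt P j p) = k) with hP'
  have hsat : ∀ p ∈ P', ∀ q ∈ P, sqi j q = sqi j p → q ∈ P' := by
    intro p hp q hq h
    refine Finset.mem_filter.2 ⟨hq, ?_⟩
    have : cnt P j q = cnt P j p := by unfold cnt; rw [h]
    rw [this]; exact (Finset.mem_filter.1 hp).2
  have hcnt : ∀ p ∈ P', cnt P' j p = cnt P j p := by
    intro p hp
    unfold cnt
    congr 1
    ext q
    simp only [Finset.mem_filter]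
    constructor
    · rintro ⟨a, b⟩; exact ⟨(Finset.mem_filter.1 a).1, b⟩
    · rintro ⟨a, b⟩; exact ⟨hsat p hp q a b, b⟩
  refine ⟨P', Finset.filter_subset _ _, ?_, hk, hsat, ?_⟩
  · rw [← Finset.card_pos]
    by_contra h0
    have : P'.card = 0 := by omega
    rw [this] at hk
    have := hne.card_pos
    omega
  · intro p hp q hq
    rw [hcnt p hp, hcnt q hq]
    have a1 := (Finset.mem_filter.1 hp).2
    have a2 := (Finset.mem_filter.1 hq).2
    have b1 := Nat.lt_pow_succ_log_self (b := 2) (by norm_num) (cnt P j p)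
    have b2 := Nat.pow_log_le_self 2 (cnt_pos (P := P) (j := j) (Finset.mem_filter.1 hq).1).ne'
    rw [a1, pow_succ] at b1
    rw [a2] at b2
    omega

lemma unif_iter (n q : ℕ) (P : Finset (ℤ × ℤ)) (hne : P.Nonempty)
    (hP : ∀ p ∈ P, 0 ≤ p.1 ∧ p.1 < 2 ^ n ∧ 0 ≤ p.2 ∧ p.2 < 2 ^ n) (m : ℕ) :
    ∃ P' ⊆ P, P'.Nonempty ∧ P.card ≤ (2 * n + 1) ^ m * P'.card ∧
      ∀ l < m, ∀ p ∈ P', ∀ p' ∈ P', cnt P' (l * q) p ≤ 2 * cnt P' (l * q) p' := by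
  induction m with
  | zero => exact ⟨P, subset_rfl, hne, by simp, by simp⟩
  | succ m ih =>
    obtain ⟨P1, hsub1, hne1, hc1, hu1⟩ := ih
    obtain ⟨P2, hsub2, hne2, hc2, hsat, hu2⟩ := unif_step n (m * q) P1 hne1 (fun p hp => hP p (hsub1 hp))
    refine ⟨P2, hsub2.trans hsub1, hne2, ?_, ?_⟩
    · calc P.card ≤ (2 * n + 1) ^ m * P1.card := hc1
        _ ≤ (2 * n + 1) ^ m * ((2 * n + 1) * P2.card) := by gcongr
        _ = _ := by ring
    · intro l hl p hp p' hp'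
      rcases Nat.lt_or_ge l m with h | h
      · have hcnt : ∀ p ∈ P2, cnt P2 (l * q) p = cnt P1 (l * q) p := by
          intro p hp
          unfold cnt
          congr 1
          ext z
          simp only [Finset.mem_filter]
          constructor
          · rintro ⟨a, b⟩; exact ⟨hsub2 a, b⟩
          · rintro ⟨a, b⟩
            exact ⟨hsat p hp z a (Cfg.sqi_coarse (Nat.mul_le_mul_right q h.le) b), b⟩
        rw [hcnt p hp, hcnt p' hp']
        exact hu1 l h p (hsub2 hp) p' (hsub2 hp')
      · have : l = m := by omega
        subst this
        exact hu2 p hp p' hp'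

lemma sub_count (k : ℕ) (Q : ℤ × ℤ) (S : Finset (ℤ × ℤ)) (h : ∀ u ∈ S, sqi k u = Q) : S.card ≤ 4 ^ k := by
  have h1 : (S.image (fun u => (u.1 - Q.1 * 2 ^ k, u.2 - Q.2 * 2 ^ k))).card ≤ 4 ^ k := by
    refine box_card_le k _ fun p hp => ?_
    obtain ⟨u, hu, rfl⟩ := Finset.mem_image.1 hp
    have e := h u hu
    have hpos : (0 : ℤ) < 2 ^ k := by positivity
    have a1 := Int.ediv_mul_le u.1 hpos.ne'
    have a2 := Int.lt_ediv_add_one_mul_self u.1 hpos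
    have a3 := Int.ediv_mul_le u.2 hpos.ne'
    have a4 := Int.lt_ediv_add_one_mul_self u.2 hpos
    have e1 : u.1 / 2 ^ k = Q.1 := congrArg Prod.fst e
    have e2 : u.2 / 2 ^ k = Q.2 := congrArg Prod.snd e
    rw [e1] at a1 a2
    rw [e2] at a3 a4
    simp only
    refine ⟨by linarith, by linarith, by linarith, by linarith⟩
  rwa [Finset.card_image_of_injective] at h1
  intro a b hab
  simp only [Prod.mk.injEq, sub_left_inj] at hab
  exact Prod.ext hab.1 hab.2

lemma cnt_between (P : Finset (ℤ × ℤ)) (j0 k U : ℕ) (hu : ∀ p ∈ P, ∀ p' ∈ P, cnt P j0 p ≤ U * cnt P j0 p')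
    (p p' : ℤ × ℤ) (hp' : p' ∈ P) : cnt P (j0 + k) p ≤ 4 ^ k * U * cnt P (j0 + k) p' := by
  have hss : ∀ z, sqi (j0 + k) z = sqi k (sqi j0 z) := by
    intro z
    have e : ∀ a : ℤ, a / 2 ^ (j0 + k) = a / 2 ^ j0 / 2 ^ k := fun a => by
      rw [pow_add, Int.ediv_ediv_of_nonneg (by positivity)]
    simp only [sqi, e]
  have h1 : cnt P (j0 + k) p ≤ (U * cnt P j0 p') * ((P.filter (fun q => sqi (j0 + k) q = sqi (j0 + k) p)).image (sqi j0)).card := by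
    refine Finset.card_le_mul_card_image _ _ ?_
    intro b hb
    obtain ⟨z, hz, rfl⟩ := Finset.mem_image.1 hb
    refine le_trans (Finset.card_le_card ?_) (hu z (Finset.mem_filter.1 hz).1 p' hp')
    intro y hy
    obtain ⟨y1, y2⟩ := Finset.mem_filter.1 hy
    exact Finset.mem_filter.2 ⟨(Finset.mem_filter.1 y1).1, y2⟩
  have h2 : ((P.filter (fun q => sqi (j0 + k) q = sqi (j0 + k) p)).image (sqi j0)).card ≤ 4 ^ k := by
    refine sub_count k (sqi (j0 + k) p) _ ?_
    intro u hu
    obtain ⟨z, hz, rfl⟩ := Finset.mem_image.1 hu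
    rw [← hss]; exact (Finset.mem_filter.1 hz).2
  have h3 : cnt P j0 p' ≤ cnt P (j0 + k) p' := by
    refine Finset.card_le_card fun z hz => ?_
    obtain ⟨z1, z2⟩ := Finset.mem_filter.1 hz
    exact Finset.mem_filter.2 ⟨z1, Cfg.sqi_coarse (Nat.le_add_right _ _) z2⟩
  calc _ ≤ _ := h1
    _ ≤ (U * cnt P (j0 + k) p') * 4 ^ k := by gcongr
    _ = _ := by ring

lemma uniformize (ε : ℝ) (hε : 0 < ε) (n : ℕ) (P : Finset (ℤ × ℤ)) (hne : P.Nonempty)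
    (hP : ∀ p ∈ P, 0 ≤ p.1 ∧ p.1 < 2 ^ n ∧ 0 ≤ p.2 ∧ p.2 < 2 ^ n) :
    ∃ P' ⊆ P, P'.Nonempty ∧ P.card ≤ (2 * n + 1) ^ (⌊1 / ε⌋₊ + 1) * P'.card ∧
      ∀ j, ∀ p ∈ P', ∀ p' ∈ P', j ≤ n → (cnt P' j p : ℝ) ≤ (8 * (2 : ℝ) ^ (2 * ε * n)) * cnt P' j p' := by
  set q := ⌊ε * n⌋₊ + 1 with hq
  obtain ⟨P', hsub, hne', hc, hu⟩ := unif_iter n q P hne hP (⌊1 / ε⌋₊ + 1)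
  refine ⟨P', hsub, hne', hc, ?_⟩
  intro j p hp p' hp' hj
  have hl : j / q < ⌊1 / ε⌋₊ + 1 := by
    rw [Nat.lt_succ_iff]
    refine (Nat.div_le_div_right hj).trans ?_
    apply Nat.le_floor
    have hq1 : ε * n ≤ q := by rw [hq]; push_cast; exact (Nat.lt_floor_add_one _).le
    have hq0 : (0 : ℝ) < q := by rw [hq]; push_cast; positivity
    refine (Nat.cast_div_le).trans ?_
    rw [div_le_div_iff₀ hq0 hε]
    linarith
  have h1 := cnt_between P' (j / q * q) (j % q) 2 (hu _ hl) p p' hp'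
  rw [Nat.div_add_mod'] at h1
  have hmod : j % q ≤ q := (Nat.mod_lt _ (by omega)).le
  have h2 : (4 : ℝ) ^ (j % q) ≤ 4 * (2 : ℝ) ^ (2 * ε * n) := by
    calc (4 : ℝ) ^ (j % q) ≤ 4 ^ q := pow_le_pow_right₀ (by norm_num) hmod
      _ = 4 * 4 ^ ⌊ε * n⌋₊ := by rw [hq, pow_succ]; ring
      _ ≤ 4 * (2 : ℝ) ^ (2 * ε * n) := by
        gcongr
        rw [← Real.rpow_natCast, show (4 : ℝ) = (2 : ℝ) ^ (2 : ℝ) by norm_num, ← Real.rpow_mul (by norm_num)]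
        apply Real.rpow_le_rpow_of_exponent_le (by norm_num)
        have := Nat.floor_le (by positivity : 0 ≤ ε * n)
        linarith
  have h3 : (cnt P' j p : ℝ) ≤ (4 : ℝ) ^ (j % q) * 2 * cnt P' j p' := by exact_mod_cast h1
  refine h3.trans ?_
  have : (0 : ℝ) ≤ cnt P' j p' := by positivity
  nlinarith


lemma corner_mem {δ : ℝ} (hδ : 0 < δ) (q : ℤ × ℤ) : ((q.1 : ℝ) * δ, (q.2 : ℝ) * δ) ∈ dSq δ q := by
  simp only [dSq, Set.mem_prod, Set.mem_Ico]
  refine ⟨⟨le_rfl, ?_⟩, ⟨le_rfl, ?_⟩⟩ <;> nlinarith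

lemma dSq_unique {δ : ℝ} (hδ : 0 < δ) {q q' : ℤ × ℤ} {z : ℝ × ℝ} (h : z ∈ dSq δ q) (h' : z ∈ dSq δ q') : q = q' := by
  simp only [dSq, Set.mem_prod, Set.mem_Ico] at h h'
  have key : ∀ {a b : ℤ} {x : ℝ}, (a : ℝ) * δ ≤ x → x < ((a : ℝ) + 1) * δ → (b : ℝ) * δ ≤ x → x < ((b : ℝ) + 1) * δ → a = b := by
    intro a b x h1 h2 h3 h4
    have e1 : (a : ℝ) < b + 1 := lt_of_mul_lt_mul_right (h1.trans_lt h4) hδ.le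
    have e2 : (b : ℝ) < a + 1 := lt_of_mul_lt_mul_right (h3.trans_lt h2) hδ.le
    have e1' : a < b + 1 := by exact_mod_cast e1
    have e2' : b < a + 1 := by exact_mod_cast e2
    omega
  exact Prod.ext (key h.1.1 h.1.2 h'.1.1 h'.1.2) (key h.2.1 h.2.2 h'.2.1 h'.2.2)

lemma cov_sub {δ : ℝ} (hδ : 0 < δ) (S : Finset (ℤ × ℤ)) (B : Set (ℝ × ℝ)) (hB : B ⊆ sqUnion δ S) :
    {q : ℤ × ℤ | (dSq δ q ∩ B).Nonempty} ⊆ (S : Set (ℤ × ℤ)) := by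
  rintro q ⟨z, hz1, hz2⟩
  have := hB hz2
  simp only [sqUnion, Set.mem_iUnion] at this
  obtain ⟨p, hp, hz3⟩ := this
  rw [dSq_unique hδ hz1 hz3]
  exact hp

lemma cov_le {δ : ℝ} (hδ : 0 < δ) (S : Finset (ℤ × ℤ)) : covNum δ (sqUnion δ S) ≤ S.card := by
  unfold covNum
  have h := Nat.card_mono S.finite_toSet (cov_sub hδ S _ subset_rfl)
  simpa using h

lemma cov_ge {δ : ℝ} (hδ : 0 < δ) (S S' : Finset (ℤ × ℤ)) (hS : S' ⊆ S) (B : Set (ℝ × ℝ))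
    (h : ∀ q ∈ S', ((q.1 : ℝ) * δ, (q.2 : ℝ) * δ) ∈ B) : S'.card ≤ covNum δ (sqUnion δ S ∩ B) := by
  unfold covNum
  have hfin : {q : ℤ × ℤ | (dSq δ q ∩ (sqUnion δ S ∩ B)).Nonempty}.Finite :=
    S.finite_toSet.subset (cov_sub hδ S _ Set.inter_subset_left)
  have hsub : (S' : Set (ℤ × ℤ)) ⊆ {q : ℤ × ℤ | (dSq δ q ∩ (sqUnion δ S ∩ B)).Nonempty} := by
    intro q hq
    have hc := corner_mem hδ q
    refine ⟨_, hc, ?_, h q hq⟩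
    simp only [sqUnion, Set.mem_iUnion]
    exact ⟨q, hS hq, hc⟩
  have h := Nat.card_mono hfin hsub
  simpa using h

section conv
variable {n m : ℕ} {δ : ℝ}

lemma unit_idx (hδ : δ = 1 / 2 ^ n) {p : ℤ × ℤ} (h : sqInUnit δ p) :
    0 ≤ p.1 ∧ p.1 < 2 ^ n ∧ 0 ≤ p.2 ∧ p.2 < 2 ^ n := by
  have hD : (0 : ℝ) < 2 ^ n := by positivity
  have hδ0 : 0 < δ := by rw [hδ]; positivity
  have := h (corner_mem hδ0 p)
  simp only [Set.mem_prod, Set.mem_Ico] at this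
  obtain ⟨⟨a1, a2⟩, ⟨a3, a4⟩⟩ := this
  rw [hδ, mul_one_div, div_lt_one hD] at a2 a4
  have b1 : (0 : ℝ) ≤ p.1 := nonneg_of_mul_nonneg_left a1 hδ0
  have b3 : (0 : ℝ) ≤ p.2 := nonneg_of_mul_nonneg_left a3 hδ0
  refine ⟨by exact_mod_cast b1, by exact_mod_cast a2, by exact_mod_cast b3, by exact_mod_cast a4⟩

lemma tube_idx (hδ : δ = 1 / 2 ^ n) {t : ℤ × ℤ} (h : tubeIdx δ t) : |(t.1 : ℝ)| ≤ 2 ^ n := by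
  have hD : (0 : ℝ) < 2 ^ n := by positivity
  obtain ⟨h1, h2⟩ := h
  rw [hδ, mul_one_div, le_div_iff₀ hD] at h1
  rw [hδ, mul_one_div, div_le_one hD] at h2
  rw [abs_le]; constructor <;> linarith

lemma uu_le (hδ : δ = 1 / 2 ^ n) {p t : ℤ × ℤ} (hp : sqInUnit δ p) (ht : tubeIdx δ t)
    (h : (dTube δ t ∩ dSq δ p).Nonempty) : |uu (2 ^ n) t p| ≤ 4 := by
  have hD : (0 : ℝ) < 2 ^ n := by positivity
  have hδ0 : 0 < δ := by rw [hδ]; positivity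
  have hδD : δ * 2 ^ n = 1 := by rw [hδ]; field_simp
  obtain ⟨z, ⟨ab, hab, hz⟩, hzp⟩ := h
  have hz01 := hp hzp
  simp only [dSq, Set.mem_prod, Set.mem_Ico] at hab hzp hz01
  obtain ⟨⟨a1, a2⟩, ⟨a3, a4⟩⟩ := hab
  obtain ⟨⟨z1, z2⟩, ⟨z3, z4⟩⟩ := hzp
  have ht' : |(t.1 : ℝ) * δ| ≤ 1 := by
    rw [abs_mul, abs_of_pos hδ0]
    calc _ ≤ 2 ^ n * δ := by have := tube_idx hδ ht; gcongr
      _ = 1 := by linarith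
  have e : uu (2 ^ n) t p = 2 ^ n * ((p.2 * δ - z.2) + ((ab.1 - t.1 * δ) * z.1 + t.1 * δ * (z.1 - p.1 * δ)) + (ab.2 - t.2 * δ)) := by
    rw [hz]
    unfold uu
    have : (t.1 : ℝ) / 2 ^ n = t.1 * δ := by rw [hδ]; ring
    rw [this]
    linear_combination (-(p.2 : ℝ) + t.1 * δ * p.1 + t.2) * hδD
  have k1 : |(p.2 : ℝ) * δ - z.2| ≤ δ := by rw [abs_le]; constructor <;> linarith
  have k2 : |(ab.1 - t.1 * δ) * z.1| ≤ δ * 1 := by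
    rw [abs_mul]
    apply mul_le_mul _ _ (abs_nonneg _) hδ0.le
    · rw [abs_le]; constructor <;> linarith
    · rw [abs_le]; constructor <;> linarith [hz01.1.1, hz01.1.2]
  have k3 : |(t.1 : ℝ) * δ * (z.1 - p.1 * δ)| ≤ 1 * δ := by
    rw [abs_mul]
    apply mul_le_mul ht' _ (abs_nonneg _) zero_le_one
    rw [abs_le]; constructor <;> linarith
  have k4 : |ab.2 - (t.2 : ℝ) * δ| ≤ δ := by rw [abs_le]; constructor <;> linarith
  rw [e, abs_mul, abs_of_pos hD]
  calc _ ≤ 2 ^ n * (4 * δ) := by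
        gcongr
        rw [abs_le] at *
        constructor <;> linarith
    _ = 4 := by linarith

lemma h4_conv (hδ : δ = 1 / 2 ^ n) {s K0 M : ℝ} (hs0 : 0 < s) (hs1 : s ≤ 1) (hK0 : 1 ≤ K0) (hM : 0 ≤ M)
    {p : ℤ × ℤ} (hp : sqInUnit δ p) (S : Finset (ℤ × ℤ)) (hS : ∀ t ∈ S, |uu (2 ^ n) t p| ≤ 4)
    (hds : IsDSSet δ s K0 (sqUnion δ S)) (hc : (S.card : ℝ) ≤ 2 * M) (a0 ρ : ℝ) (h1 : 1 / 2 ^ n ≤ ρ) (h2 : ρ ≤ 1) :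
    ((S.filter (fun t => |(t.1 : ℝ) / 2 ^ n - a0| ≤ ρ)).card : ℝ) ≤ 12 * K0 * ρ ^ s * M := by
  have hD : (0 : ℝ) < 2 ^ n := by positivity
  have hδ0 : 0 < δ := by rw [hδ]; positivity
  have hδD : δ * 2 ^ n = 1 := by rw [hδ]; field_simp
  rw [← hδ] at h1
  have hρ : 0 < ρ := by linarith
  obtain ⟨p1, p2, p3, p4⟩ := unit_idx hδ hp
  have hps : 0 < ρ ^ s := Real.rpow_pos_of_pos hρ _
  have h6s : (6 : ℝ) ^ s ≤ 6 := by
    calc (6 : ℝ) ^ s ≤ 6 ^ (1 : ℝ) := Real.rpow_le_rpow_of_exponent_le (by norm_num) hs1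
      _ = 6 := Real.rpow_one _
  by_cases h6 : 6 * ρ ≤ 1
  · have hb := hds (a0, p.2 * δ - a0 * (p.1 * δ)) (6 * ρ) (by linarith) h6
    have hge := cov_ge hδ0 S (S.filter (fun t => |(t.1 : ℝ) / 2 ^ n - a0| ≤ ρ)) (Finset.filter_subset _ _)
      (ball (a0, p.2 * δ - a0 * (p.1 * δ)) (6 * ρ)) (by
        intro t ht
        obtain ⟨ht1, ht2⟩ := Finset.mem_filter.1 ht
        have hu := hS t ht1
        have e1 : (t.1 : ℝ) / 2 ^ n = t.1 * δ := by rw [hδ]; ring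
        rw [e1] at ht2
        have e2 : (t.2 : ℝ) * δ - (p.2 * δ - a0 * (p.1 * δ)) = -((t.1 * δ - a0) * (p.1 * δ)) - δ * uu (2 ^ n) t p := by
          unfold uu; rw [e1]; ring
        have hp1' : |(p.1 : ℝ) * δ| ≤ 1 := by
          have a : (0 : ℝ) ≤ p.1 := by exact_mod_cast p1
          have b : (p.1 : ℝ) ≤ 2 ^ n := by exact_mod_cast p2.le
          rw [abs_of_nonneg (by positivity)]
          calc _ ≤ 2 ^ n * δ := by gcongr
            _ = 1 := by linarith
        have k1 : |((t.1 : ℝ) * δ - a0) * (p.1 * δ)| ≤ ρ * 1 := by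
          rw [abs_mul]; gcongr
        have k2 : |δ * uu (2 ^ n) t p| ≤ δ * 4 := by
          rw [abs_mul, abs_of_pos hδ0]; gcongr
        rw [Metric.mem_ball, Prod.dist_eq, max_lt_iff, Real.dist_eq, Real.dist_eq]
        simp only
        rw [e2]
        constructor
        · linarith
        · rw [abs_lt]
          rw [abs_le] at k1 k2
          constructor <;> linarith)
    have hge' : ((S.filter (fun t => |(t.1 : ℝ) / 2 ^ n - a0| ≤ ρ)).card : ℝ) ≤
      covNum δ (sqUnion δ S ∩ ball (a0, p.2 * δ - a0 * (p.1 * δ)) (6 * ρ)) := by exact_mod_cast hge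
    have hle : (covNum δ (sqUnion δ S) : ℝ) ≤ S.card := by exact_mod_cast cov_le hδ0 S
    rw [Real.mul_rpow (by norm_num) hρ.le] at hb
    calc _ ≤ _ := hge'
      _ ≤ _ := hb
      _ ≤ K0 * (6 * ρ ^ s) * (2 * M) := by
        have := hle.trans hc
        gcongr
      _ = _ := by ring
  · push Not at h6
    have h7 : 1 ≤ 6 * ρ ^ s := by
      calc (1 : ℝ) ≤ (6 * ρ) ^ s := Real.one_le_rpow h6.le hs0.le
        _ = 6 ^ s * ρ ^ s := Real.mul_rpow (by norm_num) hρ.le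
        _ ≤ _ := by gcongr
    have h8 : ((S.filter (fun t => |(t.1 : ℝ) / 2 ^ n - a0| ≤ ρ)).card : ℝ) ≤ S.card := by
      exact_mod_cast Finset.card_le_card (Finset.filter_subset _ _)
    calc _ ≤ 2 * M := h8.trans hc
      _ = 1 * 1 * (2 * M) := by ring
      _ ≤ K0 * (6 * ρ ^ s) * (2 * M) := by gcongr
      _ = _ := by ring

lemma dist_corner (hδ0 : 0 < δ) {p q : ℤ × ℤ} {R ρ : ℝ} (h1 : |(q.1 : ℝ) - p.1| ≤ R) (h2 : |(q.2 : ℝ) - p.2| ≤ R)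
    (h : R * δ < ρ) : ((q.1 : ℝ) * δ, (q.2 : ℝ) * δ) ∈ ball ((p.1 : ℝ) * δ, (p.2 : ℝ) * δ) ρ := by
  rw [Metric.mem_ball, Prod.dist_eq, max_lt_iff, Real.dist_eq, Real.dist_eq]
  simp only
  rw [← sub_mul, ← sub_mul, abs_mul, abs_mul, abs_of_pos hδ0]
  constructor
  · exact lt_of_le_of_lt (by gcongr) h
  · exact lt_of_le_of_lt (by gcongr) h

lemma hbig_conv (hδ : δ = 1 / 2 ^ n) {s K0 : ℝ} (hs0 : 0 < s) (hs1 : s ≤ 1) (hK0 : 1 ≤ K0) (P : Finset (ℤ × ℤ))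
    (hmn : m ≤ n)
    (h : ∀ (x : ℝ × ℝ) (ρ : ℝ), 1 / 2 ^ m < ρ → ρ < 1 → (covNum δ (sqUnion δ P ∩ Metric.ball x ρ) : ℝ) ≤
            K0 * ρ ^ (2 - s) * (P.card : ℝ)) (j : ℕ) (hj : n - m - 2 ≤ j) (p : ℤ × ℤ) :
    (cnt P j p : ℝ) ≤ 64 * K0 * (2 ^ j / 2 ^ n : ℝ) ^ (2 - s) * P.card := by
  have hD : (0 : ℝ) < 2 ^ n := by positivity
  have hδ0 : 0 < δ := by rw [hδ]; positivity
  have hδD : δ * 2 ^ n = 1 := by rw [hδ]; field_simp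
  have hw : (0 : ℝ) < 2 ^ j := by positivity
  have e : (2 : ℝ) ^ j / 2 ^ n = 2 ^ j * δ := by rw [hδ]; ring
  rw [e]
  have hy : 0 < (2 : ℝ) ^ j * δ := by positivity
  set y := (2 : ℝ) ^ j * δ with hydef
  have hys : 0 < y ^ (2 - s) := Real.rpow_pos_of_pos hy _
  have h8s : (8 : ℝ) ^ (2 - s) ≤ 64 := by
    calc (8 : ℝ) ^ (2 - s) ≤ 8 ^ (2 : ℝ) := Real.rpow_le_rpow_of_exponent_le (by norm_num) (by linarith)
      _ = 64 := by norm_num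
  by_cases h8 : 8 * y < 1
  · have hΔ : 1 / 2 ^ m < 8 * y := by
      have e2 : 8 * y = 2 ^ (j + 3) / 2 ^ n := by rw [← e]; ring
      rw [e2, div_lt_div_iff₀ (by positivity) hD, one_mul, ← pow_add]
      exact pow_lt_pow_right₀ (by norm_num) (by omega)
    have hb := h ((p.1 : ℝ) * δ, (p.2 : ℝ) * δ) (8 * y) hΔ h8
    have hge := cov_ge hδ0 P (P.filter (fun q => sqi j q = sqi j p)) (Finset.filter_subset _ _)
      (ball ((p.1 : ℝ) * δ, (p.2 : ℝ) * δ) (8 * y)) (by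
        intro q hq
        obtain ⟨d1, d2⟩ := Cfg.sqi_dist (Finset.mem_filter.1 hq).2
        refine dist_corner hδ0 (R := 2 ^ j) ?_ ?_ (by rw [← hydef]; linarith)
        · exact_mod_cast d1.le
        · exact_mod_cast d2.le)
    have hge' : (cnt P j p : ℝ) ≤ covNum δ (sqUnion δ P ∩ ball ((p.1 : ℝ) * δ, (p.2 : ℝ) * δ) (8 * y)) := by
      exact_mod_cast hge
    rw [Real.mul_rpow (by norm_num) hy.le] at hb
    calc _ ≤ _ := hge'
      _ ≤ _ := hb
      _ ≤ K0 * (64 * y ^ (2 - s)) * P.card := by gcongr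
      _ = _ := by ring
  · push Not at h8
    have h7 : 1 ≤ 64 * y ^ (2 - s) := by
      calc (1 : ℝ) ≤ (8 * y) ^ (2 - s) := Real.one_le_rpow h8 (by linarith)
        _ = 8 ^ (2 - s) * y ^ (2 - s) := Real.mul_rpow (by norm_num) hy.le
        _ ≤ _ := by gcongr
    have h9 : (cnt P j p : ℝ) ≤ P.card := by
      exact_mod_cast Finset.card_le_card (Finset.filter_subset _ _)
    calc _ ≤ 1 * 1 * (P.card : ℝ) := by linarith
      _ ≤ K0 * (64 * y ^ (2 - s)) * P.card := by gcongr
      _ = _ := by ring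

lemma hsmall_conv (hδ : δ = 1 / 2 ^ n) {s K0 : ℝ} (hs0 : 0 < s) (hs1 : s ≤ 1) (hK0 : 1 ≤ K0) (P : Finset (ℤ × ℤ))
    (h : ∀ (x : ℝ × ℝ) (ρ : ℝ), δ < ρ → ρ < 1 / 2 ^ m → (covNum δ (sqUnion δ P ∩ Metric.ball x ρ) : ℝ) ≤
            K0 * (ρ / δ) ^ s) (j : ℕ) (hj : j ≤ n - m - 2) (p : ℤ × ℤ) :
    ((P.filter (fun q => ddn p q ≤ 2 ^ j)).card : ℝ) ≤ 64 * K0 * ((2 : ℝ) ^ j) ^ s := by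
  have hD : (0 : ℝ) < 2 ^ n := by positivity
  have hδ0 : 0 < δ := by rw [hδ]; positivity
  have hw : (0 : ℝ) < 2 ^ j := by positivity
  have hdd : ∀ q ∈ P.filter (fun q => ddn p q ≤ 2 ^ j), |q.1 - p.1| ≤ 2 ^ j ∧ |q.2 - p.2| ≤ 2 ^ j := by
    intro q hq
    have := (Finset.mem_filter.1 hq).2
    unfold ddn at this
    zify at this
    have := max_le_iff.1 this
    rw [abs_sub_comm, abs_sub_comm q.2]
    exact this
  by_cases hg : n - m - 2 = 0
  · have hj0 : j = 0 := by omega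
    subst hj0
    have hsub : P.filter (fun q => ddn p q ≤ 2 ^ 0) ⊆ Finset.Icc (p.1 - 1) (p.1 + 1) ×ˢ Finset.Icc (p.2 - 1) (p.2 + 1) := by
      intro q hq
      obtain ⟨d1, d2⟩ := hdd q hq
      rw [pow_zero, abs_le] at d1 d2
      simp only [Finset.mem_product, Finset.mem_Icc]
      omega
    have hc := Finset.card_le_card hsub
    rw [Finset.card_product, Int.card_Icc, Int.card_Icc] at hc
    have e1 : (p.1 + 1 + 1 - (p.1 - 1)).toNat = 3 := by omega
    have e2 : (p.2 + 1 + 1 - (p.2 - 1)).toNat = 3 := by omega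
    rw [e1, e2] at hc
    have hc' : ((P.filter (fun q => ddn p q ≤ 2 ^ 0)).card : ℝ) ≤ 9 := by exact_mod_cast hc
    refine hc'.trans ?_
    rw [pow_zero, Real.one_rpow]
    linarith
  · have hb := h ((p.1 : ℝ) * δ, (p.2 : ℝ) * δ) (2 * 2 ^ j * δ) (by
        have : (1 : ℝ) ≤ 2 ^ j := one_le_pow₀ (by norm_num)
        nlinarith) (by
        have e2 : 2 * 2 ^ j * δ = 2 ^ (j + 1) / 2 ^ n := by rw [hδ]; ring
        rw [e2, div_lt_div_iff₀ hD (by positivity), one_mul, ← pow_add]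
        exact pow_lt_pow_right₀ (by norm_num) (by omega))
    have hge := cov_ge hδ0 P (P.filter (fun q => ddn p q ≤ 2 ^ j)) (Finset.filter_subset _ _)
      (ball ((p.1 : ℝ) * δ, (p.2 : ℝ) * δ) (2 * 2 ^ j * δ)) (by
        intro q hq
        obtain ⟨d1, d2⟩ := hdd q hq
        refine dist_corner hδ0 (R := 2 ^ j) ?_ ?_ (by nlinarith)
        · exact_mod_cast d1
        · exact_mod_cast d2)
    have hge' : ((P.filter (fun q => ddn p q ≤ 2 ^ j)).card : ℝ) ≤
      covNum δ (sqUnion δ P ∩ ball ((p.1 : ℝ) * δ, (p.2 : ℝ) * δ) (2 * 2 ^ j * δ)) := by exact_mod_cast hge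
    rw [mul_div_cancel_right₀ _ hδ0.ne', Real.mul_rpow (by norm_num) hw.le] at hb
    have h2s : (2 : ℝ) ^ s ≤ 64 := by
      calc (2 : ℝ) ^ s ≤ 2 ^ (1 : ℝ) := Real.rpow_le_rpow_of_exponent_le (by norm_num) hs1
        _ ≤ 64 := by norm_num
    have hws : 0 < ((2 : ℝ) ^ j) ^ s := Real.rpow_pos_of_pos hw _
    calc _ ≤ _ := hge'
      _ ≤ _ := hb
      _ ≤ K0 * (64 * ((2 : ℝ) ^ j) ^ s) := by gcongr
      _ = _ := by ring

end conv


lemma core_final {n m M : ℕ} {δ s K0 ε : ℝ} {P T : Finset (ℤ × ℤ)} {Tp : ℤ × ℤ → Finset (ℤ × ℤ)}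
    (hδ : δ = 1 / 2 ^ n) (hs0 : 0 < s) (hs1 : s ≤ 1) (hε : 0 < ε) (hK0 : 1 ≤ K0) (hmn : m ≤ n)
    (hM : 0 < M) (hP : P.Nonempty) (hc : NiceConfig δ s K0 M P T Tp)
    (hb : ∀ (x : ℝ × ℝ) (ρ : ℝ), 1 / 2 ^ m < ρ → ρ < 1 → (covNum δ (sqUnion δ P ∩ Metric.ball x ρ) : ℝ) ≤
            K0 * ρ ^ (2 - s) * (P.card : ℝ))
    (hsm : ∀ (x : ℝ × ℝ) (ρ : ℝ), δ < ρ → ρ < 1 / 2 ^ m → (covNum δ (sqUnion δ P ∩ Metric.ball x ρ) : ℝ) ≤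
            K0 * (ρ / δ) ^ s) :
    ∃ Y : ℝ, 1 ≤ Y ∧
      Y ≤ Cfg.CB * 64 ^ 4 * 8 * (2 * n + 2 : ℝ) ^ (17 + 5 * (⌊1 / ε⌋₊ + 1)) * K0 ^ 4 * (2 : ℝ) ^ (2 * ε * n) ∧
      ((M : ℝ) * P.card ≤ Y * T.card ∨ 2 ^ n * (M : ℝ) ≤ Y * T.card ∨ (M : ℝ) ^ 3 * P.card ≤ Y * (T.card : ℝ) ^ 2) := by
  obtain ⟨c1, c2, c3⟩ := hc
  have hM' : (0 : ℝ) < M := by exact_mod_cast hM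
  obtain ⟨P', hsub, hne, hcard, hu⟩ := uniformize ε hε n P hP (fun p hp => unit_idx hδ (c1 p hp))
  set k := ⌊1 / ε⌋₊ + 1 with hk
  have hcard' : (P.card : ℝ) ≤ (2 * n + 1 : ℝ) ^ k * P'.card := by exact_mod_cast hcard
  set W : ℝ := (2 * n + 1 : ℝ) ^ k with hW
  have hn0 : (0 : ℝ) ≤ n := Nat.cast_nonneg n
  have hW1 : 1 ≤ W := one_le_pow₀ (by linarith)
  have hKK : 1 ≤ 64 * K0 * W := by nlinarith
  have hKle : 64 * K0 ≤ 64 * K0 * W := by nlinarith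
  have h2U : (1 : ℝ) ≤ 2 ^ (2 * ε * n) := Real.one_le_rpow (by norm_num) (by positivity)
  have huu : ∀ p ∈ P, ∀ t ∈ Tp p, |uu (2 ^ n) t p| ≤ 4 := fun p hp t ht =>
    uu_le hδ (c1 p hp) (c2 t ((c3 p hp).1 ht)) ((c3 p hp).2.2.2.2 t ht)
  let c : Cfg :=
    { n := n, g := n - m - 2, s := s, M := M, K := 64 * K0 * W, U := 8 * (2 : ℝ) ^ (2 * ε * n)
      P := P', T := T, Tp := Tp, hs0 := hs0, hs1 := hs1, hM := hM', hK := hKK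
      hU := by linarith
      hP := hne
      h1 := fun p hp => unit_idx hδ (c1 p (hsub hp))
      h2T := fun p hp => (c3 p (hsub hp)).1
      h2k := fun p hp t ht => tube_idx hδ (c2 t ((c3 p (hsub hp)).1 ht))
      h2u := fun p hp t ht => huu p (hsub hp) t ht
      h3a := fun p hp => (c3 p (hsub hp)).2.2.1
      h3b := fun p hp => (c3 p (hsub hp)).2.2.2.1
      h4 := by
        intro p hp a0 ρ h1 h2
        have h0 : 0 < ρ := lt_of_lt_of_le (by positivity) h1
        have hr := Real.rpow_pos_of_pos h0 s
        refine (h4_conv hδ hs0 hs1 hK0 hM'.le (c1 p (hsub hp)) (Tp p) (huu p (hsub hp)) (c3 p (hsub hp)).2.1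
          (c3 p (hsub hp)).2.2.2.1 a0 ρ h1 h2).trans ?_
        have : 12 * K0 ≤ 64 * K0 * W := by linarith
        gcongr
      hbig := by
        intro j hj hjn p hp
        have h := hbig_conv hδ hs0 hs1 hK0 P hmn hb j hj p
        have hle : (cnt P' j p : ℝ) ≤ cnt P j p := by
          exact_mod_cast Finset.card_le_card (Finset.filter_subset_filter _ hsub)
        have hr : (0 : ℝ) < (2 ^ j / 2 ^ n : ℝ) ^ (2 - s) := Real.rpow_pos_of_pos (by positivity) _
        refine (hle.trans h).trans ?_
        calc 64 * K0 * (2 ^ j / 2 ^ n : ℝ) ^ (2 - s) * P.card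
            ≤ 64 * K0 * (2 ^ j / 2 ^ n : ℝ) ^ (2 - s) * (W * P'.card) := by gcongr
          _ = _ := by ring
      hsmall := by
        intro j hj p hp
        have h := hsmall_conv hδ hs0 hs1 hK0 P hsm j hj p
        have hle : ((P'.filter (fun q => ddn p q ≤ 2 ^ j)).card : ℝ) ≤ (P.filter (fun q => ddn p q ≤ 2 ^ j)).card := by
          exact_mod_cast Finset.card_le_card (Finset.filter_subset_filter _ hsub)
        refine (hle.trans h).trans ?_
        gcongr
      hunif := fun j hj p hp q hq => hu j p hp q hq hj }
  have hcore := c.core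
  have hX : c.X = Cfg.CB * (n + 2 : ℝ) ^ 17 * (64 * K0 * W) ^ 4 * (8 * (2 : ℝ) ^ (2 * ε * n)) := rfl
  have e1 : c.M = M := rfl
  have e2 : c.P = P' := rfl
  have e3 : c.T = T := rfl
  have e4 : c.n = n := rfl
  rw [e1, e2, e3, e4] at hcore
  have hCB : 1 ≤ Cfg.CB := by linarith [Cfg.CB_big.2]
  have hX1 : 1 ≤ c.X := by
    rw [hX]
    have a1 : (1 : ℝ) ≤ (n + 2 : ℝ) ^ 17 := one_le_pow₀ (by linarith)
    have a2 : 1 ≤ (64 * K0 * W) ^ 4 := one_le_pow₀ hKK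
    exact one_le_mul_of_one_le_of_one_le (one_le_mul_of_one_le_of_one_le (one_le_mul_of_one_le_of_one_le hCB a1) a2) (by linarith)
  refine ⟨c.X * W, one_le_mul_of_one_le_of_one_le hX1 hW1, ?_, ?_⟩
  · rw [hX]
    have hV : W ≤ (2 * n + 2 : ℝ) ^ k := by rw [hW]; gcongr; norm_num
    calc Cfg.CB * (n + 2 : ℝ) ^ 17 * (64 * K0 * W) ^ 4 * (8 * (2 : ℝ) ^ (2 * ε * n)) * W
        ≤ Cfg.CB * (2 * n + 2 : ℝ) ^ 17 * (64 * K0 * (2 * n + 2 : ℝ) ^ k) ^ 4 * (8 * (2 : ℝ) ^ (2 * ε * n)) * (2 * n + 2 : ℝ) ^ k := by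
          gcongr
          linarith
      _ = _ := by rw [pow_add _ 17, mul_comm 5 k, pow_mul]; ring
  · have hT : (0 : ℝ) ≤ T.card := Nat.cast_nonneg _
    rcases hcore with h | h | h
    · left
      calc (M : ℝ) * P.card ≤ M * (W * P'.card) := by gcongr
        _ = W * (M * P'.card) := by ring
        _ ≤ W * (c.X * T.card) := by gcongr
        _ = _ := by ring
    · right; left
      refine h.trans ?_
      have : c.X ≤ c.X * W := by nlinarith
      gcongr
    · right; right
      calc (M : ℝ) ^ 3 * P.card ≤ M ^ 3 * (W * P'.card) := by gcongr
        _ = W * (M ^ 3 * P'.card) := by ring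
        _ ≤ W * (c.X * T.card ^ 2) := by gcongr
        _ = _ := by ring

lemma polylog (a : ℝ) (ha : 0 < a) (B : ℕ) (hB : 0 < B) :
    ∃ C : ℝ, 1 ≤ C ∧ ∀ n : ℕ, (2 * n + 2 : ℝ) ^ B ≤ C * (2 : ℝ) ^ (a * n) := by
  have hB' : (0 : ℝ) < B := by exact_mod_cast hB
  have hl : 0 < Real.log 2 := Real.log_pos (by norm_num)
  set κ := a / B * Real.log 2 with hκ
  have hκ0 : 0 < κ := by positivity
  refine ⟨(2 + 2 / κ) ^ B, one_le_pow₀ (by have : 0 < 2 / κ := by positivity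
                                           linarith), fun n => ?_⟩
  have hn0 : (0 : ℝ) ≤ n := Nat.cast_nonneg n
  have h1 : κ * n + 1 ≤ (2 : ℝ) ^ (a / B * n) := by
    rw [Real.rpow_def_of_pos (by norm_num)]
    have := Real.add_one_le_exp (Real.log 2 * (a / B * n))
    refine le_trans (le_of_eq ?_) this
    rw [hκ]; ring
  have h2 : (2 : ℝ) ^ (a * n) = ((2 : ℝ) ^ (a / B * n)) ^ B := by
    rw [← Real.rpow_natCast, ← Real.rpow_mul (by norm_num)]
    congr 1
    field_simp
  rw [h2, ← mul_pow]
  gcongr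
  calc (2 * n + 2 : ℝ) ≤ (2 + 2 / κ) * (κ * n + 1) := by
        have : (2 + 2 / κ) * (κ * n + 1) = 2 * κ * n + 2 + 2 * n + 2 / κ := by field_simp; ring
        have h3 : 0 < 2 / κ := by positivity
        have h4 : 0 ≤ 2 * κ * n := by positivity
        linarith
    _ ≤ _ := by gcongr

lemma final_main (s ε : ℝ) (hs0 : 0 < s) (hs1 : s ≤ 1) (hε : 0 < ε) :
    ∃ c > (0 : ℝ), ∀ (n m : ℕ) (δ Δ : ℝ), δ = 2 ^ (-(n : ℤ)) →
      Δ = 2 ^ (-(m : ℤ)) → δ ≤ Δ →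
      ∀ (M : ℕ) (P T : Finset (ℤ × ℤ)) (Tp : ℤ × ℤ → Finset (ℤ × ℤ)),
        NiceConfig δ s (δ ^ (-(ε ^ 2))) M P T Tp →
        (∀ (x : ℝ × ℝ) (ρ : ℝ), Δ < ρ → ρ < 1 →
          (covNum δ (sqUnion δ P ∩ Metric.ball x ρ) : ℝ) ≤
            δ ^ (-(ε ^ 2)) * ρ ^ (2 - s) * (P.card : ℝ)) →
        (∀ (x : ℝ × ℝ) (ρ : ℝ), δ < ρ → ρ < Δ →
          (covNum δ (sqUnion δ P ∩ Metric.ball x ρ) : ℝ) ≤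
            δ ^ (-(ε ^ 2)) * (ρ / δ) ^ s) →
        c * δ ^ (35 * ε) *
            min ((M : ℝ) * (P.card : ℝ))
              (min ((M : ℝ) ^ ((3 : ℝ) / 2) * (P.card : ℝ) ^ ((1 : ℝ) / 2))
                (δ⁻¹ * (M : ℝ)))
          ≤ (T.card : ℝ) := by
  obtain ⟨C, hC1, hC⟩ := polylog (29 * ε) (by positivity) (17 + 5 * (⌊1 / ε⌋₊ + 1)) (by omega)
  have hCB : 1 ≤ Cfg.CB := by linarith [Cfg.CB_big.2]
  set Z : ℝ := Cfg.CB * 64 ^ 4 * 8 * C with hZ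
  have hZ2 : 2 ≤ Z := by rw [hZ]; nlinarith [mul_le_mul hCB hC1 (by norm_num) (by linarith)]
  refine ⟨1 / Z, by positivity, ?_⟩
  intro n m δ Δ hδ hΔ hle M P T Tp hc hb hsm
  have hδ : δ = 1 / 2 ^ n := by rw [hδ, zpow_neg, zpow_natCast, one_div]
  have hΔ : Δ = 1 / 2 ^ m := by rw [hΔ, zpow_neg, zpow_natCast, one_div]
  have hmn : m ≤ n := by
    rw [hδ, hΔ, one_div_le_one_div (by positivity) (by positivity)] at hle
    exact (pow_le_pow_iff_right₀ (by norm_num : (1 : ℝ) < 2)).1 hle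
  have hδ0 : 0 < δ := by rw [hδ]; positivity
  have hδr : ∀ x : ℝ, δ ^ x = (2 : ℝ) ^ (-(x * n)) := by
    intro x
    rw [hδ, one_div, ← Real.rpow_natCast, ← Real.rpow_neg (by norm_num), ← Real.rpow_mul (by norm_num)]
    congr 1; ring
  have hn0 : (0 : ℝ) ≤ n := Nat.cast_nonneg n
  have hδp : 0 < δ ^ (35 * ε) := Real.rpow_pos_of_pos hδ0 _
  set mn := min ((M : ℝ) * (P.card : ℝ)) (min ((M : ℝ) ^ ((3 : ℝ) / 2) * (P.card : ℝ) ^ ((1 : ℝ) / 2))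
                (δ⁻¹ * (M : ℝ))) with hmn'
  have hT : (0 : ℝ) ≤ T.card := Nat.cast_nonneg _
  have hm1 : mn ≤ M * P.card := min_le_left _ _
  have hm2 : mn ≤ (M : ℝ) ^ ((3 : ℝ) / 2) * (P.card : ℝ) ^ ((1 : ℝ) / 2) := (min_le_right _ _).trans (min_le_left _ _)
  have hm3 : mn ≤ δ⁻¹ * (M : ℝ) := (min_le_right _ _).trans (min_le_right _ _)
  have hfin : mn ≤ Z * (2 : ℝ) ^ (35 * ε * n) * T.card → 1 / Z * δ ^ (35 * ε) * mn ≤ T.card := by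
    intro h
    have e : δ ^ (35 * ε) * (2 : ℝ) ^ (35 * ε * n) = 1 := by
      rw [hδr, ← Real.rpow_add (by norm_num)]; simp
    calc 1 / Z * δ ^ (35 * ε) * mn ≤ 1 / Z * δ ^ (35 * ε) * (Z * (2 : ℝ) ^ (35 * ε * n) * T.card) := by gcongr
      _ = (δ ^ (35 * ε) * (2 : ℝ) ^ (35 * ε * n)) * T.card := by field_simp
      _ = T.card := by rw [e, one_mul]
  apply hfin
  have hbigp : (1 : ℝ) ≤ 2 ^ (35 * ε * n) := Real.one_le_rpow (by norm_num) (by positivity)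
  by_cases hM : M = 0
  · rw [hM] at hm1
    simp only [Nat.cast_zero, zero_mul] at hm1
    exact hm1.trans (by positivity)
  by_cases hP : P.Nonempty
  swap
  · rw [Finset.not_nonempty_iff_eq_empty] at hP
    rw [hP] at hm1
    simp only [Finset.card_empty, Nat.cast_zero, mul_zero] at hm1
    exact hm1.trans (by positivity)
  have hM0 : 0 < M := Nat.pos_of_ne_zero hM
  have hMr : (0 : ℝ) < M := by exact_mod_cast hM0
  by_cases hε1 : 1 ≤ ε
  · obtain ⟨p, hp⟩ := hP
    obtain ⟨c1, c2, c3⟩ := hc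
    have t1 : ((Tp p).card : ℝ) ≤ T.card := by exact_mod_cast Finset.card_le_card (c3 p hp).1
    have t2 := (c3 p hp).2.2.1
    have hinv : δ⁻¹ ≤ (2 : ℝ) ^ (35 * ε * n) := by
      rw [← Real.rpow_neg_one, hδr]
      apply Real.rpow_le_rpow_of_exponent_le (by norm_num)
      nlinarith
    calc mn ≤ δ⁻¹ * M := hm3
      _ ≤ (2 : ℝ) ^ (35 * ε * n) * (2 * T.card) := by gcongr; linarith
      _ = 2 * (2 : ℝ) ^ (35 * ε * n) * T.card := by ring
      _ ≤ _ := by gcongr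
  push Not at hε1
  have hK0 : 1 ≤ δ ^ (-(ε ^ 2)) := by
    rw [hδr]
    apply Real.one_le_rpow (by norm_num)
    have : 0 ≤ ε ^ 2 * n := by positivity
    linarith
  rw [hΔ] at hb hsm
  obtain ⟨Y, hY1, hY2, hY3⟩ := core_final hδ hs0 hs1 hε hK0 hmn hM0 hP hc hb hsm
  have hY : Y ≤ Z * (2 : ℝ) ^ (35 * ε * n) := by
    refine hY2.trans ?_
    have hK4 : (δ ^ (-(ε ^ 2))) ^ 4 ≤ (2 : ℝ) ^ (4 * ε * n) := by
      rw [hδr, ← Real.rpow_natCast, ← Real.rpow_mul (by norm_num)]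
      apply Real.rpow_le_rpow_of_exponent_le (by norm_num)
      have : ε ^ 2 * n ≤ ε * n := by gcongr; nlinarith
      push_cast
      linarith
    calc Cfg.CB * 64 ^ 4 * 8 * (2 * n + 2 : ℝ) ^ (17 + 5 * (⌊1 / ε⌋₊ + 1)) * (δ ^ (-(ε ^ 2))) ^ 4 * (2 : ℝ) ^ (2 * ε * n)
        ≤ Cfg.CB * 64 ^ 4 * 8 * (C * (2 : ℝ) ^ (29 * ε * n)) * (2 : ℝ) ^ (4 * ε * n) * (2 : ℝ) ^ (2 * ε * n) := by
          have := hC n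
          gcongr
      _ = Z * ((2 : ℝ) ^ (29 * ε * n) * (2 : ℝ) ^ (4 * ε * n) * (2 : ℝ) ^ (2 * ε * n)) := by rw [hZ]; ring
      _ = _ := by
          rw [← Real.rpow_add (by norm_num), ← Real.rpow_add (by norm_num)]
          congr 2; ring
  suffices h : mn ≤ Y * T.card from h.trans (by gcongr)
  rcases hY3 with h | h | h
  · exact hm1.trans h
  · refine hm3.trans (le_trans (le_of_eq ?_) h)
    rw [hδ, one_div, inv_inv]
  · refine hm2.trans ?_
    have e : (M : ℝ) ^ ((3 : ℝ) / 2) * (P.card : ℝ) ^ ((1 : ℝ) / 2) = Real.sqrt ((M : ℝ) ^ 3 * P.card) := by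
      rw [Real.sqrt_eq_rpow, Real.mul_rpow (by positivity) (by positivity), ← Real.rpow_natCast, ← Real.rpow_mul hMr.le]
      norm_num
    rw [e]
    apply Real.sqrt_le_iff.2 ⟨by positivity, h.trans ?_⟩
    rw [mul_pow]
    gcongr
    nlinarith



/-- **The semi-well-spaced case.** Let `(𝒫, 𝒯)` be a `(δ, s, δ^{−ε²}, M)`-nice
configuration, with `𝒫` of dimension `2−s` above scale `Δ` and Katz–Tao
`s`-dimensional below scale `Δ`.  Then
`|𝒯|_δ ≳_ε δ^{35ε} · min(M|𝒫|_δ, M^{3/2}|𝒫|_δ^{1/2}, δ^{−1}M)`. -/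
theorem semi_well_spaced (s ε : ℝ) (hs0 : 0 < s) (hs1 : s ≤ 1) (hε : 0 < ε) :
    ∃ c > (0 : ℝ), ∀ (n m : ℕ) (δ Δ : ℝ), δ = 2 ^ (-(n : ℤ)) →
      Δ = 2 ^ (-(m : ℤ)) → δ ≤ Δ →
      ∀ (M : ℕ) (P T : Finset (ℤ × ℤ)) (Tp : ℤ × ℤ → Finset (ℤ × ℤ)),
        NiceConfig δ s (δ ^ (-(ε ^ 2))) M P T Tp →
        (∀ (x : ℝ × ℝ) (ρ : ℝ), Δ < ρ → ρ < 1 →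
          (covNum δ (sqUnion δ P ∩ Metric.ball x ρ) : ℝ) ≤
            δ ^ (-(ε ^ 2)) * ρ ^ (2 - s) * (P.card : ℝ)) →
        (∀ (x : ℝ × ℝ) (ρ : ℝ), δ < ρ → ρ < Δ →
          (covNum δ (sqUnion δ P ∩ Metric.ball x ρ) : ℝ) ≤
            δ ^ (-(ε ^ 2)) * (ρ / δ) ^ s) →
        c * δ ^ (35 * ε) *
            min ((M : ℝ) * (P.card : ℝ))
              (min ((M : ℝ) ^ ((3 : ℝ) / 2) * (P.card : ℝ) ^ ((1 : ℝ) / 2))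
                (δ⁻¹ * (M : ℝ)))
          ≤ (T.card : ℝ) := by
  exact final_main s ε hs0 hs1 hε

end
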